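/- Let h > 0, let l_plus = arccos( ((2+m3)/(2*(1+2*m3)))^(1/4) ) in (0, pi/2) be the Lagrange central configuration shape, set v_plus = sqrt(2*W(l_plus))/cos(l_plus), and let L_plus = (0, v_plus, l_plus, 0) and L_minus = (0, v_plus, -l_plus, 0) be the Lagrange triple collision restpoints with v > 0. Then for every u1 in (0, pi/2) there exists a solution (s,v,u,w) of the regularized blown-up system satisfying the energy relation such that (s,v,u,w)(tau) converges to L_plus as tau -> -infinity and converges to the restpoint (1, sqrt(2*h), u1, 0) on the infinity manifold as tau -> +infinity. Symmetrically, for every u1 in (-pi/2, 0) there exists such a heteroclinic solution from L_minus to (1, sqrt(2*h), u1, 0). If moreover m3 < 55/4, then there exist infinitely many heteroclinic orbits (pairwise not time-translates of one another) from L_plus to the Euler restpoint (1, sqrt(2*h), 0, 0), and likewise from L_minus. -/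

import Mathlib

open Real Filter Topology MeasureTheory

/-- The regularized shape potential `W(u)` of the isosceles three-body problem with
masses `m1 = m2 = 1`, `m3`, where `mu = 2*m3/(2+m3)`. -/
noncomputable def Wpot (m3 u : ℝ) : ℝ :=
  1 / Real.sqrt 2 +
    2 * m3 * Real.cos u ^ 2 /
      Real.sqrt (Real.cos u ^ 4 / 2 + (1 - Real.cos u ^ 4) / (2 * m3 / (2 + m3)))

/-- The energy function `E(s,v,u,w)` for energy `h`. -/
noncomputable def energyFn (m3 h s v u w : ℝ) : ℝ :=
  1 / 2 * (v ^ 2 * Real.cos u ^ 2 + w ^ 2) - (1 - s) * Wpot m3 u - h * s * Real.cos u ^ 2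

/-- `(s,v,u,w) : ℝ → ℝ` is a (globally defined) solution of the regularized blown-up
system of the isosceles three-body problem with mass `m3` and energy `h`. -/
def IsSolution (m3 h : ℝ) (s v u w : ℝ → ℝ) : Prop :=
  (∀ τ : ℝ, HasDerivAt s (v τ * s τ * (1 - s τ) * Real.cos (u τ) ^ 2) τ) ∧
  (∀ τ : ℝ, HasDerivAt v (1 / 2 * (1 - s τ) * v τ ^ 2 * Real.cos (u τ) ^ 2 + w τ ^ 2
      - (1 - s τ) * Wpot m3 (u τ)) τ) ∧
  (∀ τ : ℝ, HasDerivAt u (1 / 2 * Real.sqrt (1 + Real.cos (u τ) ^ 2) * w τ) τ) ∧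
  (∀ τ : ℝ, HasDerivAt w (-(1 / 2) * (1 + s τ) * v τ * w τ * Real.cos (u τ) ^ 2
      + 1 / 2 * Real.sqrt (1 + Real.cos (u τ) ^ 2) * (1 - s τ) * deriv (Wpot m3) (u τ)
      + 1 / 2 * (v τ ^ 2 - 2 * h * s τ) * Real.sqrt (1 + Real.cos (u τ) ^ 2)
          * Real.sin (u τ) * Real.cos (u τ)) τ)

/-- The solution satisfies the energy relation `E = 0` at all times. -/
def SatisfiesEnergy (m3 h : ℝ) (s v u w : ℝ → ℝ) : Prop :=
  ∀ τ : ℝ, energyFn m3 h (s τ) (v τ) (u τ) (w τ) = 0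

section GlobalFlow

variable {E : Type*} [NormedAddCommGroup E] [NormedSpace ℝ E]

/-- Two-sided Grönwall estimate for trajectories of a globally Lipschitz vector field. -/
theorem dist_le_of_trajectories_two_sided {f : ℝ → E → E} {K : NNReal}
    (hlip : ∀ t, LipschitzWith K (f t)) {α β : ℝ → E}
    (hα : ∀ t, HasDerivAt α (f t (α t)) t) (hβ : ∀ t, HasDerivAt β (f t (β t)) t) (a t : ℝ) :
    dist (α t) (β t) ≤ dist (α a) (β a) * Real.exp (K * |t - a|) := by
  rcases le_total a t with h | h
  · rw [abs_of_nonneg (sub_nonneg.2 h)]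
    exact dist_le_of_trajectories_ODE hlip
      (fun x _ => (hα x).continuousAt.continuousWithinAt) (fun x _ => (hα x).hasDerivWithinAt)
      (fun x _ => (hβ x).continuousAt.continuousWithinAt) (fun x _ => (hβ x).hasDerivWithinAt)
      le_rfl t ⟨h, le_rfl⟩
  · rw [abs_of_nonpos (sub_nonpos.2 h)]
    have key : ∀ {γ : ℝ → E}, (∀ t, HasDerivAt γ (f t (γ t)) t) →
        ∀ x, HasDerivAt (fun x => γ (-x)) ((fun x z => -f (-x) z) x (γ (-x))) x := by
      intro γ hγ x
      have := (hγ (-x)).scomp x (hasDerivAt_neg x)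
      simpa [Function.comp_def] using this
    have := dist_le_of_trajectories_ODE (v := fun x z => -f (-x) z) (K := K)
      (f := fun x => α (-x)) (g := fun x => β (-x)) (a := -a) (b := -t)
      (δ := dist (α a) (β a))
      (fun x => (hlip (-x)).neg)
      (fun x _ => (key hα x).continuousAt.continuousWithinAt)
      (fun x _ => (key hα x).hasDerivWithinAt)
      (fun x _ => (key hβ x).continuousAt.continuousWithinAt)
      (fun x _ => (key hβ x).hasDerivWithinAt) (by simp) (-t) ⟨by linarith, le_rfl⟩
    simp only [neg_neg] at this
    convert this using 3
    ring

variable [CompleteSpace E]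

/-- A bounded, globally Lipschitz vector field has global integral curves. -/
theorem exists_global_integralCurve {f : ℝ → E → E} {K L : NNReal}
    (hlip : ∀ t, LipschitzWith K (f t)) (hcont : ∀ z, Continuous fun t => f t z)
    (hb : ∀ t z, ‖f t z‖ ≤ L) (t₀ : ℝ) (z₀ : E) :
    ∃ γ : ℝ → E, γ t₀ = z₀ ∧ ∀ t, HasDerivAt γ (f t (γ t)) t := by
  have local_sol : ∀ n : ℕ, ∃ γ : ℝ → E, γ t₀ = z₀ ∧
      ∀ t ∈ Set.Ioo (t₀ - (n + 1)) (t₀ + (n + 1)), HasDerivAt γ (f t (γ t)) t := by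
    intro n
    have hpl : IsPicardLindelof f (tmin := t₀ - (n + 1)) (tmax := t₀ + (n + 1))
        ⟨t₀, by constructor <;> linarith [n.cast_nonneg (α := ℝ)]⟩ z₀ (L * (n + 1)) 0 L K :=
      { lipschitzOnWith := fun t _ => (hlip t).lipschitzOnWith
        continuousOn := fun z _ => (hcont z).continuousOn
        norm_le := fun t _ z _ => hb t z
        mul_max_le := by simp }
    obtain ⟨γ, h0, hγ⟩ := hpl.exists_eq_forall_mem_Icc_hasDerivWithinAt₀
    exact ⟨γ, h0, fun t ht => (hγ t (Set.Ioo_subset_Icc_self ht)).hasDerivAt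
      (Icc_mem_nhds ht.1 ht.2)⟩
  choose γ h0 hγ using local_sol
  have agree : ∀ m n : ℕ, m ≤ n → Set.EqOn (γ m) (γ n) (Set.Ioo (t₀ - (m + 1)) (t₀ + (m + 1))) := by
    intro m n hmn
    have hmn' : (m : ℝ) ≤ n := by exact_mod_cast hmn
    refine ODE_solution_unique_of_mem_Ioo (v := f) (K := K) (s := fun _ => Set.univ) (t₀ := t₀)
      (fun t _ => (hlip t).lipschitzOnWith) ?_ (fun t ht => ⟨hγ m t ht, trivial⟩)
      (fun t ht => ⟨hγ n t ⟨by linarith [ht.1], by linarith [ht.2]⟩, trivial⟩) ?_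
    · constructor <;> linarith [m.cast_nonneg (α := ℝ)]
    · rw [h0, h0]
  refine ⟨fun t => γ ⌈|t - t₀|⌉₊ t, by simp [h0], fun t => ?_⟩
  set N := ⌈|t - t₀|⌉₊
  have hN : |t - t₀| ≤ N := Nat.le_ceil _
  have hmem : ∀ (n : ℕ) (s : ℝ), |s - t₀| ≤ n → s ∈ Set.Ioo (t₀ - (n + 1)) (t₀ + (n + 1)) := by
    intro n s hs
    have := abs_le.1 hs
    constructor <;> linarith [this.1, this.2]
  refine (hγ N t (hmem N t hN)).congr_of_eventuallyEq ?_
  filter_upwards [Ioo_mem_nhds (hmem N t hN).1 (hmem N t hN).2] with s hs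
  rcases le_total ⌈|s - t₀|⌉₊ N with h | h
  · exact agree _ _ h (hmem _ s (Nat.le_ceil _))
  · exact (agree _ _ h hs).symm

/-- The flow of a bounded, globally Lipschitz vector field, jointly continuous in the initial time,
the initial value and the time. -/
theorem exists_continuous_flow {f : ℝ → E → E} {K L : NNReal}
    (hlip : ∀ t, LipschitzWith K (f t)) (hcont : ∀ z, Continuous fun t => f t z)
    (hb : ∀ t z, ‖f t z‖ ≤ L) :
    ∃ φ : ℝ → E → ℝ → E, (∀ t₀ z₀, φ t₀ z₀ t₀ = z₀) ∧
      (∀ t₀ z₀ t, HasDerivAt (φ t₀ z₀) (f t (φ t₀ z₀ t)) t) ∧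
      Continuous fun q : ℝ × E × ℝ => φ q.1 q.2.1 q.2.2 := by
  choose φ h0 hφ using exists_global_integralCurve hlip hcont hb
  refine ⟨φ, h0, hφ, continuous_iff_continuousAt.2 fun ⟨t₀, z₀, t⟩ => ?_⟩
  have hc : Continuous (φ t₀ z₀) :=
    continuous_iff_continuousAt.2 fun s => (hφ t₀ z₀ s).continuousAt
  rw [ContinuousAt, tendsto_iff_dist_tendsto_zero]
  have hbound : Continuous fun q : ℝ × E × ℝ =>
      dist q.2.1 (φ t₀ z₀ q.1) * Real.exp (K * |q.2.2 - q.1|) +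
        dist (φ t₀ z₀ q.2.2) (φ t₀ z₀ t) := by fun_prop
  have hlim := hbound.tendsto (t₀, z₀, t)
  simp only [h0, dist_self, zero_mul, add_zero] at hlim
  refine squeeze_zero (fun _ => dist_nonneg) (fun q => ?_) hlim
  refine (dist_triangle _ (φ t₀ z₀ q.2.2) _).trans (add_le_add_left ?_ _)
  have := dist_le_of_trajectories_two_sided hlip (hφ q.1 q.2.1) (hφ t₀ z₀) q.1 q.2.2
  rwa [h0] at this

end GlobalFlow

section RealLemmas

theorem HasDerivAt.eventually_lt_left {f : ℝ → ℝ} {f' x : ℝ} (hf : HasDerivAt f f' x)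
    (h : 0 < f') : ∀ᶠ y in 𝓝[<] x, f y < f x := by
  have := (hasDerivWithinAt_iff_tendsto_slope' (s := Set.Iio x) (by simp)).1 hf.hasDerivWithinAt
  filter_upwards [this.eventually (lt_mem_nhds h), self_mem_nhdsWithin] with y hy hyx
  rw [slope_def_field] at hy
  have hyx' : y - x < 0 := sub_neg.2 hyx
  have := mul_neg_of_pos_of_neg hy hyx'
  rw [div_mul_cancel₀ _ hyx'.ne] at this
  linarith

theorem mul_sub_le_of_hasDerivAt {f f' : ℝ → ℝ} {a b c : ℝ} (hab : a ≤ b)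
    (hf : ∀ x ∈ Set.Icc a b, HasDerivAt f (f' x) x) (hc : ∀ x ∈ Set.Icc a b, c ≤ f' x) :
    c * (b - a) ≤ f b - f a := by
  refine (convex_Icc a b).mul_sub_le_image_sub_of_le_deriv
    (fun x hx => (hf x hx).continuousAt.continuousWithinAt)
    (fun x hx => (hf x (interior_subset hx)).differentiableAt.differentiableWithinAt)
    (fun x hx => ?_) a ⟨le_rfl, hab⟩ b ⟨hab, le_rfl⟩ hab
  rw [(hf x (interior_subset hx)).deriv]
  exact hc x (interior_subset hx)

theorem le_of_hasDerivAt_nonneg {f f' : ℝ → ℝ} {a b : ℝ} (hab : a ≤ b)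
    (hf : ∀ x ∈ Set.Icc a b, HasDerivAt f (f' x) x) (hc : ∀ x ∈ Set.Icc a b, 0 ≤ f' x) :
    f a ≤ f b := by
  have := mul_sub_le_of_hasDerivAt hab hf hc
  linarith

theorem exists_first_zero {f : ℝ → ℝ} (hf : Continuous f) {a b : ℝ} (hab : a ≤ b)
    (ha : 0 ≤ f a) (hb : f b ≤ 0) :
    ∃ x ∈ Set.Icc a b, f x = 0 ∧ ∀ y ∈ Set.Ico a x, 0 < f y := by
  have hK : IsCompact (Set.Icc a b ∩ {y | f y ≤ 0}) :=
    isCompact_Icc.inter_right (isClosed_le hf continuous_const)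
  obtain ⟨x, ⟨hx, hfx⟩, hmin⟩ := hK.exists_isLeast ⟨b, ⟨hab, le_rfl⟩, hb⟩
  have hpos : ∀ y ∈ Set.Ico a x, 0 < f y := fun y hy => by
    by_contra! hcon
    exact absurd (hmin ⟨⟨hy.1, hy.2.le.trans hx.2⟩, hcon⟩) (not_le.2 hy.2)
  refine ⟨x, hx, le_antisymm hfx ?_, hpos⟩
  rcases hx.1.eq_or_lt with rfl | hax
  · exact ha
  · refine ge_of_tendsto (hf.continuousWithinAt (s := Set.Iio x) (x := x)) ?_
    filter_upwards [Ioo_mem_nhdsLT hax] with y hy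
    exact (hpos y ⟨hy.1.le, hy.2⟩).le

/-- A function which increases at each of its zeros stays positive once it is positive. -/
theorem pos_of_deriv_pos_of_eq_zero {f f' : ℝ → ℝ} {a : ℝ} (hf : ∀ x, HasDerivAt f (f' x) x)
    (ha : 0 < f a) (h0 : ∀ x, a ≤ x → f x = 0 → 0 < f' x) {x : ℝ} (hx : a ≤ x) : 0 < f x := by
  by_contra! hcon
  obtain ⟨y, hy, hy0, hpos⟩ := exists_first_zero
    (continuous_iff_continuousAt.2 fun x => (hf x).continuousAt) hx ha.le hcon
  have hay : a < y := hy.1.lt_of_ne (fun h => by rw [← h] at hy0; linarith)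
  obtain ⟨z, hz, hz'⟩ := (((hf y).eventually_lt_left (h0 y hy.1 hy0)).and
    (Ioo_mem_nhdsLT hay)).exists
  linarith [hpos z ⟨hz'.1.le, hz'.2⟩]

/-- If `f` is nondecreasing as long as it is above the level `c`, then it is so forever
after being above `c` once. -/
theorem le_and_lt_of_deriv_nonneg_above {f f' : ℝ → ℝ} {a c : ℝ} (hc : Continuous f)
    (hf : ∀ x, a ≤ x → c < f x → HasDerivAt f (f' x) x ∧ 0 ≤ f' x) (ha : c < f a) {x : ℝ}
    (hx : a ≤ x) : c < f x := by
  by_contra! hcon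
  obtain ⟨y, hy, hy0, hpos⟩ := exists_first_zero (f := fun x => f x - c)
    (hc.sub continuous_const) hx (sub_nonneg.2 ha.le) (sub_nonpos.2 hcon)
  have hay : a < y := hy.1.lt_of_ne (fun h => by rw [← h] at hy0; linarith)
  have : f a ≤ f y := by
    refine ge_of_tendsto (hc.continuousWithinAt (s := Set.Iio y) (x := y)) ?_
    filter_upwards [Ioo_mem_nhdsLT hay] with z hz
    have hz' : ∀ w ∈ Set.Icc a z, c < f w := fun w hw =>
      sub_pos.1 (hpos w ⟨hw.1, hw.2.trans_lt hz.2⟩)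
    exact le_of_hasDerivAt_nonneg hz.1.le (fun w hw => (hf w hw.1 (hz' w hw)).1)
      (fun w hw => (hf w hw.1 (hz' w hw)).2)
  linarith

/-- The set of parameters for which `a` becomes negative before `b` ceases to be positive is
open. -/
theorem isOpen_exists_neg_forall_pos {X : Type*} [TopologicalSpace X] {a b : X × ℝ → ℝ}
    (ha : Continuous a) (hb : Continuous b) :
    IsOpen {x | ∃ r, 0 ≤ r ∧ a (x, r) < 0 ∧ ∀ r' ∈ Set.Icc 0 r, 0 < b (x, r')} := by
  refine isOpen_iff_mem_nhds.2 fun x ⟨r, hr, hra, hrb⟩ => ?_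
  have h1 : ∀ᶠ y in 𝓝 x, a (y, r) < 0 :=
    (ha.comp (by fun_prop : Continuous fun y => (y, r))).continuousAt.eventually
      (gt_mem_nhds hra)
  have h2 : ∀ᶠ y in 𝓝 x, ∀ r' ∈ Set.Icc 0 r, 0 < b (y, r') :=
    isCompact_Icc.eventually_forall_of_forall_eventually fun r' hr' =>
      hb.continuousAt.eventually (lt_mem_nhds (hrb r' hr'))
  filter_upwards [h1, h2] with y hy1 hy2
  exact ⟨r, hr, hy1, hy2⟩

theorem not_exists_neg_forall_pos_and {a b : ℝ → ℝ}
    (h1 : ∃ r, 0 ≤ r ∧ a r < 0 ∧ ∀ r' ∈ Set.Icc 0 r, 0 < b r')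
    (h2 : ∃ r, 0 ≤ r ∧ b r < 0 ∧ ∀ r' ∈ Set.Icc 0 r, 0 < a r') : False := by
  obtain ⟨r, hr, hra, hrb⟩ := h1
  obtain ⟨s, hs, hsb, hsa⟩ := h2
  rcases le_total r s with h | h
  · linarith [hsa r ⟨hr, h⟩]
  · linarith [hrb s ⟨hs, h⟩]

/-- Exit alternative: starting with `a, b ≥ 0`, if `a` and `b` never vanish simultaneously and
each changes sign when it vanishes first, then either one of them becomes negative while the other
is still positive, or both stay positive. -/
theorem exit_alternative {a b : ℝ → ℝ} (ha : Continuous a) (hb : Continuous b)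
    (ha0 : 0 ≤ a 0) (hb0 : 0 ≤ b 0)
    (h : ∀ r, 0 ≤ r → (∀ r' ∈ Set.Ico 0 r, 0 < a r' ∧ 0 < b r') →
      (a r = 0 → 0 < b r → ∃ᶠ s in 𝓝[>] r, a s < 0) ∧
      (b r = 0 → 0 < a r → ∃ᶠ s in 𝓝[>] r, b s < 0) ∧ ¬(a r = 0 ∧ b r = 0)) :
    (∃ r, 0 ≤ r ∧ a r < 0 ∧ ∀ r' ∈ Set.Icc 0 r, 0 < b r') ∨
    (∃ r, 0 ≤ r ∧ b r < 0 ∧ ∀ r' ∈ Set.Icc 0 r, 0 < a r') ∨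
    ∀ r, 0 ≤ r → 0 < a r ∧ 0 < b r := by
  by_cases hall : ∀ r, 0 ≤ r → 0 < a r ∧ 0 < b r
  · exact Or.inr (Or.inr hall)
  push Not at hall
  obtain ⟨R, hR, hR'⟩ := hall
  have hmin : min (a R) (b R) ≤ 0 := by
    by_contra! hcon
    exact absurd (hR' (hcon.trans_le (min_le_left _ _)))
      (not_le.2 (hcon.trans_le (min_le_right _ _)))
  obtain ⟨r, hr, hr0, hpos⟩ := exists_first_zero (ha.min hb) hR (le_min ha0 hb0) hmin
  simp only [lt_min_iff] at hpos
  obtain ⟨h1, h2, h3⟩ := h r hr.1 hpos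
  have key : ∀ {a b : ℝ → ℝ}, Continuous b → (∃ᶠ s in 𝓝[>] r, a s < 0) →
      (∀ r' ∈ Set.Ico 0 r, 0 < b r') → 0 < b r →
      ∃ r, 0 ≤ r ∧ a r < 0 ∧ ∀ r' ∈ Set.Icc 0 r, 0 < b r' := by
    intro a b hb hfr hbpos hbr
    obtain ⟨ε, hε, hball⟩ := Metric.eventually_nhds_iff.1
      (hb.continuousAt.eventually (lt_mem_nhds hbr))
    obtain ⟨s, hs, hs'⟩ := (hfr.and_eventually
      (Ioo_mem_nhdsGT (show r < r + ε by linarith))).exists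
    refine ⟨s, hr.1.trans hs'.1.le, hs, fun r' hr' => ?_⟩
    rcases lt_or_ge r' r with hlt | hge
    · exact hbpos r' ⟨hr'.1, hlt⟩
    · refine hball ?_
      rw [Real.dist_eq, abs_of_nonneg (sub_nonneg.2 hge)]
      linarith [hr'.2, hs'.2]
  rcases lt_trichotomy (a r) (b r) with hlt | heq | hgt
  · rw [min_eq_left hlt.le] at hr0
    exact Or.inl (key hb (h1 hr0 (hr0 ▸ hlt)) (fun r' hr' => (hpos r' hr').2) (hr0 ▸ hlt))
  · rw [heq, min_self] at hr0
    exact absurd ⟨heq.trans hr0, hr0⟩ h3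
  · rw [min_eq_right hgt.le] at hr0
    exact Or.inr (Or.inl (key ha (h2 hr0 (hr0 ▸ hgt)) (fun r' hr' => (hpos r' hr').1)
      (hr0 ▸ hgt)))

end RealLemmas

section ReducedSystem

/-- The acceleration of the shape variable `θ` in the reduced system, the independent variable
being `x = log (s / (1 - s))`. -/
noncomputable def shapeAcc (h : ℝ) (V dV : ℝ → ℝ) (x θ g : ℝ) : ℝ :=
  (1 + g ^ 2) / 2 * (dV θ / (V θ + h * exp x) - g * (1 + h * exp x / (V θ + h * exp x)))

/-- Clamping to the interval `[-M, M]`. -/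
def clampSym (M g : ℝ) : ℝ := max (-M) (min g M)

/-- The reduced system with clamped velocity, as a globally Lipschitz vector field. -/
noncomputable def clampedField (h : ℝ) (V dV : ℝ → ℝ) (M x : ℝ) (z : ℝ × ℝ) : ℝ × ℝ :=
  (clampSym M z.2, shapeAcc h V dV x z.1 (clampSym M z.2))

/-- A bounded Lipschitz potential `V` with derivative `dV` on the interval `(lo, hi)`. -/
structure ShapePotential (V dV : ℝ → ℝ) (lo hi c B : ℝ) : Prop where
  lip : ∃ K : NNReal, LipschitzWith K V
  lip_deriv : ∃ K : NNReal, LipschitzWith K dV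
  pos : 0 < c
  le : ∀ θ, c ≤ V θ
  le_bound : ∀ θ, V θ ≤ B
  abs_deriv_le : ∀ θ, |dV θ| ≤ B
  hasDerivAt : ∀ θ ∈ Set.Ioo lo hi, HasDerivAt V (dV θ) θ

/-- Bounded and Lipschitz, uniformly in the time parameter. -/
def UnifLip (F : ℝ → ℝ × ℝ → ℝ) : Prop :=
  ∃ K B : ℝ, 0 ≤ K ∧ 0 ≤ B ∧ (∀ x z z', |F x z - F x z'| ≤ K * dist z z') ∧ ∀ x z, |F x z| ≤ B

theorem UnifLip.const (a : ℝ) : UnifLip fun _ _ => a :=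
  ⟨0, |a|, le_rfl, abs_nonneg _, by simp, by simp⟩

theorem UnifLip.add {F G : ℝ → ℝ × ℝ → ℝ} (hF : UnifLip F) (hG : UnifLip G) :
    UnifLip fun x z => F x z + G x z := by
  obtain ⟨K, B, hK, hB, h1, h2⟩ := hF
  obtain ⟨K', B', hK', hB', h1', h2'⟩ := hG
  refine ⟨K + K', B + B', by positivity, by positivity, fun x z z' => ?_, fun x z => ?_⟩
  · have := abs_add_le (F x z - F x z') (G x z - G x z')
    rw [show F x z + G x z - (F x z' + G x z') = F x z - F x z' + (G x z - G x z') by ring]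
    linarith [h1 x z z', h1' x z z']
  · linarith [abs_add_le (F x z) (G x z), h2 x z, h2' x z]

theorem UnifLip.mul {F G : ℝ → ℝ × ℝ → ℝ} (hF : UnifLip F) (hG : UnifLip G) :
    UnifLip fun x z => F x z * G x z := by
  obtain ⟨K, B, hK, hB, h1, h2⟩ := hF
  obtain ⟨K', B', hK', hB', h1', h2'⟩ := hG
  refine ⟨B * K' + B' * K, B * B', by positivity, by positivity, fun x z z' => ?_, fun x z => ?_⟩
  · have := abs_add_le (F x z * (G x z - G x z')) ((F x z - F x z') * G x z')
    rw [abs_mul, abs_mul] at this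
    rw [show F x z * G x z - F x z' * G x z' =
      F x z * (G x z - G x z') + (F x z - F x z') * G x z' by ring]
    have e1 := mul_le_mul (h2 x z) (h1' x z z') (abs_nonneg _) hB
    have e2 := mul_le_mul (h1 x z z') (h2' x z') (abs_nonneg _) (by positivity)
    linarith
  · rw [abs_mul]
    exact mul_le_mul (h2 x z) (h2' x z) (abs_nonneg _) hB

theorem clampSym_of_abs_le {M g : ℝ} (hg : |g| ≤ M) : clampSym M g = g := by
  obtain ⟨h1, h2⟩ := abs_le.1 hg
  rw [clampSym, min_eq_left h2, max_eq_right h1]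

theorem abs_clampSym_le {M : ℝ} (hM : 0 ≤ M) (g : ℝ) : |clampSym M g| ≤ M :=
  abs_le.2 ⟨le_max_left _ _, max_le (by linarith) (min_le_right _ _)⟩

theorem abs_clampSym_sub_le (M g g' : ℝ) : |clampSym M g - clampSym M g'| ≤ |g - g'| := by
  unfold clampSym
  refine (abs_max_sub_max_le_max _ _ _ _).trans ?_
  rw [sub_self, abs_zero, max_eq_right (abs_nonneg _)]
  refine (abs_min_sub_min_le_max _ _ _ _).trans ?_
  rw [sub_self, abs_zero, max_eq_left (abs_nonneg _)]

variable {h : ℝ} {V dV : ℝ → ℝ} {lo hi c B M : ℝ}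

namespace ShapePotential

theorem continuous (hV : ShapePotential V dV lo hi c B) : Continuous V :=
  hV.lip.choose_spec.continuous

theorem continuous_deriv (hV : ShapePotential V dV lo hi c B) : Continuous dV :=
  hV.lip_deriv.choose_spec.continuous

theorem pos' (hV : ShapePotential V dV lo hi c B) (θ : ℝ) : 0 < V θ := hV.pos.trans_le (hV.le θ)

theorem denom_pos (hV : ShapePotential V dV lo hi c B) (hh : 0 < h) (x θ : ℝ) :
    0 < V θ + h * exp x := add_pos (hV.pos' θ) (by positivity)

theorem bound_pos (hV : ShapePotential V dV lo hi c B) : 0 < B :=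
  (hV.pos' 0).trans_le (hV.le_bound 0)

theorem unifLip_comp_fst {f : ℝ → ℝ} (hf : ∃ K : NNReal, LipschitzWith K f)
    (hb : ∀ θ, |f θ| ≤ B) : UnifLip fun _ z => f z.1 := by
  obtain ⟨K, hK⟩ := hf
  refine ⟨K, B, K.2, (abs_nonneg _).trans (hb 0), fun _ z z' => ?_, fun _ z => hb z.1⟩
  exact (hK.dist_le_mul z.1 z'.1).trans (mul_le_mul_of_nonneg_left (le_max_left _ _) K.2)

theorem unifLip_clampedField_snd (hV : ShapePotential V dV lo hi c B) (hh : 0 < h) (hM : 0 ≤ M) :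
    UnifLip fun x z => shapeAcc h V dV x z.1 (clampSym M z.2) := by
  have hcl : UnifLip fun _ z => clampSym M z.2 :=
    ⟨1, M, zero_le_one, hM, fun _ z z' => by
      rw [one_mul]
      exact (abs_clampSym_sub_le _ _ _).trans (le_max_right _ _),
      fun _ z => abs_clampSym_le hM _⟩
  have hV1 : UnifLip fun _ z => V z.1 :=
    unifLip_comp_fst hV.lip fun θ => by rw [abs_of_pos (hV.pos' θ)]; exact hV.le_bound θ
  have hdV : UnifLip fun _ z => dV z.1 := unifLip_comp_fst hV.lip_deriv hV.abs_deriv_le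
  have hinv : UnifLip fun x z => (V z.1 + h * exp x)⁻¹ := by
    obtain ⟨K, -, hK, -, hlip, -⟩ := hV1
    have hc := hV.pos
    have hge : ∀ x θ, c ≤ V θ + h * exp x := fun x θ => by
      have : 0 < h * exp x := by positivity
      linarith [hV.le θ]
    refine ⟨K / c ^ 2, c⁻¹, by positivity, by positivity, fun x z z' => ?_, fun x z => ?_⟩
    · have p1 := hV.denom_pos hh x z.1
      have p2 := hV.denom_pos hh x z'.1
      rw [inv_sub_inv p1.ne' p2.ne', abs_div, abs_of_pos (mul_pos p1 p2), abs_sub_comm,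
        div_mul_eq_mul_div]
      refine div_le_div₀ (by positivity) ?_ (by positivity) ?_
      · simpa using hlip x z z'
      · rw [sq]
        exact mul_le_mul (hge x _) (hge x _) hc.le p1.le
    · rw [abs_of_pos (inv_pos.2 (hV.denom_pos hh x z.1))]
      exact inv_anti₀ hc (hge x _)
  have := ((UnifLip.const 1).add (hcl.mul hcl)).mul ((UnifLip.const (1 / 2)).mul
    ((hdV.mul hinv).add ((UnifLip.const (-1)).mul
      (hcl.mul ((UnifLip.const 2).add ((UnifLip.const (-1)).mul (hV1.mul hinv)))))))
  convert this using 3 with x z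
  have := (hV.denom_pos hh x z.1).ne'
  unfold shapeAcc
  field_simp
  ring

theorem exists_flow (hV : ShapePotential V dV lo hi c B) (hh : 0 < h) (hM : 0 ≤ M) :
    ∃ K : NNReal, (∀ x, LipschitzWith K (clampedField h V dV M x)) ∧
    ∃ φ : ℝ → ℝ × ℝ → ℝ → ℝ × ℝ, (∀ t₀ z₀, φ t₀ z₀ t₀ = z₀) ∧
      (∀ t₀ z₀ t, HasDerivAt (φ t₀ z₀) (clampedField h V dV M t (φ t₀ z₀ t)) t) ∧
      Continuous fun q : ℝ × (ℝ × ℝ) × ℝ => φ q.1 q.2.1 q.2.2 := by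
  obtain ⟨K, B', hK, hB', hlip, hb⟩ := hV.unifLip_clampedField_snd hh hM
  have hl : ∀ x, LipschitzWith (max 1 K.toNNReal) (clampedField h V dV M x) := fun x =>
    LipschitzWith.prodMk
      (LipschitzWith.of_dist_le_mul fun z z' => by
        rw [NNReal.coe_one, one_mul]
        exact (abs_clampSym_sub_le _ _ _).trans (le_max_right _ _))
      (LipschitzWith.of_dist_le_mul fun z z' => by
        rw [Real.coe_toNNReal _ hK]
        exact hlip x z z')
  refine ⟨_, hl, exists_continuous_flow (L := (max M B').toNNReal) hl (fun z => ?_)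
    (fun t z => ?_)⟩
  · unfold clampedField shapeAcc
    have : ∀ t, V z.1 + h * exp t ≠ 0 := fun t => (hV.denom_pos hh t z.1).ne'
    fun_prop (disch := exact this _)
  · rw [Real.coe_toNNReal _ (hB'.trans (le_max_right _ _))]
    exact max_le_max (abs_clampSym_le hM _) (hb t z)

end ShapePotential

end ReducedSystem

section Orbits

/-- The energy-like Lyapunov function of the reduced system. -/
noncomputable def shapeEnergy (h : ℝ) (V : ℝ → ℝ) (x θ g : ℝ) : ℝ :=
  (V θ - g ^ 2 * (h * exp x)) / (1 + g ^ 2)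

/-- Integral curves of the clamped reduced system. -/
def IsClampedOrbit (h : ℝ) (V dV : ℝ → ℝ) (M : ℝ) (z : ℝ → ℝ × ℝ) : Prop :=
  ∀ x, HasDerivAt z (clampedField h V dV M x (z x)) x

/-- A local minimum `P` of `V` on the left of which `V` is not larger, and a point `q` up to which
`V` increases. -/
structure SaddleData (V dV : ℝ → ℝ) (lo hi P q : ℝ) : Prop where
  lo_le : lo ≤ P
  lt : P < q
  lt_hi : q < hi
  deriv_eq : dV P = 0
  le_left : ∀ θ ≤ P, V θ ≤ V P
  deriv_pos : ∀ θ ∈ Set.Ioc P q, 0 < dV θ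

/-- Up to time `t` the orbit moves forward with more energy than the saddle. -/
def IsUnstableUpTo (h : ℝ) (V : ℝ → ℝ) (P t : ℝ) (z : ℝ → ℝ × ℝ) : Prop :=
  ∀ x ≤ t, 0 < (z x).2 ∧ V P < shapeEnergy h V x (z x).1 (z x).2

/-- Backwards in time from `t`, the velocity becomes negative before the energy is lost. -/
def TurnsBack (h : ℝ) (V : ℝ → ℝ) (P t : ℝ) (z : ℝ → ℝ × ℝ) : Prop :=
  ∃ r, 0 ≤ r ∧ (z (t - r)).2 < 0 ∧
    ∀ r' ∈ Set.Icc 0 r, 0 < shapeEnergy h V (t - r') (z (t - r')).1 (z (t - r')).2 - V P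

/-- Backwards in time from `t`, the energy is lost before the velocity becomes negative. -/
def LosesEnergy (h : ℝ) (V : ℝ → ℝ) (P t : ℝ) (z : ℝ → ℝ × ℝ) : Prop :=
  ∃ r, 0 ≤ r ∧ shapeEnergy h V (t - r) (z (t - r)).1 (z (t - r)).2 - V P < 0 ∧
    ∀ r' ∈ Set.Icc 0 r, 0 < (z (t - r')).2

variable {h : ℝ} {V dV : ℝ → ℝ} {lo hi c B M P q t : ℝ} {z : ℝ → ℝ × ℝ}

theorem clampSym_nonneg {g : ℝ} (hM : 0 ≤ M) (hg : 0 ≤ g) : 0 ≤ clampSym M g :=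
  le_max_of_le_right (le_min hg hM)

theorem shapeEnergy_zero_velocity (x θ : ℝ) : shapeEnergy h V x θ 0 = V θ := by
  simp [shapeEnergy]

theorem le_shapeEnergy_iff {v x θ g : ℝ} :
    v ≤ shapeEnergy h V x θ g ↔ g ^ 2 * (v + h * exp x) ≤ V θ - v := by
  have : 0 < 1 + g ^ 2 := by positivity
  rw [shapeEnergy, le_div_iff₀ this]
  constructor <;> intro H <;> linarith

theorem lt_shapeEnergy_iff {v x θ g : ℝ} :
    v < shapeEnergy h V x θ g ↔ g ^ 2 * (v + h * exp x) < V θ - v := by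
  have : 0 < 1 + g ^ 2 := by positivity
  rw [shapeEnergy, lt_div_iff₀ this]
  constructor <;> intro H <;> linarith

theorem abs_le_of_le_shapeEnergy (hV : ShapePotential V dV lo hi c B) (hh : 0 < h) (hM : 0 ≤ M)
    (hMB : B ≤ c * M ^ 2) {v x θ g : ℝ} (hv : c ≤ v) (hG : v ≤ shapeEnergy h V x θ g) :
    |g| ≤ M := by
  rw [le_shapeEnergy_iff] at hG
  have := hV.pos
  have h1 : 0 < h * exp x := by positivity
  have h2 : g ^ 2 * c ≤ g ^ 2 * (v + h * exp x) :=
    mul_le_mul_of_nonneg_left (by linarith) (sq_nonneg g)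
  refine abs_le_of_sq_le_sq ?_ hM
  have h3 := hV.le_bound θ
  refine le_of_mul_le_mul_left ?_ hV.pos
  linarith

theorem le_potential_of_le_shapeEnergy (hh : 0 < h) {v x θ g : ℝ} (hv : 0 < v)
    (hG : v ≤ shapeEnergy h V x θ g) : v ≤ V θ := by
  rw [le_shapeEnergy_iff] at hG
  have : 0 ≤ g ^ 2 * (v + h * exp x) := by positivity
  linarith

theorem lt_potential_of_lt_shapeEnergy (hh : 0 < h) {v x θ g : ℝ} (hv : 0 < v)
    (hG : v < shapeEnergy h V x θ g) : v < V θ := by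
  rw [lt_shapeEnergy_iff] at hG
  have : 0 ≤ g ^ 2 * (v + h * exp x) := by positivity
  linarith

namespace IsClampedOrbit

theorem fst' (hz : IsClampedOrbit h V dV M z) (x : ℝ) :
    HasDerivAt (fun x => (z x).1) (clampSym M (z x).2) x :=
  (hz x).hasFDerivAt.fst.hasDerivAt.congr_deriv (by simp [clampedField])

theorem snd' (hz : IsClampedOrbit h V dV M z) (x : ℝ) :
    HasDerivAt (fun x => (z x).2) (shapeAcc h V dV x (z x).1 (clampSym M (z x).2)) x :=
  (hz x).hasFDerivAt.snd.hasDerivAt.congr_deriv (by simp [clampedField])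

theorem fst (hz : IsClampedOrbit h V dV M z) {x : ℝ} (hg : |(z x).2| ≤ M) :
    HasDerivAt (fun x => (z x).1) (z x).2 x := by
  simpa only [clampSym_of_abs_le hg] using hz.fst' x

theorem snd (hz : IsClampedOrbit h V dV M z) {x : ℝ} (hg : |(z x).2| ≤ M) :
    HasDerivAt (fun x => (z x).2) (shapeAcc h V dV x (z x).1 (z x).2) x := by
  simpa only [clampSym_of_abs_le hg] using hz.snd' x

theorem continuous (hz : IsClampedOrbit h V dV M z) : Continuous z :=
  continuous_iff_continuousAt.2 fun x => (hz x).continuousAt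

theorem hasDerivAt_energy (hV : ShapePotential V dV lo hi c B) (hh : 0 < h)
    (hz : IsClampedOrbit h V dV M z) {x : ℝ} (hg : |(z x).2| ≤ M)
    (hθ : (z x).1 ∈ Set.Ioo lo hi) :
    HasDerivAt (fun x => shapeEnergy h V x (z x).1 (z x).2)
      ((z x).2 ^ 2 * (V (z x).1 + h * exp x) / (1 + (z x).2 ^ 2)) x := by
  have h1 := (hV.hasDerivAt _ hθ).comp x (hz.fst hg)
  have h2 := hz.snd hg
  have h3 : (1 + (z x).2 ^ 2) ≠ 0 := by positivity
  refine (((h1.sub ((h2.pow 2).mul ((Real.hasDerivAt_exp x).const_mul h))).div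
    ((h2.pow 2).const_add 1) h3)).congr_deriv ?_
  have := (hV.denom_pos hh x (z x).1).ne'
  simp only [shapeAcc, Pi.sub_apply, Pi.mul_apply, Pi.pow_apply, Function.comp_apply]
  field_simp
  ring

theorem continuous_energy (hV : ShapePotential V dV lo hi c B)
    (hz : IsClampedOrbit h V dV M z) :
    Continuous fun x => shapeEnergy h V x (z x).1 (z x).2 := by
  have := hV.continuous
  have := hz.continuous
  unfold shapeEnergy
  refine Continuous.div (by fun_prop) (by fun_prop) fun x => by positivity

/-- The energy stays above a level whose superlevel set is inside the domain. -/
theorem lt_energy_forward (hV : ShapePotential V dV lo hi c B) (hh : 0 < h) (hM : 0 ≤ M)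
    (hMB : B ≤ c * M ^ 2) (hz : IsClampedOrbit h V dV M z) {v : ℝ} (hv : c ≤ v)
    (hlev : ∀ θ, v < V θ → θ ∈ Set.Ioo lo hi)
    (ht : v < shapeEnergy h V t (z t).1 (z t).2) {x : ℝ} (hx : t ≤ x) :
    v < shapeEnergy h V x (z x).1 (z x).2 := by
  refine le_and_lt_of_deriv_nonneg_above
    (f' := fun x => (z x).2 ^ 2 * (V (z x).1 + h * exp x) / (1 + (z x).2 ^ 2))
    (hz.continuous_energy hV) (fun x _ hGx => ?_) ht hx
  exact ⟨hz.hasDerivAt_energy hV hh (abs_le_of_le_shapeEnergy hV hh hM hMB hv hGx.le)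
    (hlev _ (lt_potential_of_lt_shapeEnergy hh (hV.pos.trans_le hv) hGx)),
    div_nonneg (mul_nonneg (sq_nonneg _) (hV.denom_pos hh _ _).le) (by positivity)⟩

theorem fst_le_of_velocity_nonneg (hM : 0 ≤ M) (hz : IsClampedOrbit h V dV M z) {a b : ℝ}
    (hab : a ≤ b) (hg : ∀ x ∈ Set.Icc a b, 0 ≤ (z x).2) : (z a).1 ≤ (z b).1 :=
  le_of_hasDerivAt_nonneg hab (fun x _ => hz.fst' x) fun x hx => clampSym_nonneg hM (hg x hx)

theorem eq_of_eq_at (hV : ShapePotential V dV lo hi c B) (hh : 0 < h) (hM : 0 ≤ M)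
    {y : ℝ → ℝ × ℝ} (hz : IsClampedOrbit h V dV M z) (hy : IsClampedOrbit h V dV M y)
    (hx : z t = y t) : z = y := by
  obtain ⟨K, hK, -⟩ := hV.exists_flow hh hM
  exact ODE_solution_unique_univ (v := clampedField h V dV M) (s := fun _ => Set.univ) (K := K)
    (fun x => (hK x).lipschitzOnWith) (fun x => ⟨hz x, trivial⟩) (fun x => ⟨hy x, trivial⟩) hx

theorem const (hM : 0 ≤ M) (hP : dV P = 0) : IsClampedOrbit h V dV M fun _ => (P, 0) := by
  intro x
  have : clampSym M 0 = 0 := clampSym_of_abs_le (by simpa using hM)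
  exact (hasDerivAt_const x ((P, 0) : ℝ × ℝ)).congr_deriv
    (by simp [clampedField, this, shapeAcc, hP, ← Prod.zero_eq_mk])

end IsClampedOrbit

theorem SaddleData.lt_potential (hV : ShapePotential V dV lo hi c B)
    (hs : SaddleData V dV lo hi P q) {θ : ℝ} (hθ : θ ∈ Set.Ioc P q) : V P < V θ := by
  have hmono : StrictMonoOn V (Set.Icc P q) := by
    refine strictMonoOn_of_deriv_pos (convex_Icc _ _) hV.continuous.continuousOn fun x hx => ?_
    rw [interior_Icc] at hx
    rw [(hV.hasDerivAt x ⟨hs.lo_le.trans_lt hx.1, hx.2.trans hs.lt_hi⟩).deriv]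
    exact hs.deriv_pos x ⟨hx.1, hx.2.le⟩
  exact hmono ⟨le_rfl, hs.lt.le⟩ ⟨hθ.1.le, hθ.2⟩ hθ.1

theorem SaddleData.lt_of_lt_potential (hs : SaddleData V dV lo hi P q) {θ : ℝ}
    (hθ : V P < V θ) : P < θ := by
  by_contra! hcon
  exact absurd (hs.le_left θ hcon) (not_le.2 hθ)

/-- An orbit starting at the section `θ = q` either turns back, loses energy, or is on the unstable
manifold of the saddle. -/
theorem SaddleData.trichotomy (hV : ShapePotential V dV lo hi c B) (hh : 0 < h) (hM : 0 ≤ M)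
    (hMB : B ≤ c * M ^ 2) (hs : SaddleData V dV lo hi P q) (hz : IsClampedOrbit h V dV M z)
    (hq : (z t).1 = q) (hg : 0 ≤ (z t).2)  :
    TurnsBack h V P t z ∨ LosesEnergy h V P t z ∨ IsUnstableUpTo h V P t z := by
  have hPpos := hV.pos' P
  have hVq := hs.lt_potential hV ⟨hs.lt, le_rfl⟩
  have hcz := hz.continuous
  rcases lt_or_ge (shapeEnergy h V t (z t).1 (z t).2) (V P) with hlt | hge
  · have hg' : 0 < (z t).2 := hg.lt_of_ne fun h0 => by
      rw [← h0, shapeEnergy_zero_velocity, hq] at hlt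
      linarith
    exact Or.inr (Or.inl ⟨0, le_rfl, by simpa using hlt, fun r' hr' => by
      rw [le_antisymm hr'.2 hr'.1]; simpa using hg'⟩)
  have hcE := hz.continuous_energy hV
  refine (exit_alternative (a := fun r => (z (t - r)).2)
    (b := fun r => shapeEnergy h V (t - r) (z (t - r)).1 (z (t - r)).2 - V P)
    (by fun_prop) ((hcE.comp (by fun_prop : Continuous fun r => t - r)).sub continuous_const)
    (by simpa using hg) (by simpa using hge) ?_).imp id (Or.imp id fun h3 x hx => ?_)
  swap
  · have := h3 (t - x) (sub_nonneg.2 hx)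
    simp only [sub_sub_cancel, sub_pos] at this
    exact this
  intro r hr hpos
  have hpos' : ∀ x ∈ Set.Ioc (t - r) t, 0 < (z x).2 ∧
      V P < shapeEnergy h V x (z x).1 (z x).2 := fun x hx => by
    have := hpos (t - x) ⟨by linarith [hx.2], by linarith [hx.1]⟩
    simp only [sub_sub_cancel, sub_pos] at this
    exact this
  have htend : Tendsto (fun s => t - s) (𝓝[>] r) (𝓝[<] (t - r)) :=
    tendsto_nhdsWithin_of_tendsto_nhds_of_eventually_within _
      ((by fun_prop : Continuous fun s => t - s).continuousWithinAt) (by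
        filter_upwards [self_mem_nhdsWithin] with s hs
        simpa using hs)
  have hθq : 0 ≤ (z (t - r)).2 → (z (t - r)).1 ≤ q := fun h0 => by
    rw [← hq]
    refine hz.fst_le_of_velocity_nonneg hM (by linarith) fun x hx => ?_
    rcases hx.1.eq_or_lt with rfl | hlt
    · exact h0
    · exact (hpos' x ⟨hlt, hx.2⟩).1.le
  refine ⟨fun h0 hG => ?_, fun h0 hg => ?_, fun ⟨h0, hG⟩ => ?_⟩
  · rw [h0, shapeEnergy_zero_velocity, sub_pos] at hG
    have hd := hs.deriv_pos _ ⟨hs.lt_of_lt_potential hG, hθq h0.ge⟩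
    have := (hz.snd (x := t - r) (by simpa [h0] using hM)).eventually_lt_left (by
      rw [h0]
      have := hV.denom_pos hh (t - r) (z (t - r)).1
      simp only [shapeAcc, zero_mul, sub_zero]
      positivity)
    refine ((htend.eventually this).mono fun s hs => ?_).frequently
    rwa [h0] at hs
  · rw [sub_eq_zero] at h0
    have hgM := abs_le_of_le_shapeEnergy hV hh hM hMB (hV.le P) h0.ge
    have hPθ : P < (z (t - r)).1 := hs.lt_of_lt_potential (by
      have := le_shapeEnergy_iff.1 h0.ge
      have : 0 < (z (t - r)).2 ^ 2 * (V P + h * exp (t - r)) := by positivity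
      linarith)
    have := (hz.hasDerivAt_energy hV hh hgM ⟨hs.lo_le.trans_lt hPθ,
      (hθq hg.le).trans_lt hs.lt_hi⟩).eventually_lt_left (by
        have := hV.denom_pos hh (t - r) (z (t - r)).1
        positivity)
    refine ((htend.eventually this).mono fun s hs => ?_).frequently
    rw [h0] at hs
    linarith
  · rw [h0, shapeEnergy_zero_velocity, sub_eq_zero] at hG
    have hle : P ≤ (z (t - r)).1 := by
      rcases hr.eq_or_lt with rfl | hr0
      · simp only [sub_zero] at hG
        rw [hq] at hG
        linarith
      · refine ge_of_tendsto ((by fun_prop : Continuous fun x => (z x).1).continuousWithinAt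
          (s := Set.Ioi (t - r)) (x := t - r)) ?_
        filter_upwards [Ioo_mem_nhdsGT (show t - r < t by linarith)] with x hx
        exact (hs.lt_of_lt_potential (lt_potential_of_lt_shapeEnergy hh hPpos
          (hpos' x ⟨hx.1, hx.2.le⟩).2)).le
    have hP : (z (t - r)).1 = P := by
      refine (hle.eq_or_lt.resolve_right fun hlt => ?_).symm
      linarith [hs.lt_potential hV ⟨hlt, hθq h0.ge⟩]
    have := hz.eq_of_eq_at hV hh hM (IsClampedOrbit.const hM hs.deriv_eq) (t := t - r)
      (Prod.ext hP h0)
    rw [this] at hq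
    exact hs.lt.ne hq

end Orbits

section Connections

/-- A flow of the clamped reduced system. -/
structure IsClampedFlow (h : ℝ) (V dV : ℝ → ℝ) (M : ℝ) (φ : ℝ → ℝ × ℝ → ℝ → ℝ × ℝ) : Prop where
  init : ∀ t₀ z₀, φ t₀ z₀ t₀ = z₀
  orbit : ∀ t₀ z₀, IsClampedOrbit h V dV M (φ t₀ z₀)
  continuous : Continuous fun q : ℝ × (ℝ × ℝ) × ℝ => φ q.1 q.2.1 q.2.2

variable {h : ℝ} {V dV : ℝ → ℝ} {lo hi c B M P q t : ℝ} {z : ℝ → ℝ × ℝ}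
  {φ : ℝ → ℝ × ℝ → ℝ → ℝ × ℝ}

theorem ShapePotential.exists_isClampedFlow (hV : ShapePotential V dV lo hi c B) (hh : 0 < h)
    (hM : 0 ≤ M) : ∃ φ, IsClampedFlow h V dV M φ := by
  obtain ⟨-, -, φ, h1, h2, h3⟩ := hV.exists_flow hh hM
  exact ⟨φ, h1, h2, h3⟩

theorem continuous_shapeEnergy (hV : ShapePotential V dV lo hi c B) :
    Continuous fun p : ℝ × ℝ × ℝ => shapeEnergy h V p.1 p.2.1 p.2.2 := by
  have := hV.continuous
  unfold shapeEnergy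
  exact Continuous.div (by fun_prop) (by fun_prop) fun x => by positivity

theorem IsClampedFlow.isOpen_turnsBack (hV : ShapePotential V dV lo hi c B)
    (hφ : IsClampedFlow h V dV M φ) :
    IsOpen {p : ℝ × ℝ | TurnsBack h V P p.1 (φ p.1 (q, p.2))} := by
  have hc : Continuous fun p : (ℝ × ℝ) × ℝ => φ p.1.1 (q, p.1.2) (p.1.1 - p.2) :=
    hφ.continuous.comp (by fun_prop :
      Continuous fun p : (ℝ × ℝ) × ℝ => (p.1.1, ((q, p.1.2) : ℝ × ℝ), p.1.1 - p.2))
  exact isOpen_exists_neg_forall_pos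
    (a := fun p : (ℝ × ℝ) × ℝ => (φ p.1.1 (q, p.1.2) (p.1.1 - p.2)).2)
    (b := fun p : (ℝ × ℝ) × ℝ => shapeEnergy h V (p.1.1 - p.2)
      (φ p.1.1 (q, p.1.2) (p.1.1 - p.2)).1 (φ p.1.1 (q, p.1.2) (p.1.1 - p.2)).2 - V P)
    hc.snd (((continuous_shapeEnergy hV).comp ((continuous_fst.fst.sub continuous_snd).prodMk
      hc)).sub continuous_const)

theorem IsClampedFlow.isOpen_losesEnergy (hV : ShapePotential V dV lo hi c B)
    (hφ : IsClampedFlow h V dV M φ) :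
    IsOpen {p : ℝ × ℝ | LosesEnergy h V P p.1 (φ p.1 (q, p.2))} := by
  have hc : Continuous fun p : (ℝ × ℝ) × ℝ => φ p.1.1 (q, p.1.2) (p.1.1 - p.2) :=
    hφ.continuous.comp (by fun_prop :
      Continuous fun p : (ℝ × ℝ) × ℝ => (p.1.1, ((q, p.1.2) : ℝ × ℝ), p.1.1 - p.2))
  exact isOpen_exists_neg_forall_pos
    (b := fun p : (ℝ × ℝ) × ℝ => (φ p.1.1 (q, p.1.2) (p.1.1 - p.2)).2)
    (a := fun p : (ℝ × ℝ) × ℝ => shapeEnergy h V (p.1.1 - p.2)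
      (φ p.1.1 (q, p.1.2) (p.1.1 - p.2)).1 (φ p.1.1 (q, p.1.2) (p.1.1 - p.2)).2 - V P)
    (((continuous_shapeEnergy hV).comp ((continuous_fst.fst.sub continuous_snd).prodMk
      hc)).sub continuous_const) hc.snd

theorem IsUnstableUpTo.velocity_lt (hV : ShapePotential V dV lo hi c B) (hh : 0 < h) (hM : 0 ≤ M)
    (hMB : B ≤ c * M ^ 2) (hu : IsUnstableUpTo h V P t z) : (z t).2 < M := by
  have := hu t le_rfl
  refine (le_of_abs_le (abs_le_of_le_shapeEnergy hV hh hM hMB (hV.le P) this.2.le)).lt_of_ne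
    fun hE => ?_
  have h1 := lt_shapeEnergy_iff.1 this.2
  rw [hE] at h1
  have h2 : M ^ 2 * c ≤ M ^ 2 * (V P + h * exp t) :=
    mul_le_mul_of_nonneg_left (by linarith [hV.le P, mul_pos hh (exp_pos t)]) (sq_nonneg M)
  linarith [hV.le_bound (z t).1, hV.pos' P]

theorem SaddleData.turnsBack_zero (hV : ShapePotential V dV lo hi c B) (hh : 0 < h) (hM : 0 ≤ M)
    (hMB : B ≤ c * M ^ 2) (hs : SaddleData V dV lo hi P q) (hφ : IsClampedFlow h V dV M φ) :
    TurnsBack h V P t (φ t (q, 0)) := by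
  rcases hs.trichotomy hV hh hM hMB (hφ.orbit t (q, 0)) (by rw [hφ.init]) (by rw [hφ.init])
    with h1 | ⟨r, hr, -, h2⟩ | h3
  · exact h1
  · simpa [hφ.init] using h2 0 ⟨le_rfl, hr⟩
  · simpa [hφ.init] using (h3 t le_rfl).1

theorem SaddleData.losesEnergy_max (hV : ShapePotential V dV lo hi c B) (hh : 0 < h) (hM : 0 < M)
    (hMB : B ≤ c * M ^ 2) (hs : SaddleData V dV lo hi P q) (hφ : IsClampedFlow h V dV M φ) :
    LosesEnergy h V P t (φ t (q, M)) := by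
  rcases hs.trichotomy hV hh hM.le hMB (hφ.orbit t (q, M)) (by rw [hφ.init])
    (by rw [hφ.init]; exact hM.le) with ⟨r, hr, -, h1⟩ | h2 | h3
  · have := h1 0 ⟨le_rfl, hr⟩
    simp only [sub_zero, hφ.init, sub_pos] at this
    have h1 := lt_shapeEnergy_iff.1 this
    have h2 : M ^ 2 * c ≤ M ^ 2 * (V P + h * exp t) :=
      mul_le_mul_of_nonneg_left (by linarith [hV.le P, mul_pos hh (exp_pos t)]) (sq_nonneg M)
    linarith [hV.le_bound q, hV.pos' P]
  · exact h2
  · simpa [hφ.init] using h3.velocity_lt hV hh hM.le hMB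

theorem turnsBack_losesEnergy_disjoint (h1 : TurnsBack h V P t z) (h2 : LosesEnergy h V P t z) :
    False :=
  not_exists_neg_forall_pos_and h1 h2

/-- Through each instance of the section `θ = q` there passes an orbit on the unstable manifold. -/
theorem SaddleData.exists_unstable (hV : ShapePotential V dV lo hi c B) (hh : 0 < h) (hM : 0 < M)
    (hMB : B ≤ c * M ^ 2) (hs : SaddleData V dV lo hi P q) (hφ : IsClampedFlow h V dV M φ)
    (t : ℝ) : ∃ b, IsUnstableUpTo h V P t (φ t (q, b)) := by
  by_contra! hcon
  have hι : Continuous fun b : ℝ => (t, b) := by fun_prop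
  obtain ⟨b, -, hb1, hb2⟩ := isPreconnected_Icc (a := (0 : ℝ)) (b := M)
    _ _ ((hφ.isOpen_turnsBack (P := P) (q := q) hV).preimage hι)
    ((hφ.isOpen_losesEnergy (P := P) (q := q) hV).preimage hι)
    (fun b hb => by
      rcases hs.trichotomy hV hh hM.le hMB (hφ.orbit t (q, b)) (by rw [hφ.init])
        (by rw [hφ.init]; exact hb.1) with h1 | h2 | h3
      · exact Or.inl h1
      · exact Or.inr h2
      · exact absurd h3 (hcon b))
    ⟨0, ⟨le_rfl, hM.le⟩, hs.turnsBack_zero hV hh hM.le hMB hφ⟩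
    ⟨M, ⟨hM.le, le_rfl⟩, hs.losesEnergy_max hV hh hM hMB hφ⟩
  exact turnsBack_losesEnergy_disjoint hb1 hb2

/-- An orbit coming from the section with nonnegative velocity and enough energy converges to the
saddle in backward time. -/
theorem SaddleData.tendsto_atBot (hV : ShapePotential V dV lo hi c B) (hh : 0 < h) (hM : 0 ≤ M)
    (hMB : B ≤ c * M ^ 2) (hs : SaddleData V dV lo hi P q) (hz : IsClampedOrbit h V dV M z)
    (hu : ∀ x ≤ t, 0 ≤ (z x).2 ∧ V P ≤ shapeEnergy h V x (z x).1 (z x).2)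
    (hθ : ∀ x ≤ t, (z x).1 ∈ Set.Icc P q) : Tendsto z atBot (𝓝 (P, 0)) := by
  have hmono : Monotone fun x => (z (min x t)).1 := fun x y hxy =>
    hz.fst_le_of_velocity_nonneg hM (min_le_min_right t hxy)
      fun w hw => (hu w (hw.2.trans (min_le_right _ _))).1
  obtain ⟨l, hl⟩ : ∃ l, Tendsto (fun x => (z (min x t)).1) atBot (𝓝 l) :=
    ⟨_, tendsto_atBot_ciInf hmono ⟨P, by
      rintro _ ⟨x, rfl⟩
      exact (hθ _ (min_le_right _ _)).1⟩⟩
  have hl' : Tendsto (fun x => (z x).1) atBot (𝓝 l) := hl.congr' (by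
    filter_upwards [eventually_le_atBot t] with x hx
    rw [min_eq_left hx])
  have hPl : P ≤ l := ge_of_tendsto hl' (by
    filter_upwards [eventually_le_atBot t] with x hx using (hθ x hx).1)
  have hlx : ∀ x ≤ t, l ≤ (z x).1 := fun x hx => by
    have := hmono.le_of_tendsto hl x
    rwa [min_eq_left hx] at this
  have hl_eq : l = P := by
    refine (hPl.eq_or_lt.resolve_right fun hlt => ?_).symm
    have hlq : l ≤ q := (hlx t le_rfl).trans (hθ t le_rfl).2
    obtain ⟨y, hy, hymin⟩ := isCompact_Icc.exists_isMinOn (Set.nonempty_Icc.2 hlq)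
      hV.continuous_deriv.continuousOn
    have hκ := hs.deriv_pos y ⟨hlt.trans_le hy.1, hy.2⟩
    set κ := dV y / (2 * (B + h * exp t)) with hκ'
    have hB := hV.bound_pos
    have hκpos : 0 < κ := by positivity
    have hgM : ∀ x ≤ t, |(z x).2| ≤ M := fun x hx =>
      abs_le_of_le_shapeEnergy hV hh hM hMB (hV.le P) (hu x hx).2
    have key : ∀ x ≤ t, κ * (t - x) ≤
        ((z t).2 + (1 + M ^ 2) * (z t).1) - ((z x).2 + (1 + M ^ 2) * (z x).1) := fun x hx => by
      refine mul_sub_le_of_hasDerivAt (f := fun x => (z x).2 + (1 + M ^ 2) * (z x).1) hx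
        (fun w hw => (hz.snd (hgM w hw.2)).add ((hz.fst (hgM w hw.2)).const_mul (1 + M ^ 2)))
        fun w hw => ?_
      have hg := (hu w hw.2).1
      have hgM' : (z w).2 ^ 2 ≤ M ^ 2 := sq_le_sq' (by linarith) ((le_abs_self _).trans (hgM w hw.2))
      have hD := hV.denom_pos hh w (z w).1
      have h1 : dV y ≤ dV (z w).1 := hymin ⟨hlx w hw.2, (hθ w hw.2).2⟩
      have h2 : κ ≤ dV (z w).1 / (V (z w).1 + h * exp w) / 2 := by
        rw [hκ', div_div, mul_comm _ (2 : ℝ)]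
        refine div_le_div₀ (hκ.le.trans h1) h1 (by positivity) ?_
        have : h * exp w ≤ h * exp t := mul_le_mul_of_nonneg_left (exp_le_exp.2 hw.2) hh.le
        linarith [hV.le_bound (z w).1]
      have h3 : h * exp w / (V (z w).1 + h * exp w) ≤ 1 := by
        rw [div_le_one hD]
        linarith [hV.pos' (z w).1]
      have h4 : 0 ≤ h * exp w / (V (z w).1 + h * exp w) := by positivity
      unfold shapeAcc
      set A := dV (z w).1 / (V (z w).1 + h * exp w)
      set E := h * exp w / (V (z w).1 + h * exp w)
      set g := (z w).2
      have h5 : 0 ≤ g ^ 2 * A := mul_nonneg (sq_nonneg _) (by linarith)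
      have h6 : (1 + g ^ 2) * (g * (1 + E)) ≤ (1 + M ^ 2) * (g * 2) :=
        mul_le_mul (by linarith) (mul_le_mul_of_nonneg_left (by linarith) hg) (by positivity)
          (by positivity)
      nlinarith
    set T := (M + (1 + M ^ 2) * (q - P) + 1) / κ with hT
    have hTpos : 0 ≤ T := by
      have := hs.lt
      have : 0 < q - P := by linarith
      positivity
    have h1 := key (t - T) (by linarith)
    rw [sub_sub_cancel, hT, mul_div_cancel₀ _ hκpos.ne'] at h1
    have h2 := (hu (t - T) (by linarith)).1
    have h3 := hθ (t - T) (by linarith)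
    have h4 := hθ t le_rfl
    have h5 := (le_abs_self _).trans (hgM t le_rfl)
    have h6 : (1 + M ^ 2) * ((z t).1 - (z (t - T)).1) ≤ (1 + M ^ 2) * (q - P) :=
      mul_le_mul_of_nonneg_left (by linarith [h4.2, h3.1]) (by positivity)
    linarith
  rw [hl_eq] at hl'
  refine hl'.prodMk_nhds ?_
  have hVlim : Tendsto (fun x => √((V (z x).1 - V P) / V P)) atBot (𝓝 0) := by
    have := (((hV.continuous.tendsto P).comp hl').sub_const (V P)).div_const (V P)
    simpa using this.sqrt
  refine squeeze_zero_norm' ?_ hVlim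
  filter_upwards [eventually_le_atBot t] with x hx
  refine Real.abs_le_sqrt ?_
  have h1 := le_shapeEnergy_iff.1 (hu x hx).2
  have h2 := hV.pos' P
  rw [le_div_iff₀ h2]
  nlinarith [sq_nonneg (z x).2, mul_pos hh (exp_pos x)]

/-- Exponential decay of the velocity. -/
theorem abs_velocity_le (hV : ShapePotential V dV lo hi c B) (hh : 0 < h) {v x θ g : ℝ}
    (hv : 0 ≤ v) (hG : v ≤ shapeEnergy h V x θ g) : |g| ≤ √(B / h) * exp (-x / 2) := by
  have h1 := le_shapeEnergy_iff.1 hG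
  have h2 : exp (-x / 2) ^ 2 * exp x = 1 := by
    rw [← exp_nat_mul, ← exp_add]
    simp; ring
  have h3 : g ^ 2 * (h * exp x) ≤ B := by nlinarith [hV.le_bound θ, sq_nonneg g]
  refine abs_le_of_sq_le_sq ?_ (by positivity)
  rw [mul_pow, Real.sq_sqrt (div_nonneg hV.bound_pos.le hh.le), div_mul_eq_mul_div,
    le_div_iff₀ hh]
  have h4 := mul_le_mul_of_nonneg_left h3 (sq_nonneg (exp (-x / 2)))
  rw [show exp (-x / 2) ^ 2 * (g ^ 2 * (h * exp x)) =
    (exp (-x / 2) ^ 2 * exp x) * (g ^ 2 * h) by ring, h2, one_mul] at h4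
  linarith

theorem abs_drift_le {f f' : ℝ → ℝ} {A a b : ℝ} (hA : 0 ≤ A) (hab : a ≤ b)
    (hf : ∀ x ∈ Set.Icc a b, HasDerivAt f (f' x) x)
    (hb : ∀ x ∈ Set.Icc a b, |f' x| ≤ A * exp (-x / 2)) :
    |f b - f a| ≤ 2 * A * exp (-a / 2) := by
  have hE : ∀ x, HasDerivAt (fun x => -(2 * A) * exp (-x / 2)) (A * exp (-x / 2)) x := fun x =>
    (((hasDerivAt_neg x).div_const 2).exp.const_mul (-(2 * A))).congr_deriv (by ring)
  have h1 := le_of_hasDerivAt_nonneg hab (fun x hx => (hE x).sub (hf x hx))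
    fun x hx => sub_nonneg.2 (le_of_abs_le (hb x hx))
  have h2 := le_of_hasDerivAt_nonneg hab (fun x hx => (hE x).add (hf x hx))
    fun x hx => by linarith [neg_le_of_abs_le (hb x hx)]
  have h3 : 0 ≤ 2 * A * exp (-b / 2) := by positivity
  simp only [Pi.sub_apply, Pi.add_apply] at h1 h2
  exact abs_le.2 ⟨by linarith, by linarith⟩

/-- For every target `q` on the increasing side of the saddle `P`, there is a connection from the
saddle to `(q, 0)`. -/
theorem SaddleData.exists_connection (hV : ShapePotential V dV lo hi c B) (hh : 0 < h) (hM : 0 < M)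
    (hMB : B ≤ c * M ^ 2) (hs : SaddleData V dV lo hi P q) :
    ∃ z, IsClampedOrbit h V dV M z ∧ (∀ x, (z x).1 ∈ Set.Icc P q) ∧ (∀ x, |(z x).2| ≤ M) ∧
      Tendsto z atBot (𝓝 (P, 0)) ∧ Tendsto z atTop (𝓝 (q, 0)) := by
  obtain ⟨φ, hφ⟩ := hV.exists_isClampedFlow hh hM.le
  choose b hb using fun n : ℕ => hs.exists_unstable hV hh hM hMB hφ n
  set A := √(B / h) with hAdef
  have hA : 0 ≤ A := Real.sqrt_nonneg _
  set z : ℕ → ℝ → ℝ × ℝ := fun n => φ n (q, b n) with hzdef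
  have hz : ∀ n, IsClampedOrbit h V dV M (z n) := fun n => hφ.orbit _ _
  have hzn : ∀ n : ℕ, (z n n).1 = q := fun n => by rw [hzdef]; simp only [hφ.init]
  set S : ℝ → Set (ℝ × ℝ) := fun x => {p | P ≤ p.1 ∧ p.1 ≤ q ∧ 0 ≤ p.2 ∧
    V P ≤ shapeEnergy h V x p.1 p.2 ∧ q - 2 * A * exp (-x / 2) ≤ p.1} with hS
  have hSclosed : ∀ x, IsClosed (S x) := fun x => by
    have := (continuous_shapeEnergy (h := h) hV).comp
      (by fun_prop : Continuous fun p : ℝ × ℝ => (x, p))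
    simp only [hS, Set.ofPred_and]
    exact (isClosed_le continuous_const continuous_fst).inter
      ((isClosed_le continuous_fst continuous_const).inter
      ((isClosed_le continuous_const continuous_snd).inter
      ((isClosed_le continuous_const this).inter (isClosed_le continuous_const continuous_fst))))
  have hvel : ∀ {x : ℝ} {p : ℝ × ℝ}, V P ≤ shapeEnergy h V x p.1 p.2 → |p.2| ≤ M := fun hp =>
    abs_le_of_le_shapeEnergy hV hh hM.le hMB (hV.le P) hp
  have hzS : ∀ (n : ℕ) (x : ℝ), x ≤ n → z n x ∈ S x := fun n x hx => by
    have hu := hb n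
    refine ⟨(hs.lt_of_lt_potential (lt_potential_of_lt_shapeEnergy hh (hV.pos' P)
      (hu x hx).2)).le, ?_, (hu x hx).1.le, (hu x hx).2.le, ?_⟩
    · rw [← hzn n]
      exact (hz n).fst_le_of_velocity_nonneg hM.le hx fun w hw => (hu w hw.2).1.le
    · have := abs_drift_le hA hx (fun w hw => (hz n).fst (hvel (hu w hw.2).2.le))
        fun w hw => abs_velocity_le hV hh (hV.pos' P).le (hu w hw.2).2.le
      rw [hzn] at this
      linarith [le_of_abs_le this]
  obtain ⟨w, -, ns, hns, hlim⟩ := (isCompact_Icc (a := ((P, 0) : ℝ × ℝ)) (b := (q, M))).tendsto_subseq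
    (x := fun n => z n 0) fun n => by
      obtain ⟨h1, h2, h3, h4, -⟩ := hzS n 0 n.cast_nonneg
      exact ⟨⟨h1, h3⟩, ⟨h2, (le_abs_self _).trans (hvel h4)⟩⟩
  set y := φ 0 w
  have hy : IsClampedOrbit h V dV M y := hφ.orbit 0 w
  have hyS : ∀ x, y x ∈ S x := fun x => by
    have hc : Continuous fun p => φ 0 p x :=
      hφ.continuous.comp (by fun_prop : Continuous fun p : ℝ × ℝ => ((0 : ℝ), p, x))
    refine (hSclosed x).mem_of_tendsto ((hc.tendsto w).comp hlim) ?_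
    filter_upwards [hns.tendsto_atTop.eventually_ge_atTop ⌈x⌉₊] with k hk
    have : φ 0 (z (ns k) 0) = z (ns k) :=
      (hφ.orbit _ _).eq_of_eq_at hV hh hM.le (hz _) (hφ.init _ _)
    simp only [Function.comp_apply, this]
    exact hzS _ x ((Nat.le_ceil x).trans (by exact_mod_cast hk))
  have hexp : Tendsto (fun x : ℝ => exp (-x / 2)) atTop (𝓝 0) :=
    Real.tendsto_exp_atBot.comp ((tendsto_neg_atTop_atBot).atBot_div_const (by norm_num))
  refine ⟨y, hy, fun x => ⟨(hyS x).1, (hyS x).2.1⟩, fun x => hvel (hyS x).2.2.2.1,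
    hs.tendsto_atBot (t := 0) hV hh hM.le hMB hy (fun x _ => ⟨(hyS x).2.2.1, (hyS x).2.2.2.1⟩)
      fun x _ => ⟨(hyS x).1, (hyS x).2.1⟩, Tendsto.prodMk_nhds ?_ ?_⟩
  · refine tendsto_of_tendsto_of_tendsto_of_le_of_le ?_ tendsto_const_nhds
      (fun x => (hyS x).2.2.2.2) fun x => (hyS x).2.1
    simpa using (hexp.const_mul (2 * A)).const_sub q
  · refine squeeze_zero_norm (fun x => abs_velocity_le hV hh (hV.pos' P).le (hyS x).2.2.2.1) ?_
    simpa using hexp.const_mul A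

end Connections

section UnstableFamily

/-- Monotonicity of the force on the interval `[P, q]`. -/
structure MonotoneForce (V dV : ℝ → ℝ) (P q : ℝ) : Prop where
  mono : MonotoneOn dV (Set.Icc P q)
  ratio : ∀ a ∈ Set.Icc P q, ∀ b ∈ Set.Icc P q, a ≤ b → dV a * V b ≤ dV b * V a
  le : ∀ a ∈ Set.Icc P q, dV a ≤ V a

variable {h : ℝ} {V dV : ℝ → ℝ} {lo hi c B M P q t : ℝ} {y z : ℝ → ℝ × ℝ}
  {φ : ℝ → ℝ × ℝ → ℝ → ℝ × ℝ}

theorem shapeAcc_le_shapeAcc (hV : ShapePotential V dV lo hi c B) (hh : 0 < h)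
    (hs : SaddleData V dV lo hi P q) (hm : MonotoneForce V dV P q) {x a₁ a₂ g₁ g₂ : ℝ}
    (ha₂ : a₂ ∈ Set.Icc P q) (ha₁ : a₁ ∈ Set.Icc P q) (ha : a₂ ≤ a₁) (hg₁ : 0 ≤ g₁)
    (hg : g₁ ≤ g₂) : shapeAcc h V dV x a₂ g₂ ≤ shapeAcc h V dV x a₁ g₁ := by
  have he : 0 < h * exp x := by positivity
  have hD₁ := hV.denom_pos hh x a₁
  have hD₂ := hV.denom_pos hh x a₂
  have hdV : ∀ a ∈ Set.Icc P q, 0 ≤ dV a := fun a ha => by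
    rcases ha.1.eq_or_lt with rfl | hlt
    · exact hs.deriv_eq.ge
    · exact (hs.deriv_pos a ⟨hlt, ha.2⟩).le
  have hVmono : V a₂ ≤ V a₁ := by
    refine monotoneOn_of_deriv_nonneg (convex_Icc P q) hV.continuous.continuousOn ?_ ?_ ha₂ ha₁ ha
    all_goals
      intro x hx
      rw [interior_Icc] at hx
      have := hV.hasDerivAt x ⟨hs.lo_le.trans_lt hx.1, hx.2.trans hs.lt_hi⟩
    · exact this.differentiableAt.differentiableWithinAt
    · exact this.deriv ▸ hdV x ⟨hx.1.le, hx.2.le⟩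
  have hA : dV a₂ / (V a₂ + h * exp x) ≤ dV a₁ / (V a₁ + h * exp x) := by
    rw [div_le_div_iff₀ hD₂ hD₁]
    have := hm.ratio a₂ ha₂ a₁ ha₁ ha
    nlinarith [mul_le_mul_of_nonneg_right (hm.mono ha₂ ha₁ ha) he.le]
  have hE : h * exp x / (V a₁ + h * exp x) ≤ h * exp x / (V a₂ + h * exp x) :=
    div_le_div_of_nonneg_left he.le hD₂ (by linarith)
  have hA1 : dV a₂ / (V a₂ + h * exp x) ≤ 1 := by
    rw [div_le_one hD₂]
    linarith [hm.le a₂ ha₂]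
  have hA0 : 0 ≤ dV a₂ / (V a₂ + h * exp x) := div_nonneg (hdV a₂ ha₂) hD₂.le
  have hE0 : 0 ≤ h * exp x / (V a₁ + h * exp x) := by positivity
  unfold shapeAcc
  generalize dV a₂ / (V a₂ + h * exp x) = A₂ at *
  generalize dV a₁ / (V a₁ + h * exp x) = A₁ at *
  generalize h * exp x / (V a₁ + h * exp x) = E₁ at *
  generalize h * exp x / (V a₂ + h * exp x) = E₂ at *
  have step1 : (1 + g₁ ^ 2) / 2 * (A₂ - g₁ * (1 + E₂)) ≤ (1 + g₁ ^ 2) / 2 * (A₁ - g₁ * (1 + E₁)) := by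
    refine mul_le_mul_of_nonneg_left ?_ (by positivity)
    linarith [mul_le_mul_of_nonneg_left hE hg₁]
  refine le_trans ?_ step1
  have hg₂ := hg₁.trans hg
  have e1 : A₂ * (g₁ + g₂) ≤ g₁ + g₂ := mul_le_of_le_one_left (by linarith) hA1
  have e2 : g₁ + g₂ ≤ 1 + g₁ ^ 2 + g₁ * g₂ + g₂ ^ 2 := by
    nlinarith [sq_nonneg (g₁ + g₂ - 1), mul_nonneg hg₁ hg₂]
  have e3 : 0 ≤ E₂ * (1 + g₁ ^ 2 + g₁ * g₂ + g₂ ^ 2) :=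
    mul_nonneg (hE0.trans hE) (by positivity)
  have e4 : 0 ≤ (g₂ - g₁) * ((1 + E₂) * (1 + g₁ ^ 2 + g₁ * g₂ + g₂ ^ 2) - A₂ * (g₁ + g₂)) :=
    mul_nonneg (by linarith) (by linarith)
  linarith

theorem IsUnstableUpTo.mem (hh : 0 < h) (hV : ShapePotential V dV lo hi c B) (hM : 0 ≤ M)
    (hs : SaddleData V dV lo hi P q) (hz : IsClampedOrbit h V dV M z)
    (hu : IsUnstableUpTo h V P t z) (hq : (z t).1 = q) {x : ℝ} (hx : x ≤ t) :
    (z x).1 ∈ Set.Ioc P q :=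
  ⟨hs.lt_of_lt_potential (lt_potential_of_lt_shapeEnergy hh (hV.pos' P) (hu x hx).2), by
    rw [← hq]
    exact hz.fst_le_of_velocity_nonneg hM hx fun w hw => (hu w hw.2).1.le⟩

theorem SaddleData.unstable_unique (hV : ShapePotential V dV lo hi c B) (hh : 0 < h) (hM : 0 ≤ M)
    (hMB : B ≤ c * M ^ 2) (hs : SaddleData V dV lo hi P q) (hm : MonotoneForce V dV P q)
    (hy : IsClampedOrbit h V dV M y) (hz : IsClampedOrbit h V dV M z)
    (huy : IsUnstableUpTo h V P t y) (huz : IsUnstableUpTo h V P t z)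
    (hyq : (y t).1 = q) (hzq : (z t).1 = q) : ¬ (y t).2 < (z t).2 := by
  intro hlt
  have hvel : ∀ {w}, IsUnstableUpTo h V P t w → ∀ x ≤ t, |(w x).2| ≤ M := fun hu x hx =>
    abs_le_of_le_shapeEnergy hV hh hM hMB (hV.le P) (hu x hx).2.le
  set d := (z t).2 - (y t).2 with hd
  have hdpos : 0 < d := sub_pos.2 hlt
  have hη : ∀ x ≤ t, HasDerivAt (fun x => (z x).1 - (y x).1) ((z x).2 - (y x).2) x := fun x hx =>
    (hz.fst (hvel huz x hx)).sub (hy.fst (hvel huy x hx))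
  have hcy := hy.continuous
  have hcz := hz.continuous
  have claim : ∀ x ≤ t, d / 2 ≤ (z x).2 - (y x).2 := by
    intro x hx
    by_contra! hcon
    obtain ⟨r, hr, hr0, hpos⟩ := exists_first_zero
      (f := fun r => (z (t - r)).2 - (y (t - r)).2 - d / 2) (by fun_prop) (sub_nonneg.2 hx)
      (by simp only [sub_zero]; linarith) (by simp only [sub_sub_cancel]; linarith)
    have hge : ∀ w ∈ Set.Icc (t - r) t, 0 ≤ (z w).2 - (y w).2 := fun w hw => by
      rcases hw.1.eq_or_lt with rfl | hlt
      · linarith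
      · have := hpos (t - w) ⟨by linarith [hw.2], by linarith⟩
        simp only [sub_sub_cancel] at this
        linarith
    have hle : ∀ w ∈ Set.Icc (t - r) t, (z w).1 ≤ (y w).1 := fun w hw => by
      have := le_of_hasDerivAt_nonneg hw.2 (fun v hv => hη v hv.2)
        fun v hv => hge v ⟨hw.1.trans hv.1, hv.2⟩
      linarith
    have := le_of_hasDerivAt_nonneg (f := fun x => (y x).2 - (z x).2)
      (show t - r ≤ t by linarith [hr.1])
      (fun w hw => (hy.snd (hvel huy w hw.2)).sub (hz.snd (hvel huz w hw.2)))
      fun w hw => sub_nonneg.2 (shapeAcc_le_shapeAcc hV hh hs hm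
        (Set.Ioc_subset_Icc_self (huz.mem hh hV hM hs hz hzq hw.2))
        (Set.Ioc_subset_Icc_self (huy.mem hh hV hM hs hy hyq hw.2)) (hle w hw)
        (huy w hw.2).1.le (by linarith [hge w hw]))
    linarith
  set T := 2 * (q - P) / d with hT
  have hTpos : 0 ≤ T := by
    have := sub_pos.2 hs.lt
    positivity
  have h1 := mul_sub_le_of_hasDerivAt (show t - T ≤ t by linarith) (fun x hx => hη x hx.2)
    fun x hx => claim x hx.2
  rw [sub_sub_cancel, hT, show d / 2 * (2 * (q - P) / d) = q - P by field_simp] at h1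
  have h2 := huz.mem hh hV hM hs hz hzq (show t - T ≤ t by linarith)
  have h3 := huy.mem hh hV hM hs hy hyq (show t - T ≤ t by linarith)
  linarith [h2.1, h3.2]

/-- The unstable manifold meets the section `θ = q` in a continuous curve. -/
theorem SaddleData.exists_unstable_family (hV : ShapePotential V dV lo hi c B) (hh : 0 < h)
    (hM : 0 < M) (hMB : B ≤ c * M ^ 2) (hs : SaddleData V dV lo hi P q)
    (hm : MonotoneForce V dV P q) (hφ : IsClampedFlow h V dV M φ) :
    ∃ Y : ℝ → ℝ, Continuous Y ∧ ∀ t, IsUnstableUpTo h V P t (φ t (q, Y t)) := by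
  choose Y hY using hs.exists_unstable hV hh hM hMB hφ
  have hYpos : ∀ t, 0 < Y t := fun t => by simpa [hφ.init] using (hY t t le_rfl).1
  have hYlt : ∀ t, Y t < M := fun t => by
    simpa [hφ.init] using (hY t).velocity_lt hV hh hM.le hMB
  have hnot : ∀ {t z}, IsUnstableUpTo h V P t z → ¬ TurnsBack h V P t z ∧ ¬ LosesEnergy h V P t z :=
    fun hu => ⟨fun ⟨r, hr, h1, _⟩ => absurd h1 (not_lt.2 (hu _ (by linarith)).1.le),
      fun ⟨r, hr, h1, _⟩ => absurd h1 (not_lt.2 (sub_nonneg.2 (hu _ (by linarith)).2.le))⟩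
  have hcover : ∀ t b, 0 ≤ b → b ≠ Y t →
      TurnsBack h V P t (φ t (q, b)) ∨ LosesEnergy h V P t (φ t (q, b)) := fun t b hb hne => by
    rcases hs.trichotomy hV hh hM.le hMB (hφ.orbit t (q, b)) (by rw [hφ.init])
      (by rw [hφ.init]; exact hb) with h1 | h2 | h3
    · exact Or.inl h1
    · exact Or.inr h2
    · have u1 := hs.unstable_unique hV hh hM.le hMB hm (hφ.orbit _ _) (hφ.orbit _ _) h3 (hY t)
        (by rw [hφ.init]) (by rw [hφ.init])
      have u2 := hs.unstable_unique hV hh hM.le hMB hm (hφ.orbit _ _) (hφ.orbit _ _) (hY t) h3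
        (by rw [hφ.init]) (by rw [hφ.init])
      simp only [hφ.init] at u1 u2
      exact absurd (le_antisymm (not_lt.1 u2) (not_lt.1 u1)) hne
  have hopen : ∀ t : ℝ, Continuous fun b : ℝ => (t, b) := fun t => by fun_prop
  have hA := hφ.isOpen_turnsBack (P := P) (q := q) hV
  have hB := hφ.isOpen_losesEnergy (P := P) (q := q) hV
  have hlow : ∀ t b, TurnsBack h V P t (φ t (q, b)) → b ≤ M → b < Y t := fun t b hb hbM => by
    by_contra! hcon
    have hcon' : Y t < b := hcon.lt_of_ne fun hE => (hnot (hY t)).1 (hE ▸ hb)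
    obtain ⟨b', -, h1, h2⟩ := isPreconnected_Icc (a := b) (b := M)
      _ _ (hA.preimage (hopen t)) (hB.preimage (hopen t))
      (fun b' hb' => hcover t b' ((hYpos t).le.trans (hcon.trans hb'.1))
        (hcon'.trans_le hb'.1).ne') ⟨b, ⟨le_rfl, hbM⟩, hb⟩
      ⟨M, ⟨hbM, le_rfl⟩, hs.losesEnergy_max hV hh hM hMB hφ⟩
    exact turnsBack_losesEnergy_disjoint h1 h2
  have hup : ∀ t b, LosesEnergy h V P t (φ t (q, b)) → 0 ≤ b → Y t < b := fun t b hb hb0 => by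
    by_contra! hcon
    have hcon' : b < Y t := hcon.lt_of_ne fun hE => (hnot (hY t)).2 (hE ▸ hb)
    obtain ⟨b', -, h1, h2⟩ := isPreconnected_Icc (a := (0 : ℝ)) (b := b)
      _ _ (hA.preimage (hopen t)) (hB.preimage (hopen t))
      (fun b' hb' => hcover t b' hb'.1 (hb'.2.trans_lt hcon').ne)
      ⟨0, ⟨le_rfl, hb0⟩, hs.turnsBack_zero hV hh hM.le hMB hφ⟩ ⟨b, ⟨hb0, le_rfl⟩, hb⟩
    exact turnsBack_losesEnergy_disjoint h1 h2
  have hev : ∀ (t b : ℝ), Tendsto (fun s => (s, b)) (𝓝 t) (𝓝 (t, b)) := fun t b =>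
    (by fun_prop : Continuous fun s : ℝ => (s, b)).tendsto t
  refine ⟨Y, continuous_iff_continuousAt.2 fun t => tendsto_order.2 ⟨fun a ha => ?_,
    fun a ha => ?_⟩, hY⟩
  · obtain ⟨b, hb1, hb2⟩ := exists_between (max_lt ha (hYpos t))
    have hb0 : 0 ≤ b := (le_max_right _ _).trans hb1.le
    have hT : TurnsBack h V P t (φ t (q, b)) := (hcover t b hb0 hb2.ne).resolve_right
      fun hc => (hup t b hc hb0).not_gt hb2
    filter_upwards [(hev t b).eventually (hA.mem_nhds hT)] with s hs'
    exact ((le_max_left _ _).trans_lt hb1).trans (hlow s b hs' (hb2.le.trans (hYlt t).le))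
  · obtain ⟨b, hb1, hb2⟩ := exists_between (lt_min ha (hYlt t))
    have hb0 : 0 ≤ b := (hYpos t).le.trans hb1.le
    have hT : LosesEnergy h V P t (φ t (q, b)) := (hcover t b hb0 hb1.ne').resolve_left
      fun hc => (hlow t b hc (hb2.le.trans (min_le_right _ _))).not_gt hb1
    filter_upwards [(hev t b).eventually (hB.mem_nhds hT)] with s hs'
    exact (hup s b hs' hb0).trans (hb2.trans_le (min_le_left _ _))

end UnstableFamily

section Angle

/-- The angular speed of an orbit around the origin of the `(θ, g)`-plane. -/
noncomputable def angularSpeed (h : ℝ) (V dV : ℝ → ℝ) (x : ℝ) (p : ℝ × ℝ) : ℝ :=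
  (p.2 ^ 2 - p.1 * shapeAcc h V dV x p.1 p.2) / (p.1 ^ 2 + p.2 ^ 2)

variable {h : ℝ} {V dV : ℝ → ℝ} {lo hi c B M p q t : ℝ} {z : ℝ → ℝ × ℝ}
  {φ : ℝ → ℝ × ℝ → ℝ → ℝ × ℝ}

theorem sq_add_sq_pos_of_ne {a : ℝ × ℝ} (ha : a ≠ 0) : 0 < a.1 ^ 2 + a.2 ^ 2 := by
  by_contra! hcon
  refine ha (Prod.ext ?_ ?_)
  · exact pow_eq_zero_iff two_ne_zero |>.1 (by nlinarith [sq_nonneg a.1, sq_nonneg a.2])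
  · exact pow_eq_zero_iff two_ne_zero |>.1 (by nlinarith [sq_nonneg a.1, sq_nonneg a.2])

theorem continuous_shapeAcc (hV : ShapePotential V dV lo hi c B) (hh : 0 < h) :
    Continuous fun a : ℝ × ℝ × ℝ => shapeAcc h V dV a.1 a.2.1 a.2.2 := by
  have := hV.continuous
  have := hV.continuous_deriv
  have : ∀ a : ℝ × ℝ × ℝ, V a.2.1 + h * exp a.1 ≠ 0 := fun a => (hV.denom_pos hh _ _).ne'
  unfold shapeAcc
  fun_prop (disch := exact this)

theorem IsClampedOrbit.ne_zero (hV : ShapePotential V dV lo hi c B) (hh : 0 < h) (hM : 0 ≤ M)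
    (h0 : dV 0 = 0) (hz : IsClampedOrbit h V dV M z) (ht : (z t).1 ≠ 0) (x : ℝ) : z x ≠ 0 := by
  intro hx
  have := hz.eq_of_eq_at hV hh hM (IsClampedOrbit.const hM h0) (t := x) hx
  exact ht (by rw [this])

/-- A lift `ψ` of the polar angle vanishes modulo `π / 2` exactly when `θ` does. -/
theorem IsClampedOrbit.cos_angle_eq_zero_iff (hz : IsClampedOrbit h V dV M z)
    (hvel : ∀ x, |(z x).2| ≤ M) (hne : ∀ x, z x ≠ 0) {ψ : ℝ → ℝ}
    (hψ : ∀ x, HasDerivAt ψ (angularSpeed h V dV x (z x)) x)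
    (ht : (z t).1 * sin (ψ t) + (z t).2 * cos (ψ t) = 0) (x : ℝ) :
    cos (ψ x) = 0 ↔ (z x).1 = 0 := by
  have hN : ∀ x, 0 < (z x).1 ^ 2 + (z x).2 ^ 2 := fun x => sq_add_sq_pos_of_ne (hne x)
  have hderiv : ∀ x, HasDerivAt (fun x => ((z x).1 * sin (ψ x) + (z x).2 * cos (ψ x)) ^ 2 /
      ((z x).1 ^ 2 + (z x).2 ^ 2)) 0 x := fun x => by
    have h1 := hz.fst (hvel x)
    have h2 := hz.snd (hvel x)
    have h3 := (((h1.mul (hψ x).sin).add (h2.mul (hψ x).cos)).pow 2).div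
      ((h1.pow 2).add (h2.pow 2)) (hN x).ne'
    refine h3.congr_deriv ?_
    have := (hN x).ne'
    simp only [angularSpeed, Pi.add_apply, Pi.mul_apply, Pi.pow_apply]
    field_simp
    ring
  have hconst := is_const_of_deriv_eq_zero (fun x => (hderiv x).differentiableAt)
    (fun x => (hderiv x).deriv) x t
  simp only [ht] at hconst
  rw [zero_pow two_ne_zero, zero_div, div_eq_zero_iff, or_iff_left (hN x).ne',
    pow_eq_zero_iff two_ne_zero] at hconst
  constructor
  · intro hc
    rw [hc, mul_zero, add_zero] at hconst
    refine (mul_eq_zero.1 hconst).resolve_right fun hs => ?_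
    have := sin_sq_add_cos_sq (ψ x)
    rw [hc, hs] at this
    norm_num at this
  · intro hθ
    rw [hθ, zero_mul, zero_add] at hconst
    exact (mul_eq_zero.1 hconst).resolve_left fun hg => hne x (Prod.ext hθ hg)

theorem angularSpeed_of_fst_eq_zero {x : ℝ} {a : ℝ × ℝ} (ha : a ≠ 0) (h0 : a.1 = 0) :
    angularSpeed h V dV x a = 1 := by
  have := (sq_add_sq_pos_of_ne ha).ne'
  rw [angularSpeed, h0, zero_mul, sub_zero, zero_pow two_ne_zero, zero_add]
  rw [h0, zero_pow two_ne_zero, zero_add] at this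
  exact div_self this

/-- A continuous choice of the polar angle for a continuous family of orbits. -/
theorem exists_angle (hV : ShapePotential V dV lo hi c B) (hh : 0 < h)
    {z : ℝ → ℝ → ℝ × ℝ} (hz : Continuous fun a : ℝ × ℝ => z a.1 a.2) (hne : ∀ t x, z t x ≠ 0)
    (hq : ∀ t, (z t t).1 < 0) (hg : ∀ t, 0 < (z t t).2) :
    ∃ ψ : ℝ → ℝ → ℝ, Continuous (fun a : ℝ × ℝ => ψ a.1 a.2) ∧
      (∀ t x, HasDerivAt (ψ t) (angularSpeed h V dV x (z t x)) x) ∧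
      (∀ t, 0 ≤ ψ t t) ∧ ∀ t, (z t t).1 * sin (ψ t t) + (z t t).2 * cos (ψ t t) = 0 := by
  have hΩ : Continuous fun a : ℝ × ℝ => angularSpeed h V dV a.2 (z a.1 a.2) := by
    have h1 := (continuous_shapeAcc (h := h) hV hh).comp (continuous_snd.prodMk hz)
    have h2 : ∀ a : ℝ × ℝ, (z a.1 a.2).1 ^ 2 + (z a.1 a.2).2 ^ 2 ≠ 0 := fun a =>
      (sq_add_sq_pos_of_ne (hne _ _)).ne'
    exact ((hz.snd.pow 2).sub (hz.fst.mul h1)).div ((hz.fst.pow 2).add (hz.snd.pow 2)) h2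
  have hI : Continuous fun a : ℝ × ℝ =>
      ∫ s in (0 : ℝ)..a.2, angularSpeed h V dV s (z a.1 s) :=
    intervalIntegral.continuous_parametric_intervalIntegral_of_continuous
      (f := fun (a : ℝ × ℝ) s => angularSpeed h V dV s (z a.1 s))
      (hΩ.comp (by fun_prop : Continuous fun b : (ℝ × ℝ) × ℝ => (b.1.1, b.2))) continuous_snd
  have hdiag : Continuous fun t : ℝ => z t t :=
    hz.comp (by fun_prop : Continuous fun t : ℝ => (t, t))
  refine ⟨fun t x => arctan ((z t t).2 / -(z t t).1) +
    ((∫ s in (0 : ℝ)..x, angularSpeed h V dV s (z t s)) -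
      ∫ s in (0 : ℝ)..t, angularSpeed h V dV s (z t s)), ?_, fun t x => ?_, fun t => ?_,
    fun t => ?_⟩
  · have h1 : Continuous fun t : ℝ => arctan ((z t t).2 / -(z t t).1) :=
      continuous_arctan.comp (hdiag.snd.div hdiag.fst.neg fun t => (neg_pos.2 (hq t)).ne')
    exact (h1.comp continuous_fst).add (hI.sub
      (hI.comp (by fun_prop : Continuous fun a : ℝ × ℝ => (a.1, a.1))))
  · have hc : Continuous fun s => angularSpeed h V dV s (z t s) :=
      hΩ.comp (by fun_prop : Continuous fun s : ℝ => (t, s))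
    have := intervalIntegral.integral_hasDerivAt_right (hc.intervalIntegrable 0 x)
      (hc.stronglyMeasurableAtFilter _ _) hc.continuousAt
    exact (this.sub_const _).const_add _
  · simp only [sub_self, add_zero]
    exact arctan_nonneg.2 (div_nonneg (hg t).le (neg_nonneg.2 (hq t).le))
  · simp only [sub_self, add_zero]
    rw [sin_arctan, cos_arctan]
    have h1 := (hq t).ne
    have : √(1 + ((z t t).2 / -(z t t).1) ^ 2) ≠ 0 := by positivity
    field_simp
    ring

end Angle

section Settling

/-- `V` is maximal at `0` and has no other critical point in the interval `(-p, p)`, which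
contains the superlevel set of `V (-p)`. -/
structure CentralPeak (V dV : ℝ → ℝ) (p : ℝ) : Prop where
  pos : 0 < p
  mem_of_lt : ∀ θ, V (-p) < V θ → θ ∈ Set.Ioo (-p) p
  exists_deriv2 : ∃ ddV : ℝ → ℝ, ∃ K, ∀ θ ∈ Set.Ioo (-p) p, HasDerivAt dV (ddV θ) θ ∧ |ddV θ| ≤ K
  deriv_zero : dV 0 = 0
  eq_zero : ∀ θ ∈ Set.Ioo (-p) p, dV θ = 0 → θ = 0
  lt_peak : ∀ θ ∈ Set.Icc (-p) p, θ ≠ 0 → V θ < V 0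

variable {h : ℝ} {V dV : ℝ → ℝ} {c B M p q t : ℝ} {z : ℝ → ℝ × ℝ}

theorem shapeEnergy_le_potential (hh : 0 < h) {x θ g : ℝ} (hG : 0 ≤ shapeEnergy h V x θ g) :
    shapeEnergy h V x θ g ≤ V θ := by
  have h1 := le_shapeEnergy_iff.1 (le_refl (shapeEnergy h V x θ g))
  have : 0 ≤ g ^ 2 * (shapeEnergy h V x θ g + h * exp x) := by positivity
  linarith

theorem le_mul_shapeAcc (hV : ShapePotential V dV (-p) p c B) (hh : 0 < h) {x θ g : ℝ}
    (hx : x ≤ 0) (hg : |g| ≤ M) :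
    1 / (4 * (B + h)) * dV θ ^ 2 - (1 + M ^ 2) ^ 2 * (B + h) * g ^ 2 ≤
      shapeAcc h V dV x θ g * dV θ := by
  have hB := hV.bound_pos
  have hD := hV.denom_pos hh x θ
  have hDA : V θ + h * exp x ≤ B + h := by
    have := exp_le_one_iff.2 hx
    have := hV.le_bound θ
    nlinarith
  have hg2 : g ^ 2 ≤ M ^ 2 := sq_le_sq.2 (hg.trans (le_abs_self M))
  set D := V θ + h * exp x with hDdef
  set A := B + h
  have hA : 0 < A := by positivity
  set r := h * exp x / D with hr
  have hr0 : 0 ≤ r := by positivity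
  have hr1 : r ≤ 1 := (div_le_one hD).2 (by linarith [hV.pos, hV.le θ])
  have e1 : dV θ ^ 2 / A ≤ dV θ ^ 2 / D := div_le_div_of_nonneg_left (sq_nonneg _) hD hDA
  have e2 : g * (1 + r) * dV θ ≤ 2 * (|g| * |dV θ|) := by
    have : g * dV θ ≤ |g| * |dV θ| := by rw [← abs_mul]; exact le_abs_self _
    have : 0 ≤ |g| * |dV θ| := by positivity
    nlinarith
  have e3 : (1 + M ^ 2) * (|g| * |dV θ|) ≤
      dV θ ^ 2 / (4 * A) + (1 + M ^ 2) ^ 2 * A * g ^ 2 := by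
    have h1 := sq_nonneg (|dV θ| / (2 * A) - (1 + M ^ 2) * |g|)
    have h2 : A * (|dV θ| / (2 * A) - (1 + M ^ 2) * |g|) ^ 2 =
        |dV θ| ^ 2 / (4 * A) + (1 + M ^ 2) ^ 2 * A * |g| ^ 2 - (1 + M ^ 2) * (|g| * |dV θ|) := by
      field_simp
      ring
    rw [sq_abs, sq_abs] at h2
    linarith [mul_nonneg hA.le h1]
  have e4 : shapeAcc h V dV x θ g * dV θ =
      (1 + g ^ 2) / 2 * (dV θ ^ 2 / D - g * (1 + r) * dV θ) := by
    rw [shapeAcc, ← hDdef, ← hr]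
    ring
  have e5 : 0 ≤ dV θ ^ 2 / A := by positivity
  have e6 : dV θ ^ 2 / (4 * A) = dV θ ^ 2 / A / 4 := by
    field_simp
  have e7 : 1 / (4 * A) * dV θ ^ 2 = dV θ ^ 2 / A / 4 := by
    field_simp
  have e8 : (1 + g ^ 2) * (|g| * |dV θ|) ≤ (1 + M ^ 2) * (|g| * |dV θ|) :=
    mul_le_mul_of_nonneg_right (by linarith) (by positivity)
  have e9 : (1 + g ^ 2) / 2 * (dV θ ^ 2 / A - 2 * (|g| * |dV θ|)) ≤
      (1 + g ^ 2) / 2 * (dV θ ^ 2 / D - g * (1 + r) * dV θ) :=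
    mul_le_mul_of_nonneg_left (by linarith) (by positivity)
  have e10 : dV θ ^ 2 / A / 2 ≤ (1 + g ^ 2) / 2 * (dV θ ^ 2 / A) := by
    nlinarith [mul_nonneg (sq_nonneg g) e5]
  rw [e4, e7]
  linarith

namespace CentralPeak

theorem mem_of_lt_energy (hV : ShapePotential V dV (-p) p c B) (hh : 0 < h)
    (hp : CentralPeak V dV p) {x θ g : ℝ} (hG : V (-p) < shapeEnergy h V x θ g) :
    θ ∈ Set.Ioo (-p) p :=
  hp.mem_of_lt _ (lt_potential_of_lt_shapeEnergy hh (hV.pos.trans_le (hV.le _)) hG)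

theorem exists_near_peak (hV : ShapePotential V dV (-p) p c B) (hh : 0 < h)
    (hp : CentralPeak V dV p) {ρ : ℝ} (hρ : 0 < ρ) :
    ∃ ε, 0 < ε ∧ ∀ x, ∀ θ ∈ Set.Icc (-p) p, ∀ g, V 0 - ε ≤ shapeEnergy h V x θ g →
      |θ| ≤ ρ ∧ |g| ≤ ρ := by
  have hS : IsCompact (Set.Icc (-p) p ∩ {θ | ρ ≤ |θ|}) :=
    isCompact_Icc.inter_right (isClosed_le continuous_const continuous_abs)
  obtain ⟨e, he, hle⟩ := hS.exists_forall_le' (f := fun θ => V 0 - V θ) (a := 0)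
    (continuous_const.sub hV.continuous).continuousOn fun θ hθ =>
      sub_pos.2 (hp.lt_peak θ hθ.1 fun h0 => by
        have := hθ.2
        rw [Set.mem_ofPred_eq, h0, abs_zero] at this
        linarith)
  have hVp : 0 < V 0 - V (-p) := sub_pos.2 (hp.lt_peak _ ⟨le_rfl, by linarith [hp.pos]⟩
    (neg_ne_zero.2 hp.pos.ne'))
  have hc := hV.pos
  refine ⟨min (e / 2) (min (V 0 - V (-p)) (c * ρ ^ 2)), by positivity, fun x θ hθ g hG => ?_⟩
  set ε := min (e / 2) (min (V 0 - V (-p)) (c * ρ ^ 2))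
  have e1 : ε ≤ e / 2 := min_le_left _ _
  have e2 : ε ≤ V 0 - V (-p) := (min_le_right _ _).trans (min_le_left _ _)
  have e3 : ε ≤ c * ρ ^ 2 := (min_le_right _ _).trans (min_le_right _ _)
  have hv : c ≤ V 0 - ε := by linarith [hV.le (-p)]
  have h1 := le_potential_of_le_shapeEnergy hh (hV.pos.trans_le hv) hG
  have hθ0 : V θ ≤ V 0 := by
    by_cases h0 : θ = 0
    · rw [h0]
    · exact (hp.lt_peak θ hθ h0).le
  constructor
  · by_contra! hcon
    have := hle θ ⟨hθ, hcon.le⟩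
    linarith
  · rw [le_shapeEnergy_iff] at hG
    refine abs_le_of_sq_le_sq (le_of_mul_le_mul_left ?_ hc) hρ.le
    have : g ^ 2 * c ≤ g ^ 2 * (V 0 - ε + h * exp x) :=
      mul_le_mul_of_nonneg_left (by linarith [show 0 < h * exp x by positivity]) (sq_nonneg g)
    linarith

/-- Away from the critical points the dissipation is bounded from below. -/
theorem exists_dissipation (hV : ShapePotential V dV (-p) p c B) (hh : 0 < h)
    (hp : CentralPeak V dV p) {μ ε η : ℝ} (hμ : 0 < μ) (hε : 0 < ε) (hη : 0 < η) :
    ∃ κ, 0 < κ ∧ ∀ x ≤ 0, ∀ θ g, V (-p) < shapeEnergy h V x θ g →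
      V (-p) + η ≤ shapeEnergy h V x θ g + μ * (g * dV θ) → shapeEnergy h V x θ g ≤ V 0 - ε →
      κ ≤ g ^ 2 + dV θ ^ 2 := by
  have hS : IsCompact (Set.Icc (-p) p ∩ {θ | V (-p) + η / 2 ≤ V θ ∧ V θ ≤ V 0 - ε / 2}) :=
    isCompact_Icc.inter_right ((isClosed_le continuous_const hV.continuous).inter
      (isClosed_le hV.continuous continuous_const))
  obtain ⟨k, hk, hle⟩ := hS.exists_forall_le' (f := fun θ => dV θ ^ 2) (a := 0)
    (hV.continuous_deriv.pow 2).continuousOn fun θ hθ => by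
      obtain ⟨-, h1, h2⟩ := hθ
      have h3 : dV θ ≠ 0 := fun h0 => by
        rw [hp.eq_zero θ (hp.mem_of_lt θ (by linarith)) h0] at h2
        linarith
      positivity
  have hB := hV.bound_pos
  refine ⟨min k (min (η / (2 * μ)) (ε / (2 * (B + h)))), by positivity,
    fun x hx θ g hG0 hH hG => ?_⟩
  by_contra! hcon
  have c1 := hcon.trans_le (min_le_left _ _)
  have c2 := hcon.trans_le ((min_le_right _ _).trans (min_le_left _ _))
  have c3 := hcon.trans_le ((min_le_right _ _).trans (min_le_right _ _))
  rw [lt_div_iff₀ (by positivity)] at c2 c3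
  have hGpos : 0 < shapeEnergy h V x θ g := (hV.pos.trans_le (hV.le _)).trans hG0
  have hGV := shapeEnergy_le_potential hh hGpos.le
  have hVG := le_shapeEnergy_iff.1 (le_refl (shapeEnergy h V x θ g))
  have hmem := hp.mem_of_lt_energy hV hh hG0
  have hVB := hV.le_bound θ
  have hexp : h * exp x ≤ h := by
    have := exp_le_one_iff.2 hx
    nlinarith
  have hGe : V θ - shapeEnergy h V x θ g = g ^ 2 * (shapeEnergy h V x θ g + h * exp x) := by
    have : 0 < 1 + g ^ 2 := by positivity
    rw [shapeEnergy]
    field_simp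
    ring
  have h2 : g ^ 2 * (shapeEnergy h V x θ g + h * exp x) ≤ g ^ 2 * (B + h) :=
    mul_le_mul_of_nonneg_left (by linarith) (sq_nonneg g)
  have h3 : 0 ≤ dV θ ^ 2 * (B + h) := by positivity
  have h4 : μ * (g * dV θ) ≤ μ * ((g ^ 2 + dV θ ^ 2)) / 1 := by
    rw [div_one]
    exact mul_le_mul_of_nonneg_left
      (by nlinarith [sq_nonneg (g - dV θ), sq_nonneg g, sq_nonneg (dV θ)]) hμ.le
  have := hle θ ⟨⟨hmem.1.le, hmem.2.le⟩, by linarith, by linarith⟩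
  linarith [sq_nonneg g]

/-- Up to time `0` an orbit with more energy than the saddle comes close to the peak in bounded
time. -/
theorem exists_settling_time (hV : ShapePotential V dV (-p) p c B) (hh : 0 < h) (hM : 0 < M)
    (hMB : B ≤ c * M ^ 2) (hp : CentralPeak V dV p) :
    ∃ μ, 0 < μ ∧ ∀ ε, 0 < ε → ∀ η, 0 < η → ∃ T, 0 ≤ T ∧ ∀ z, IsClampedOrbit h V dV M z →
      (∀ x, V (-p) < shapeEnergy h V x (z x).1 (z x).2) → ∀ t,
      V (-p) + η ≤ shapeEnergy h V t (z t).1 (z t).2 + μ * ((z t).2 * dV (z t).1) →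
      ∀ x, t + T ≤ x → x ≤ 0 → V 0 - ε ≤ shapeEnergy h V x (z x).1 (z x).2 := by
  obtain ⟨ddV, K, hdd⟩ := hp.exists_deriv2
  have hc := hV.pos
  have hB := hV.bound_pos
  have hK : 0 ≤ K := (abs_nonneg _).trans (hdd 0 ⟨by linarith [hp.pos], hp.pos⟩).2
  set a := 1 / (4 * (B + h)) with ha
  set C := (1 + M ^ 2) ^ 2 * (B + h) + K with hC
  set b := c / (1 + M ^ 2) with hb
  have ha0 : 0 < a := by positivity
  have hC0 : 0 < C := by positivity
  have hb0 : 0 < b := by positivity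
  set μ := b / (2 * C) with hμ
  have hμ0 : 0 < μ := by positivity
  set c' := min (b / 2) (μ * a) with hc'
  have hc'0 : 0 < c' := by positivity
  refine ⟨μ, hμ0, fun ε hε η hη => ?_⟩
  obtain ⟨κ, hκ, hdis⟩ := hp.exists_dissipation hV hh hμ0 hε hη
  refine ⟨(B + μ * (M * B)) / (c' * κ), by positivity, fun z hz hG t hHt x htx hx0 => ?_⟩
  have hvel : ∀ x, |(z x).2| ≤ M := fun x =>
    abs_le_of_le_shapeEnergy hV hh hM.le hMB (hV.le _) (hG x).le
  have hmem : ∀ x, (z x).1 ∈ Set.Ioo (-p) p := fun x => hp.mem_of_lt_energy hV hh (hG x)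
  have hGpos : ∀ x, 0 < shapeEnergy h V x (z x).1 (z x).2 := fun x =>
    (hV.pos.trans_le (hV.le _)).trans (hG x)
  set F : ℝ → ℝ := fun x => shapeEnergy h V x (z x).1 (z x).2 + μ * ((z x).2 * dV (z x).1)
  set F' : ℝ → ℝ := fun x => (z x).2 ^ 2 * (V (z x).1 + h * exp x) / (1 + (z x).2 ^ 2) +
    μ * (shapeAcc h V dV x (z x).1 (z x).2 * dV (z x).1 + (z x).2 * (ddV (z x).1 * (z x).2))
  have hF : ∀ x, HasDerivAt F (F' x) x := fun x =>
    (hz.hasDerivAt_energy hV hh (hvel x) (hmem x)).add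
      (((hz.snd (hvel x)).mul ((hdd _ (hmem x)).1.comp x (hz.fst (hvel x)))).const_mul μ)
  have hF' : ∀ x ≤ 0, c' * ((z x).2 ^ 2 + dV (z x).1 ^ 2) ≤ F' x := fun x hx => by
    have h1 := le_mul_shapeAcc hV hh hx (θ := (z x).1) (hvel x)
    have h2 : b * (z x).2 ^ 2 ≤
        (z x).2 ^ 2 * (V (z x).1 + h * exp x) / (1 + (z x).2 ^ 2) := by
      have hg2 : (z x).2 ^ 2 ≤ M ^ 2 := sq_le_sq.2 ((hvel x).trans (le_abs_self M))
      rw [mul_comm, mul_div_assoc]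
      refine mul_le_mul_of_nonneg_left (div_le_div₀ (hV.denom_pos hh _ _).le ?_ (by positivity)
        (by linarith)) (sq_nonneg _)
      linarith [hV.le (z x).1, show 0 < h * exp x by positivity]
    have h3 : -K * (z x).2 ^ 2 ≤ (z x).2 * (ddV (z x).1 * (z x).2) := by
      have := mul_le_mul_of_nonneg_right (abs_le.1 (hdd _ (hmem x)).2).1 (sq_nonneg (z x).2)
      linarith
    have h4 : μ * (a * dV (z x).1 ^ 2 - C * (z x).2 ^ 2) ≤
        μ * (shapeAcc h V dV x (z x).1 (z x).2 * dV (z x).1 +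
          (z x).2 * (ddV (z x).1 * (z x).2)) :=
      mul_le_mul_of_nonneg_left (by rw [hC]; linarith) hμ0.le
    have h5 : μ * C = b / 2 := by
      rw [hμ]
      field_simp
    have h6 : c' * (z x).2 ^ 2 ≤ b / 2 * (z x).2 ^ 2 :=
      mul_le_mul_of_nonneg_right (min_le_left _ _) (sq_nonneg _)
    have h7 : c' * dV (z x).1 ^ 2 ≤ μ * a * dV (z x).1 ^ 2 :=
      mul_le_mul_of_nonneg_right (min_le_right _ _) (sq_nonneg _)
    have h8 : μ * (a * dV (z x).1 ^ 2 - C * (z x).2 ^ 2) =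
      μ * a * dV (z x).1 ^ 2 - b / 2 * (z x).2 ^ 2 := by rw [← h5]; ring
    simp only [F']
    linarith
  by_contra! hcon
  have hmono : ∀ y ∈ Set.Icc t x, shapeEnergy h V y (z y).1 (z y).2 ≤ V 0 - ε := fun y hy =>
    (le_of_hasDerivAt_nonneg hy.2
      (fun r _ => hz.hasDerivAt_energy hV hh (hvel r) (hmem r)) fun r _ =>
      div_nonneg (mul_nonneg (sq_nonneg _) (hV.denom_pos hh _ _).le)
        (by positivity)).trans hcon.le
  have hFle : ∀ y ∈ Set.Icc t x, V (-p) + η ≤ F y := fun y hy =>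
    hHt.trans (le_of_hasDerivAt_nonneg hy.1 (fun r _ => hF r) fun r hr =>
      le_trans (by positivity) (hF' r (hr.2.trans (hy.2.trans hx0))))
  have hT0 : 0 ≤ (B + μ * (M * B)) / (c' * κ) := by positivity
  have key := mul_sub_le_of_hasDerivAt (c := c' * κ) (f := F) (f' := F')
    (by linarith : t ≤ x) (fun r _ => hF r) fun r hr =>
      (mul_le_mul_of_nonneg_left (hdis r (hr.2.trans hx0) _ _ (hG r) (hFle r hr) (hmono r hr))
        hc'0.le).trans (hF' r (hr.2.trans hx0))
  have h1 : B + μ * (M * B) ≤ c' * κ * (x - t) := by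
    have : (B + μ * (M * B)) / (c' * κ) ≤ x - t := by linarith
    rw [div_le_iff₀ (by positivity)] at this
    linarith
  have h2 : F x ≤ B + μ * (M * B) := by
    refine add_le_add ((shapeEnergy_le_potential hh (hGpos x).le).trans (hV.le_bound _))
      (mul_le_mul_of_nonneg_left ?_ hμ0.le)
    refine (le_abs_self _).trans ?_
    rw [abs_mul]
    exact mul_le_mul (hvel x) (hV.abs_deriv_le _) (abs_nonneg _) hM.le
  have h3 : V (-p) + η ≤ F t := hHt
  linarith [hV.le (-p)]

end CentralPeak

end Settling

section Spiral

/-- Near the origin of the `(θ, g)`-plane and for very negative times, orbits rotate with a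
uniformly positive angular speed. -/
def IsSpiralling (h : ℝ) (V dV : ℝ → ℝ) : Prop :=
  ∃ ρ, 0 < ρ ∧ ∃ ω, 0 < ω ∧ ∃ K, 0 ≤ K ∧ ∀ x ≤ -K, ∀ θ g, |θ| ≤ ρ → |g| ≤ ρ →
    ω * (θ ^ 2 + g ^ 2) ≤ g ^ 2 - θ * shapeAcc h V dV x θ g

/-- A continuous family of orbits on the unstable manifold of `(-p, 0)`, the orbit with label `t`
passing through `θ = q` at time `t`. -/
structure UnstableFamily (h : ℝ) (V dV : ℝ → ℝ) (M p q : ℝ) (z : ℝ → ℝ → ℝ × ℝ) : Prop where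
  orbit : ∀ t, IsClampedOrbit h V dV M (z t)
  continuous : Continuous fun a : ℝ × ℝ => z a.1 a.2
  fst_self : ∀ t, (z t t).1 = q
  unstable : ∀ t, IsUnstableUpTo h V (-p) t (z t)

variable {h : ℝ} {V dV : ℝ → ℝ} {c B M p q t : ℝ} {z : ℝ → ℝ → ℝ × ℝ}

namespace UnstableFamily

theorem lt_energy (hV : ShapePotential V dV (-p) p c B) (hh : 0 < h) (hM : 0 < M)
    (hMB : B ≤ c * M ^ 2) (hp : CentralPeak V dV p) (hz : UnstableFamily h V dV M p q z)
    (t x : ℝ) : V (-p) < shapeEnergy h V x (z t x).1 (z t x).2 := by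
  rcases le_total x t with hx | hx
  · exact (hz.unstable t x hx).2
  · exact (hz.orbit t).lt_energy_forward hV hh hM.le hMB (hV.le _) hp.mem_of_lt
      (hz.unstable t t le_rfl).2 hx

theorem abs_velocity_le' (hV : ShapePotential V dV (-p) p c B) (hh : 0 < h) (hM : 0 < M)
    (hMB : B ≤ c * M ^ 2) (hp : CentralPeak V dV p) (hz : UnstableFamily h V dV M p q z)
    (t x : ℝ) : |(z t x).2| ≤ M :=
  abs_le_of_le_shapeEnergy hV hh hM.le hMB (hV.le _) (hz.lt_energy hV hh hM hMB hp t x).le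

theorem mem (hV : ShapePotential V dV (-p) p c B) (hh : 0 < h) (hM : 0 < M)
    (hMB : B ≤ c * M ^ 2) (hp : CentralPeak V dV p) (hz : UnstableFamily h V dV M p q z)
    (t x : ℝ) : (z t x).1 ∈ Set.Ioo (-p) p :=
  hp.mem_of_lt_energy hV hh (hz.lt_energy hV hh hM hMB hp t x)

theorem velocity_decay (hV : ShapePotential V dV (-p) p c B) (hh : 0 < h) (hM : 0 < M)
    (hMB : B ≤ c * M ^ 2) (hp : CentralPeak V dV p) (hz : UnstableFamily h V dV M p q z)
    (t x : ℝ) : |(z t x).2| ≤ √(B / h) * exp (-x / 2) :=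
  abs_velocity_le hV hh (hV.pos' _).le (hz.lt_energy hV hh hM hMB hp t x).le

/-- The orbit stays away from `θ = 0` from time `x` on. -/
def _root_.Escapes (h B : ℝ) (z : ℝ → ℝ × ℝ) (x : ℝ) : Prop :=
  2 * √(B / h) * exp (-x / 2) < |(z x).1|

theorem fst_ne_zero_of_escapes (hV : ShapePotential V dV (-p) p c B) (hh : 0 < h) (hM : 0 < M)
    (hMB : B ≤ c * M ^ 2) (hp : CentralPeak V dV p) (hz : UnstableFamily h V dV M p q z)
    {x y : ℝ} (hx : Escapes h B (z t) x) (hxy : x ≤ y) : (z t y).1 ≠ 0 := by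
  intro h0
  have := abs_drift_le (A := √(B / h)) (f := fun x => (z t x).1) (by positivity) hxy
    (fun r _ => (hz.orbit t).fst (hz.abs_velocity_le' hV hh hM hMB hp t r))
    fun r _ => hz.velocity_decay hV hh hM hMB hp t r
  simp only [h0, zero_sub, abs_neg] at this
  exact absurd hx (not_lt.2 this)

theorem tendsto_decay (A : ℝ) : Tendsto (fun x : ℝ => A * exp (-x / 2)) atTop (𝓝 0) := by
  have h1 : Tendsto (fun x : ℝ => -x / 2) atTop atBot :=
    tendsto_neg_atTop_atBot.atBot_div_const two_pos
  simpa using (tendsto_exp_atBot.comp h1).const_mul A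

theorem exists_escape_or_tendsto (hV : ShapePotential V dV (-p) p c B) (hh : 0 < h) (hM : 0 < M)
    (hMB : B ≤ c * M ^ 2) (hp : CentralPeak V dV p) (hz : UnstableFamily h V dV M p q z) (t : ℝ) :
    (∃ x, Escapes h B (z t) x) ∨ Tendsto (z t) atTop (𝓝 (0, 0)) := by
  refine or_iff_not_imp_left.2 fun hne => ?_
  simp only [Escapes, not_exists, not_lt] at hne
  exact (squeeze_zero_norm hne (tendsto_decay _)).prodMk_nhds
    (squeeze_zero_norm (hz.velocity_decay hV hh hM hMB hp t) (tendsto_decay _))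


end UnstableFamily

end Spiral

section Spiral

/-- A continuous lift of the polar angle of the orbits of the family, measured from the negative
`θ`-axis. -/
structure AngleFamily (h : ℝ) (V dV : ℝ → ℝ) (z : ℝ → ℝ → ℝ × ℝ) (ψ : ℝ → ℝ → ℝ) : Prop where
  continuous : Continuous fun a : ℝ × ℝ => ψ a.1 a.2
  hasDerivAt : ∀ t x, HasDerivAt (ψ t) (angularSpeed h V dV x (z t x)) x
  nonneg : ∀ t, 0 ≤ ψ t t
  cos_eq_zero_iff : ∀ t x, cos (ψ t x) = 0 ↔ (z t x).1 = 0
  ne_zero : ∀ t x, z t x ≠ 0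

variable {h : ℝ} {V dV : ℝ → ℝ} {c B M p q t : ℝ} {z : ℝ → ℝ → ℝ × ℝ} {ψ : ℝ → ℝ → ℝ}

theorem UnstableFamily.exists_angleFamily (hV : ShapePotential V dV (-p) p c B) (hh : 0 < h)
    (hM : 0 < M) (hMB : B ≤ c * M ^ 2) (hp : CentralPeak V dV p)
    (hz : UnstableFamily h V dV M p q z) (hq : q < 0) : ∃ ψ, AngleFamily h V dV z ψ := by
  have hne : ∀ t x, z t x ≠ 0 := fun t x =>
    (hz.orbit t).ne_zero hV hh hM.le hp.deriv_zero (t := t) (by rw [hz.fst_self]; exact hq.ne) x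
  obtain ⟨ψ, h1, h2, h3, h4⟩ := exists_angle hV hh hz.continuous hne
    (fun t => by rw [hz.fst_self]; exact hq) fun t => (hz.unstable t t le_rfl).1
  exact ⟨ψ, h1, h2, h3, fun t x => (hz.orbit t).cos_angle_eq_zero_iff
    (hz.abs_velocity_le' hV hh hM hMB hp t) (hne t) (h2 t) (h4 t) x, hne⟩

namespace AngleFamily

theorem lt_of_lt (hψ : AngleFamily h V dV z ψ) {L x y : ℝ} (hL : cos L = 0) (hx : L < ψ t x)
    (hxy : x ≤ y) : L < ψ t y := by
  refine sub_pos.1 (pos_of_deriv_pos_of_eq_zero (f := fun x => ψ t x - L)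
    (fun x => (hψ.hasDerivAt t x).sub_const L) (sub_pos.2 hx) (fun r _ hr => ?_) hxy)
  rw [angularSpeed_of_fst_eq_zero (hψ.ne_zero t r)]
  · exact one_pos
  · rw [← hψ.cos_eq_zero_iff, sub_eq_zero.1 hr, hL]

theorem lt_of_ne_zero (hψ : AngleFamily h V dV z ψ) {L x y : ℝ} (hL : cos L = 0)
    (hne : ∀ y ≥ x, (z t y).1 ≠ 0) (hx : ψ t x < L) (hxy : x ≤ y) : ψ t y < L := by
  refine sub_pos.1 (pos_of_deriv_pos_of_eq_zero (f := fun x => L - ψ t x)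
    (fun x => (hψ.hasDerivAt t x).const_sub L) (sub_pos.2 hx) (fun r hr hr0 => ?_) hxy)
  exact absurd ((hψ.cos_eq_zero_iff t r).1 (by rw [← sub_eq_zero.1 hr0, hL])) (hne r hr)

/-- Orbits starting early wind arbitrarily often around the origin. -/
theorem exists_large_angle (hV : ShapePotential V dV (-p) p c B) (hh : 0 < h) (hM : 0 < M)
    (hMB : B ≤ c * M ^ 2) (hp : CentralPeak V dV p) (hs : SaddleData V dV (-p) p (-p) q)
    (hspir : IsSpiralling h V dV) (hz : UnstableFamily h V dV M p q z)
    (hψ : AngleFamily h V dV z ψ) (X L : ℝ) : ∃ t < X, ∃ x, L < ψ t x := by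
  obtain ⟨ρ, hρ, ω, hω, K, hK, hrot⟩ := hspir
  obtain ⟨ε, hε, hnear⟩ := hp.exists_near_peak hV hh hρ
  obtain ⟨μ, hμ, hset⟩ := hp.exists_settling_time hV hh hM hMB
  have hdq : 0 < dV q := hs.deriv_pos q ⟨hs.lt, le_rfl⟩
  have hVq : V (-p) < V q := hs.lt_potential hV ⟨hs.lt, le_rfl⟩
  set δ := V q - V (-p) with hδ
  have hδ0 : 0 < δ := sub_pos.2 hVq
  have hVp : 0 < V (-p) := hV.pos' _
  set g₀ := min 1 (δ / 2 / (V (-p) + δ / 2 + h)) with hg₀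
  have hg₀0 : 0 < g₀ := by positivity
  obtain ⟨T, hT, hsett⟩ := hset ε hε (min (δ / 2) (μ * (g₀ * dV q))) (by positivity)
  obtain ⟨t, ht⟩ : ∃ t, t < min X (min 0 (-K - T - max 0 ((L + π) / ω))) := exists_lt _
  have htX : t < X := ht.trans_le (min_le_left _ _)
  have ht0 : t < 0 := ht.trans_le ((min_le_right _ _).trans (min_le_left _ _))
  have htK : t < -K - T - max 0 ((L + π) / ω) :=
    ht.trans_le ((min_le_right _ _).trans (min_le_right _ _))
  have hm0 := le_max_left 0 ((L + π) / ω)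
  have hm1 := le_max_right 0 ((L + π) / ω)
  have hY := (hz.unstable t t le_rfl).1
  have hGt := (hz.unstable t t le_rfl).2
  have hstart : V (-p) + min (δ / 2) (μ * (g₀ * dV q)) ≤
      shapeEnergy h V t (z t t).1 (z t t).2 + μ * ((z t t).2 * dV (z t t).1) := by
    rw [hz.fst_self] at hGt ⊢
    have h1 := min_le_left (δ / 2) (μ * (g₀ * dV q))
    have h2 := min_le_right (δ / 2) (μ * (g₀ * dV q))
    rcases le_total g₀ (z t t).2 with hg | hg
    · have : μ * (g₀ * dV q) ≤ μ * ((z t t).2 * dV q) := by gcongr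
      linarith
    · have h3 : V (-p) + δ / 2 ≤ shapeEnergy h V t q (z t t).2 := by
        rw [le_shapeEnergy_iff]
        have e1 : h * exp t ≤ h := by
          have := exp_le_one_iff.2 ht0.le
          nlinarith
        have e2 : (z t t).2 ^ 2 ≤ g₀ := by
          have := min_le_left 1 (δ / 2 / (V (-p) + δ / 2 + h))
          nlinarith
        have e3 : g₀ * (V (-p) + δ / 2 + h) ≤ δ / 2 := by
          rw [← le_div_iff₀ (by positivity)]
          exact min_le_right _ _
        have e4 : (z t t).2 ^ 2 * (V (-p) + δ / 2 + h * exp t) ≤ g₀ * (V (-p) + δ / 2 + h) :=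
          mul_le_mul e2 (by linarith) (by positivity) hg₀0.le
        linarith
      have : 0 ≤ μ * ((z t t).2 * dV q) := by positivity
      linarith
  have hpi := pi_pos
  refine ⟨t, htX, -K, ?_⟩
  have hlow : -(π / 2) < ψ t (t + T) :=
    hψ.lt_of_lt (x := t) (by rw [cos_neg, cos_pi_div_two]) (by linarith [hψ.nonneg t]) (by linarith)
  have hgrow := mul_sub_le_of_hasDerivAt (c := ω) (f := ψ t) (a := t + T) (b := -K)
    (by linarith) (fun x _ => hψ.hasDerivAt t x) fun x hx => by
      have hmem := hz.mem hV hh hM hMB hp t x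
      obtain ⟨h1, h2⟩ := hnear x (z t x).1 ⟨hmem.1.le, hmem.2.le⟩ (z t x).2
        (hsett _ (hz.orbit t) (hz.lt_energy hV hh hM hMB hp t) t hstart x hx.1
          (by linarith [hx.2]))
      rw [angularSpeed, le_div_iff₀ (sq_add_sq_pos_of_ne (hψ.ne_zero t x))]
      exact hrot x hx.2 _ _ h1 h2
  have : (L + π) / ω < -K - (t + T) := by linarith
  rw [div_lt_iff₀ hω] at this
  linarith

theorem isOpen_lt (hψ : AngleFamily h V dV z ψ) (L x : ℝ) : IsOpen {t | ψ t x < L} :=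
  _root_.isOpen_lt (hψ.continuous.comp (by fun_prop : Continuous fun t : ℝ => (t, x))) continuous_const

theorem isOpen_gt (hψ : AngleFamily h V dV z ψ) (L x : ℝ) : IsOpen {t | L < ψ t x} :=
  _root_.isOpen_lt continuous_const
    (hψ.continuous.comp (by fun_prop : Continuous fun t : ℝ => (t, x)))

/-- The peak is reached by orbits of the family with arbitrarily negative label. -/
theorem exists_tendsto (hV : ShapePotential V dV (-p) p c B) (hh : 0 < h) (hM : 0 < M)
    (hMB : B ≤ c * M ^ 2) (hp : CentralPeak V dV p) (hs : SaddleData V dV (-p) p (-p) q)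
    (hspir : IsSpiralling h V dV) (hz : UnstableFamily h V dV M p q z)
    (hψ : AngleFamily h V dV z ψ) (X : ℝ) : ∃ t < X, Tendsto (z t) atTop (𝓝 (0, 0)) := by
  by_contra! hcon
  have hesc : ∀ t < X, ∃ x, Escapes h B (z t) x := fun t ht =>
    (hz.exists_escape_or_tendsto hV hh hM hMB hp t).resolve_right (hcon t ht)
  have hne : ∀ {t x}, Escapes h B (z t) x → ∀ y ≥ x, (z t y).1 ≠ 0 := fun hx y hy =>
    hz.fst_ne_zero_of_escapes hV hh hM hMB hp hx hy
  have hall : ∀ L, cos L = 0 → Set.Iio X ⊆ ⋃ x, {t | L < ψ t x} := fun L hL => by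
    have hEsc : ∀ x, IsOpen {t | Escapes h B (z t) x} := fun x =>
      _root_.isOpen_lt continuous_const
        (hz.continuous.comp (by fun_prop : Continuous fun t : ℝ => (t, x))).fst.abs
    refine isPreconnected_Iio.subset_left_of_subset_union
      (v := ⋃ x, {t | Escapes h B (z t) x} ∩ {t | ψ t x < L})
      (isOpen_iUnion fun x => hψ.isOpen_gt L x)
      (isOpen_iUnion fun x => (hEsc x).inter (hψ.isOpen_lt L x)) ?_ (fun t ht => ?_) ?_
    · rw [Set.disjoint_left]
      rintro t ⟨_, ⟨x, rfl⟩, hx⟩ ⟨_, ⟨y, rfl⟩, hy, hyL⟩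
      have hx : L < ψ t x := hx
      have hyL : ψ t y < L := hyL
      have h1 := hψ.lt_of_lt hL hx (le_max_left x y)
      have h2 := hψ.lt_of_ne_zero hL (hne hy) hyL (le_max_right x y)
      exact lt_asymm h1 h2
    · obtain ⟨x, hx⟩ := hesc t ht
      rcases lt_trichotomy (ψ t x) L with h1 | h1 | h1
      · exact Or.inr (Set.mem_iUnion.2 ⟨x, hx, h1⟩)
      · exact absurd ((hψ.cos_eq_zero_iff t x).1 (by rw [h1, hL])) (hne hx x le_rfl)
      · exact Or.inl (Set.mem_iUnion.2 ⟨x, h1⟩)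
    · obtain ⟨t, ht, x, hx⟩ := hψ.exists_large_angle hV hh hM hMB hp hs hspir hz X L
      exact ⟨t, ht, Set.mem_iUnion.2 ⟨x, hx⟩⟩
  obtain ⟨t, ht⟩ := exists_lt X
  obtain ⟨x, hx⟩ := hesc t ht
  obtain ⟨n, hn⟩ := exists_nat_gt (ψ t x / π)
  rw [div_lt_iff₀ pi_pos] at hn
  have hL : cos (n * π + π / 2) = 0 := by
    rw [cos_add_pi_div_two, sin_nat_mul_pi, neg_zero]
  obtain ⟨y, hy⟩ := Set.mem_iUnion.1 (hall _ hL ht)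
  have hy : (n * π + π / 2) < ψ t y := hy
  have h1 := hψ.lt_of_lt hL hy (le_max_left y x)
  have h2 := hψ.lt_of_ne_zero hL (hne hx) (by linarith [pi_pos]) (le_max_right y x)
  exact lt_asymm h1 h2

end AngleFamily

theorem UnstableFamily.injective (hV : ShapePotential V dV (-p) p c B) (hh : 0 < h) (hM : 0 < M)
    (hMB : B ≤ c * M ^ 2) (hp : CentralPeak V dV p) (hz : UnstableFamily h V dV M p q z)
    {t r : ℝ} (htr : (fun x => (z t x).1) = fun x => (z r x).1) : t = r := by
  have key : ∀ {t r}, ((fun x => (z t x).1) = fun x => (z r x).1) → ¬ t < r := fun {t r} he hlt => by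
    have h1 : (z r t).1 = q := by rw [← congrFun he t, hz.fst_self]
    obtain ⟨y, hy, hy'⟩ := exists_hasDerivAt_eq_slope (fun x => (z r x).1) (fun x => (z r x).2) hlt
      (hz.orbit r).continuous.fst.continuousOn
      fun y _ => (hz.orbit r).fst (hz.abs_velocity_le' hV hh hM hMB hp r y)
    rw [h1, hz.fst_self, sub_self, zero_div] at hy'
    exact (hz.unstable r y hy.2.le).1.ne' hy'
  exact le_antisymm (not_lt.1 (key htr.symm)) (not_lt.1 (key htr))

/-- Infinitely many orbits connect the saddle `-p` to the peak `0`. -/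
theorem CentralPeak.exists_infinite_connections (hV : ShapePotential V dV (-p) p c B)
    (hh : 0 < h) (hM : 0 < M) (hMB : B ≤ c * M ^ 2) (hp : CentralPeak V dV p)
    (hs : SaddleData V dV (-p) p (-p) q) (hm : MonotoneForce V dV (-p) q) (hq : q < 0)
    (hspir : IsSpiralling h V dV) :
    ∃ y : ℕ → ℝ → ℝ × ℝ, (∀ i, IsClampedOrbit h V dV M (y i) ∧ (∀ x, (y i x).1 ∈ Set.Icc (-p) p) ∧
      (∀ x, |(y i x).2| ≤ M) ∧ Tendsto (y i) atBot (𝓝 (-p, 0)) ∧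
      Tendsto (y i) atTop (𝓝 (0, 0))) ∧
      ∀ i j, i ≠ j → (fun x => (y i x).1) ≠ fun x => (y j x).1 := by
  obtain ⟨φ, hφ⟩ := hV.exists_isClampedFlow hh hM.le
  obtain ⟨Y, hYc, hY⟩ := hs.exists_unstable_family hV hh hM hMB hm hφ
  have hz : UnstableFamily h V dV M p q fun t => φ t (q, Y t) :=
    ⟨fun t => hφ.orbit _ _, hφ.continuous.comp
      (by fun_prop : Continuous fun a : ℝ × ℝ => (a.1, (q, Y a.1), a.2)),
      fun t => by simp [hφ.init], hY⟩
  obtain ⟨ψ, hψ⟩ := hz.exists_angleFamily hV hh hM hMB hp hq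
  have hinf : {t | Tendsto (φ t (q, Y t)) atTop (𝓝 (0, 0))}.Infinite :=
    Set.infinite_of_not_bddBelow fun ⟨b, hb⟩ => by
      obtain ⟨t, ht, hlim⟩ := hψ.exists_tendsto hV hh hM hMB hp hs hspir hz b
      exact absurd (hb hlim) (not_le.2 ht)
  let e := hinf.natEmbedding
  refine ⟨fun i => φ (e i) (q, Y (e i)), fun i => ⟨hφ.orbit _ _, fun x => ?_,
    hz.abs_velocity_le' hV hh hM hMB hp _, ?_, (e i).2⟩, fun i j hij he => hij ?_⟩
  · exact Set.Ioo_subset_Icc_self (hz.mem hV hh hM hMB hp _ x)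
  · refine hs.tendsto_atBot (t := e i) hV hh hM.le hMB (hφ.orbit _ _)
      (fun x hx => ⟨(hY _ x hx).1.le, (hY _ x hx).2.le⟩) fun x hx => ?_
    exact Set.Ioc_subset_Icc_self
      ((hY _).mem hh hV hM.le hs (hφ.orbit _ _) (by simp [hφ.init]) hx)
  · exact e.injective (Subtype.ext (hz.injective hV hh hM hMB hp he))

end Spiral

section Potential

/-- The shape potential as a function of `X = cos θ`. -/
noncomputable def cosPot (m X : ℝ) : ℝ := 1 / (√2 * X) + 2 * m / √(1 / 2 + (1 - X ^ 2) / m)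

/-- The derivative of `cosPot`. -/
noncomputable def cosPotDeriv (m X : ℝ) : ℝ :=
  -1 / (√2 * X ^ 2) +
    2 * X / ((1 / 2 + (1 - X ^ 2) / m) * √(1 / 2 + (1 - X ^ 2) / m))

/-- The shape potential as a function of the angle `θ` with `cos θ = cos u ^ 2`. -/
noncomputable def shapePot (m θ : ℝ) : ℝ := cosPot m (cos θ)

/-- The derivative of `shapePot`. -/
noncomputable def shapePotDeriv (m θ : ℝ) : ℝ := -sin θ * cosPotDeriv m (cos θ)

/-- The regularized shape variable `u` as a function of `θ`. -/
noncomputable def regShape (θ : ℝ) : ℝ := arcsin (√2 * sin (θ / 2))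

variable {m θ X : ℝ}

theorem half_add_pos (hm : 0 < m) (h1 : X ^ 2 ≤ 1) : 0 < 1 / 2 + (1 - X ^ 2) / m := by
  have : 0 ≤ (1 - X ^ 2) / m := div_nonneg (by linarith) hm.le
  linarith

theorem hasDerivAt_cosPot (hm : 0 < m) (h0 : 0 < X) (h1 : X ≤ 1) :
    HasDerivAt (cosPot m) (cosPotDeriv m X) X := by
  have hD := half_add_pos hm (by nlinarith : X ^ 2 ≤ 1)
  have hs := Real.sqrt_pos.2 hD
  have d1 : HasDerivAt (fun X : ℝ => 1 / 2 + (1 - X ^ 2) / m) (-(2 * X) / m) X := by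
    have := (((hasDerivAt_pow 2 X).const_sub 1).div_const m).const_add (1 / 2)
    exact this.congr_deriv (by norm_num)
  have d2 : HasDerivAt (fun X : ℝ => 1 / (√2 * X)) _ X :=
    (hasDerivAt_const X (1 : ℝ)).div ((hasDerivAt_id X).const_mul (√2)) (by positivity)
  have d3 := (hasDerivAt_const X (2 * m)).div (d1.sqrt hD.ne') hs.ne'
  refine (d2.add d3).congr_deriv ?_
  rw [cosPotDeriv]
  have e2 : (√(1 / 2 + (1 - X ^ 2) / m)) ^ 2 = 1 / 2 + (1 - X ^ 2) / m := Real.sq_sqrt hD.le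
  set r := √(1 / 2 + (1 - X ^ 2) / m)
  rw [← e2]
  have h2 : (√2) ^ 2 = 2 := Real.sq_sqrt two_pos.le
  field_simp
  ring

theorem cosPot_pos (hm : 0 < m) (h0 : 0 < X) (h1 : X ≤ 1) : 0 < cosPot m X := by
  have := Real.sqrt_pos.2 (half_add_pos hm (by nlinarith : X ^ 2 ≤ 1))
  rw [cosPot]
  positivity

theorem cos_pos_of_abs_lt (hθ : |θ| < π / 2) : 0 < cos θ :=
  cos_pos_of_mem_Ioo (abs_lt.1 hθ)

theorem hasDerivAt_shapePot (hm : 0 < m) (hθ : |θ| < π / 2) :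
    HasDerivAt (shapePot m) (shapePotDeriv m θ) θ :=
  ((hasDerivAt_cosPot hm (cos_pos_of_abs_lt hθ) (cos_le_one θ)).comp θ
    (hasDerivAt_cos θ)).congr_deriv (by rw [shapePotDeriv]; ring)

theorem shapePot_pos (hm : 0 < m) (hθ : |θ| < π / 2) : 0 < shapePot m θ :=
  cosPot_pos hm (cos_pos_of_abs_lt hθ) (cos_le_one θ)

theorem shapePot_neg : shapePot m (-θ) = shapePot m θ := by rw [shapePot, cos_neg, shapePot]

theorem shapePotDeriv_neg : shapePotDeriv m (-θ) = -shapePotDeriv m θ := by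
  rw [shapePotDeriv, cos_neg, sin_neg, shapePotDeriv]
  ring

theorem Wpot_eq (hm : 0 < m) {u : ℝ} (hu : 0 < cos u) :
    Wpot m u = cos u ^ 2 * cosPot m (cos u ^ 2) := by
  have hX : (cos u ^ 2) ^ 2 ≤ 1 := pow_le_one₀ (sq_nonneg _) (cos_sq_le_one u)
  have e : cos u ^ 4 / 2 + (1 - cos u ^ 4) / (2 * m / (2 + m)) =
      1 / 2 + (1 - (cos u ^ 2) ^ 2) / m := by
    field_simp
    ring
  have := Real.sqrt_pos.2 (half_add_pos hm hX)
  rw [Wpot, e, cosPot]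
  field_simp

theorem hasDerivAt_Wpot (hm : 0 < m) {u : ℝ} (hu : 0 < cos u) :
    HasDerivAt (Wpot m) (-(2 * cos u * sin u) *
      (cosPot m (cos u ^ 2) + cos u ^ 2 * cosPotDeriv m (cos u ^ 2))) u := by
  have hev : Wpot m =ᶠ[𝓝 u] fun u => cos u ^ 2 * cosPot m (cos u ^ 2) := by
    filter_upwards [continuous_cos.continuousAt.eventually (lt_mem_nhds hu)] with y hy
    exact Wpot_eq hm hy
  have h1 := (hasDerivAt_cos u).pow 2
  have h2 := (hasDerivAt_cosPot hm (pow_pos hu 2) (cos_sq_le_one u)).comp u h1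
  refine ((h1.mul h2).congr_of_eventuallyEq hev).congr_deriv ?_
  simp only [Function.comp_apply, Pi.pow_apply]
  ring

theorem two_mul_sin_half_sq : (√2 * sin (θ / 2)) ^ 2 = 1 - cos θ := by
  have h1 : cos θ = 1 - 2 * sin (θ / 2) ^ 2 := by
    nth_rw 1 [show θ = 2 * (θ / 2) by ring]
    rw [cos_two_mul, cos_sq']
    ring
  rw [mul_pow, Real.sq_sqrt two_pos.le, h1]
  ring

theorem cos_regShape : cos (regShape θ) = √(cos θ) := by
  rw [regShape, cos_arcsin, two_mul_sin_half_sq]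
  ring_nf

theorem cos_regShape_sq (hθ : |θ| < π / 2) : cos (regShape θ) ^ 2 = cos θ := by
  rw [cos_regShape, Real.sq_sqrt (cos_pos_of_abs_lt hθ).le]

theorem cos_regShape_pos (hθ : |θ| < π / 2) : 0 < cos (regShape θ) := by
  rw [cos_regShape]
  exact Real.sqrt_pos.2 (cos_pos_of_abs_lt hθ)

theorem sin_half_lt (hθ : |θ| < π / 2) : |√2 * sin (θ / 2)| < 1 := by
  rw [← sq_lt_one_iff_abs_lt_one, two_mul_sin_half_sq]
  linarith [cos_pos_of_abs_lt hθ]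

theorem sin_regShape (hθ : |θ| < π / 2) : sin (regShape θ) = √2 * sin (θ / 2) := by
  obtain ⟨h1, h2⟩ := abs_lt.1 (sin_half_lt hθ)
  exact sin_arcsin h1.le h2.le

theorem sqrt_one_add_cos_regShape_sq (hθ : |θ| < π / 2) :
    √(1 + cos (regShape θ) ^ 2) = √2 * cos (θ / 2) := by
  obtain ⟨h1, h2⟩ := abs_lt.1 hθ
  have h3 : 0 ≤ cos (θ / 2) := (cos_pos_of_mem_Ioo ⟨by linarith, by linarith⟩).le
  have h4 : 1 + cos θ = (√2 * cos (θ / 2)) ^ 2 := by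
    rw [mul_pow, Real.sq_sqrt two_pos.le]
    nth_rw 1 [show θ = 2 * (θ / 2) by ring]
    rw [cos_two_mul]
    ring
  rw [cos_regShape_sq hθ, h4, Real.sqrt_sq (by positivity)]

theorem sin_eq_regShape (hθ : |θ| < π / 2) :
    sin θ = sin (regShape θ) * √(1 + cos (regShape θ) ^ 2) := by
  rw [sin_regShape hθ, sqrt_one_add_cos_regShape_sq hθ]
  nth_rw 1 [show θ = 2 * (θ / 2) by ring]
  rw [sin_two_mul]
  have h2 : (√2) ^ 2 = 2 := Real.sq_sqrt two_pos.le
  linear_combination (-sin (θ / 2) * cos (θ / 2)) * h2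

theorem hasDerivAt_regShape (hθ : |θ| < π / 2) :
    HasDerivAt regShape (√(1 + cos (regShape θ) ^ 2) / (2 * cos (regShape θ))) θ := by
  obtain ⟨h1, h2⟩ := abs_lt.1 (sin_half_lt hθ)
  have h3 := ((hasDerivAt_id θ).div_const 2).sin.const_mul (√2)
  refine ((hasDerivAt_arcsin h1.ne' h2.ne).comp θ h3).congr_deriv ?_
  rw [sqrt_one_add_cos_regShape_sq hθ, regShape, cos_arcsin]
  have := Real.sqrt_pos.2 (sub_pos.2 ((sq_lt_one_iff_abs_lt_one _).2 (sin_half_lt hθ)))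
  simp only [id]
  field_simp

theorem regShape_neg : regShape (-θ) = -regShape θ := by
  rw [regShape, neg_div, sin_neg, mul_neg, arcsin_neg, regShape]

theorem continuous_regShape : Continuous regShape := by
  unfold regShape
  fun_prop

end Potential

section TimeChange

/-- Solutions of a scalar autonomous equation with bounded positive right-hand side. -/
theorem exists_time_change {ψ : ℝ → ℝ} {K : ℝ} (hψ : Continuous ψ) (hpos : ∀ x, 0 < ψ x)
    (hK : ∀ x, ψ x ≤ K) : ∃ X : ℝ ≃o ℝ, ∀ τ, HasDerivAt X (ψ (X τ)) τ := by
  have hK0 : 0 < K := (hpos 0).trans_le (hK 0)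
  have hinv : Continuous fun x => (ψ x)⁻¹ := hψ.inv₀ fun x => (hpos x).ne'
  set T : ℝ → ℝ := fun x => ∫ r in (0 : ℝ)..x, (ψ r)⁻¹
  have hT : ∀ x, HasDerivAt T (ψ x)⁻¹ x := fun x =>
    intervalIntegral.integral_hasDerivAt_right (hinv.intervalIntegrable 0 x)
      (hinv.stronglyMeasurableAtFilter _ _) hinv.continuousAt
  have hmono : StrictMono T := strictMono_of_hasDerivAt_pos hT fun x => inv_pos.2 (hpos x)
  have hgrow : ∀ a b, a ≤ b → K⁻¹ * (b - a) ≤ T b - T a := fun a b hab =>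
    mul_sub_le_of_hasDerivAt hab (fun x _ => hT x) fun x _ => inv_anti₀ (hpos x) (hK x)
  have hlin : Tendsto (fun x : ℝ => K⁻¹ * (x - 0)) atTop atTop := by
    simpa using tendsto_id.const_mul_atTop (inv_pos.2 hK0)
  have hlin' : Tendsto (fun x : ℝ => K⁻¹ * (x - 0)) atBot atBot := by
    simpa using tendsto_id.const_mul_atBot (inv_pos.2 hK0)
  have hT0 : T 0 = 0 := intervalIntegral.integral_same
  have hsurj : Function.Surjective T := Continuous.surjective
    (continuous_iff_continuousAt.2 fun x => (hT x).continuousAt)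
    (tendsto_atTop_mono' _ (by
      filter_upwards [eventually_ge_atTop 0] with x hx
      simpa [hT0] using hgrow 0 x hx) hlin)
    (tendsto_atBot_mono' _ (by
      filter_upwards [eventually_le_atBot 0] with x hx
      have := hgrow x 0 hx
      linarith) hlin')
  let e := hmono.orderIsoOfSurjective T hsurj
  refine ⟨e.symm, fun τ => ?_⟩
  have := (hT (e.symm τ)).of_local_left_inverse (e.symm.continuous.continuousAt)
    (inv_pos.2 (hpos _)).ne' (Eventually.of_forall fun y => e.apply_symm_apply y)
  simpa using this

end TimeChange

section Conversion

theorem exists_bound_of_tendsto {f : ℝ → ℝ} {l l' : ℝ} (hf : Continuous f)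
    (hbot : Tendsto f atBot (𝓝 l)) (htop : Tendsto f atTop (𝓝 l')) : ∃ K, ∀ x, f x ≤ K := by
  obtain ⟨a, ha⟩ := eventually_atBot.1 (hbot.eventually (gt_mem_nhds (lt_add_one l)))
  obtain ⟨b, hb⟩ := eventually_atTop.1 (htop.eventually (gt_mem_nhds (lt_add_one l')))
  obtain ⟨K, hK⟩ := (isCompact_Icc (a := a) (b := b)).bddAbove_image hf.continuousOn
  refine ⟨max (l + 1) (max (l' + 1) K), fun x => ?_⟩
  rcases le_total x a with h1 | h1
  · exact le_max_of_le_left (ha x h1).le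
  rcases le_total b x with h2 | h2
  · exact le_max_of_le_right (le_max_of_le_left (hb x h2).le)
  · exact le_max_of_le_right (le_max_of_le_right (hK ⟨x, ⟨h1, h2⟩, rfl⟩))

/-- An orbit of the reduced shape system that connects two equilibria. -/
structure ShapeConnection (m h a b : ℝ) (z : ℝ → ℝ × ℝ) : Prop where
  fst : ∀ x, HasDerivAt (fun x => (z x).1) (z x).2 x
  snd : ∀ x, HasDerivAt (fun x => (z x).2)
    (shapeAcc h (shapePot m) (shapePotDeriv m) x (z x).1 (z x).2) x
  bound : ∃ r < π / 2, ∀ x, |(z x).1| ≤ r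
  atBot : Tendsto z atBot (𝓝 (a, 0))
  atTop : Tendsto z atTop (𝓝 (b, 0))

variable {m h a b : ℝ} {z : ℝ → ℝ × ℝ}

namespace ShapeConnection

theorem neg (hz : ShapeConnection m h a b z) : ShapeConnection m h (-a) (-b) fun x => -z x where
  fst x := (hz.fst x).neg
  snd x := (hz.snd x).neg.congr_deriv (by
    simp only [Prod.fst_neg, Prod.snd_neg, shapeAcc, shapePot_neg,
      shapePotDeriv_neg]
    ring)
  bound := by simpa using hz.bound
  atBot := by simpa using hz.atBot.neg
  atTop := by simpa using hz.atTop.neg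

theorem continuous (hz : ShapeConnection m h a b z) : Continuous z :=
  (continuous_iff_continuousAt.2 fun x => (hz.fst x).continuousAt).prodMk
    (continuous_iff_continuousAt.2 fun x => (hz.snd x).continuousAt)

theorem abs_lt (hz : ShapeConnection m h a b z) (x : ℝ) : |(z x).1| < π / 2 := by
  obtain ⟨r, hr, H⟩ := hz.bound
  exact (H x).trans_lt hr

theorem abs_left_lt (hz : ShapeConnection m h a b z) : |a| < π / 2 := by
  obtain ⟨r, hr, H⟩ := hz.bound
  exact (le_of_tendsto' hz.atBot.fst_nhds.abs H).trans_lt hr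

theorem abs_right_lt (hz : ShapeConnection m h a b z) : |b| < π / 2 := by
  obtain ⟨r, hr, H⟩ := hz.bound
  exact (le_of_tendsto' hz.atTop.fst_nhds.abs H).trans_lt hr

end ShapeConnection

/-- Half of the square of the regularized radial velocity `v`. -/
noncomputable def radialSq (m h x θ g : ℝ) : ℝ :=
  (shapePot m θ * (1 - sigmoid x) + h * sigmoid x) / (1 + g ^ 2)

theorem radialSq_pos (hm : 0 < m) (hh : 0 < h) {x θ g : ℝ} (hθ : |θ| < π / 2) :
    0 < radialSq m h x θ g := by
  have := shapePot_pos hm hθ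
  have := sigmoid_pos x
  have := sub_pos.2 (sigmoid_lt_one x)
  rw [radialSq]
  positivity

theorem exp_eq_sigmoid_div (x : ℝ) : exp x = sigmoid x / (1 - sigmoid x) := by
  have h1 := exp_pos x
  rw [sigmoid_def, exp_neg]
  field_simp
  ring

namespace ShapeConnection

theorem hasDerivAt_radialSq (hm : 0 < m) (hh : 0 < h) (hz : ShapeConnection m h a b z) (x : ℝ) :
    HasDerivAt (fun x => radialSq m h x (z x).1 (z x).2)
      ((1 - sigmoid x) * radialSq m h x (z x).1 (z x).2 +
        2 * (z x).2 ^ 2 * radialSq m h x (z x).1 (z x).2 - (1 - sigmoid x) * shapePot m (z x).1)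
      x := by
  have h1 := (hasDerivAt_shapePot hm (hz.abs_lt x)).comp x (hz.fst x)
  have h2 := hasDerivAt_sigmoid x
  have h3 := ((h1.mul (h2.const_sub 1)).add (h2.const_mul h)).div
    (((hz.snd x).pow 2).const_add 1) (by positivity : 1 + (z x).2 ^ 2 ≠ 0)
  refine h3.congr_deriv ?_
  have hV := shapePot_pos hm (hz.abs_lt x)
  have hs := sigmoid_pos x
  have hs1 := sub_pos.2 (sigmoid_lt_one x)
  have hD : 0 < shapePot m (z x).1 * (1 - sigmoid x) + h * sigmoid x := by positivity
  have hE : shapePot m (z x).1 + h * (sigmoid x / (1 - sigmoid x)) =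
      (shapePot m (z x).1 * (1 - sigmoid x) + h * sigmoid x) / (1 - sigmoid x) := by
    field_simp
  simp only [radialSq, shapeAcc, exp_eq_sigmoid_div, hE, Pi.add_apply, Pi.mul_apply, Pi.pow_apply,
    Function.comp_apply]
  set S := sigmoid x
  have := hD.ne'
  have := hs1.ne'
  field_simp
  ring

theorem continuous_radialSq (hm : 0 < m) (hh : 0 < h) (hz : ShapeConnection m h a b z) :
    Continuous fun x => radialSq m h x (z x).1 (z x).2 :=
  continuous_iff_continuousAt.2 fun x => (hz.hasDerivAt_radialSq hm hh x).continuousAt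

theorem tendsto_radialSq (hm : 0 < m) {l : Filter ℝ} {d s : ℝ} (hd : |d| < π / 2)
    (hl : Tendsto z l (𝓝 (d, 0))) (hs : Tendsto sigmoid l (𝓝 s)) :
    Tendsto (fun x => radialSq m h x (z x).1 (z x).2) l
      (𝓝 (shapePot m d * (1 - s) + h * s)) := by
  have h1 := ((hasDerivAt_shapePot hm hd).continuousAt.tendsto.comp hl.fst_nhds).mul
    (hs.const_sub 1)
  have h2 := (h1.add (hs.const_mul h)).div ((hl.snd_nhds.pow 2).const_add 1) (by norm_num)
  refine (h2.congr fun x => rfl).mono_right (le_of_eq ?_)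
  norm_num

/-- A connection of the reduced system yields a solution of the regularized system. -/
theorem exists_solution (hm : 0 < m) (hh : 0 < h) (hz : ShapeConnection m h a b z) :
    ∃ s v u w : ℝ → ℝ, ∃ X : ℝ ≃o ℝ, IsSolution m h s v u w ∧ SatisfiesEnergy m h s v u w ∧
      Tendsto (fun τ => (s τ, v τ, u τ, w τ)) Filter.atBot
        (𝓝 (0, √(2 * shapePot m a), regShape a, 0)) ∧
      Tendsto (fun τ => (s τ, v τ, u τ, w τ)) Filter.atTop (𝓝 (1, √(2 * h), regShape b, 0)) ∧
      (∀ τ, s τ = sigmoid (X τ)) ∧ ∀ τ, u τ = regShape (z (X τ)).1 := by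
  set R : ℝ → ℝ := fun x => radialSq m h x (z x).1 (z x).2 with hR
  set v : ℝ → ℝ := fun x => √(2 * R x) with hv
  set C : ℝ → ℝ := fun x => cos (regShape (z x).1) with hC
  have hRpos : ∀ x, 0 < R x := fun x => radialSq_pos hm hh (hz.abs_lt x)
  have hvpos : ∀ x, 0 < v x := fun x => Real.sqrt_pos.2 (by linarith [hRpos x])
  have hCpos : ∀ x, 0 < C x := fun x => cos_regShape_pos (hz.abs_lt x)
  have hCsq : ∀ x, C x ^ 2 = cos (z x).1 := fun x => cos_regShape_sq (hz.abs_lt x)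
  have hvc : Continuous v := ((hz.continuous_radialSq hm hh).const_mul 2).sqrt
  have hCc : Continuous C := continuous_cos.comp (continuous_regShape.comp hz.continuous.fst)
  have hVlim : ∀ {l s d}, |d| < π / 2 → Tendsto z l (𝓝 (d, 0)) → Tendsto sigmoid l (𝓝 s) →
      Tendsto v l (𝓝 √(2 * (shapePot m d * (1 - s) + h * s))) := fun hd hl hs =>
    ((tendsto_radialSq hm hd hl hs).const_mul 2).sqrt
  have hCle : ∀ x, C x ^ 2 ≤ 1 := fun x => cos_sq_le_one _
  have hlimBot := hVlim hz.abs_left_lt hz.atBot tendsto_sigmoid_atBot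
  have hlimTop := hVlim hz.abs_right_lt hz.atTop tendsto_sigmoid_atTop
  obtain ⟨K, hK⟩ : ∃ K, ∀ x, v x ≤ K :=
    exists_bound_of_tendsto hvc hlimBot hlimTop
  obtain ⟨X, hX⟩ := exists_time_change (hvc.mul (hCc.pow 2))
    (fun x => mul_pos (hvpos x) (pow_pos (hCpos x) 2))
    (fun x => (mul_le_of_le_one_right (hvpos x).le (hCle x)).trans (hK x))
  have dv : ∀ x, HasDerivAt v ((((1 - sigmoid x) * R x + 2 * (z x).2 ^ 2 * R x -
      (1 - sigmoid x) * shapePot m (z x).1)) / v x) x := fun x => by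
    have := ((hz.hasDerivAt_radialSq hm hh x).const_mul 2).sqrt (by linarith [hRpos x])
    refine this.congr_deriv ?_
    exact mul_div_mul_left _ _ two_ne_zero
  have du : ∀ x, HasDerivAt (fun x => regShape (z x).1)
      (√(1 + C x ^ 2) / (2 * C x) * (z x).2) x := fun x =>
    HasDerivAt.comp (h₂ := regShape) x (hasDerivAt_regShape (hz.abs_lt x)) (hz.fst x)
  have dw := fun x => ((du x).cos.mul (hz.snd x)).mul (dv x)
  have hW : ∀ x, Wpot m (regShape (z x).1) = C x ^ 2 * shapePot m (z x).1 := fun x => by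
    rw [Wpot_eq hm (hCpos x), shapePot, ← hCsq]
  have hlim : ∀ {l s d}, |d| < π / 2 → Tendsto z l (𝓝 (d, 0)) → Tendsto sigmoid l (𝓝 s) →
      Tendsto (fun x => (sigmoid x, v x, regShape (z x).1, C x * (z x).2 * v x)) l
        (𝓝 (s, √(2 * (shapePot m d * (1 - s) + h * s)), regShape d, 0)) := fun hd hl hs => by
    have h1 := (continuous_regShape.tendsto _).comp hl.fst_nhds
    have h2 := (((continuous_cos.tendsto _).comp h1).mul hl.snd_nhds).mul (hVlim hd hl hs)
    rw [mul_zero, zero_mul] at h2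
    exact hs.prodMk_nhds ((hVlim hd hl hs).prodMk_nhds (h1.prodMk_nhds h2))
  refine ⟨fun τ => sigmoid (X τ), fun τ => v (X τ), fun τ => regShape (z (X τ)).1,
    fun τ => C (X τ) * (z (X τ)).2 * v (X τ), X, ⟨fun τ => ?_, fun τ => ?_, fun τ => ?_,
    fun τ => ?_⟩, fun τ => ?_, ?_, ?_, fun τ => rfl, fun τ => rfl⟩
  · refine ((hasDerivAt_sigmoid _).comp τ (hX τ)).congr_deriv ?_
    simp only [hC, Pi.mul_apply, Pi.pow_apply]
    ring
  · refine ((dv _).comp τ (hX τ)).congr_deriv ?_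
    have h1 := (hvpos (X τ)).ne'
    have h2 : v (X τ) ^ 2 = 2 * R (X τ) := Real.sq_sqrt (by linarith [hRpos (X τ)])
    rw [hW]
    change _ = 1 / 2 * (1 - sigmoid (X τ)) * v (X τ) ^ 2 * C (X τ) ^ 2 +
      (C (X τ) * (z (X τ)).2 * v (X τ)) ^ 2 - _
    rw [mul_pow, h2]
    simp only [Pi.mul_apply, Pi.pow_apply]
    field_simp
  · refine ((du _).comp τ (hX τ)).congr_deriv ?_
    have h1 := (hCpos (X τ)).ne'
    change _ = 1 / 2 * √(1 + C (X τ) ^ 2) * (C (X τ) * (z (X τ)).2 * v (X τ))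
    simp only [Pi.mul_apply, Pi.pow_apply]
    field_simp
  · refine ((dw _).comp τ (hX τ)).congr_deriv ?_
    have h1 := (hvpos (X τ)).ne'
    have h2 : v (X τ) ^ 2 = 2 * R (X τ) := Real.sq_sqrt (by linarith [hRpos (X τ)])
    have h3 := (hCpos (X τ)).ne'
    have hV := shapePot_pos hm (hz.abs_lt (X τ))
    have hs := sigmoid_pos (X τ)
    have hs1 := sub_pos.2 (sigmoid_lt_one (X τ))
    have hD : 0 < shapePot m (z (X τ)).1 * (1 - sigmoid (X τ)) + h * sigmoid (X τ) := by positivity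
    have hE : shapePot m (z (X τ)).1 + h * (sigmoid (X τ) / (1 - sigmoid (X τ))) =
        (shapePot m (z (X τ)).1 * (1 - sigmoid (X τ)) + h * sigmoid (X τ)) /
          (1 - sigmoid (X τ)) := by
      field_simp
    have hdV : shapePotDeriv m (z (X τ)).1 = -(sin (regShape (z (X τ)).1) *
        √(1 + C (X τ) ^ 2)) * cosPotDeriv m (C (X τ) ^ 2) := by
      rw [shapePotDeriv, hCsq, sin_eq_regShape (hz.abs_lt _), ← hCsq]
    have hVC : cosPot m (C (X τ) ^ 2) = shapePot m (z (X τ)).1 := by rw [hCsq, shapePot]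
    rw [(hasDerivAt_Wpot hm (hCpos (X τ))).deriv]
    change _ = -(1 / 2) * (1 + sigmoid (X τ)) * v (X τ) * (C (X τ) * (z (X τ)).2 * v (X τ)) *
      C (X τ) ^ 2 + 1 / 2 * √(1 + C (X τ) ^ 2) * (1 - sigmoid (X τ)) *
        (-(2 * C (X τ) * sin (regShape (z (X τ)).1)) *
          (cosPot m (C (X τ) ^ 2) + C (X τ) ^ 2 * cosPotDeriv m (C (X τ) ^ 2))) +
      1 / 2 * (v (X τ) ^ 2 - 2 * h * sigmoid (X τ)) * √(1 + C (X τ) ^ 2) *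
        sin (regShape (z (X τ)).1) * C (X τ)
    rw [hVC]
    have hR' : R (X τ) * (1 + (z (X τ)).2 ^ 2) =
        shapePot m (z (X τ)).1 * (1 - sigmoid (X τ)) + h * sigmoid (X τ) :=
      div_mul_cancel₀ _ (by positivity)
    simp only [Pi.mul_apply, Pi.pow_apply, shapeAcc, exp_eq_sigmoid_div, hE, hdV]
    rw [show cos (regShape (z (X τ)).1) = C (X τ) from rfl]
    have h4 : 0 < R (X τ) := hRpos _
    have hg : (0 : ℝ) < 1 + (z (X τ)).2 ^ 2 := by positivity
    have hg1 := hg.ne'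
    have h5 := h4.ne'
    have hs2 := hs1.ne'
    rw [← hR']
    generalize R (X τ) = R at *
    generalize v (X τ) = v at *
    generalize C (X τ) = C at *
    generalize sigmoid (X τ) = S at *
    generalize (z (X τ)).2 = g at *
    generalize shapePot m (z (X τ)).1 = V at *
    generalize sin (regShape (z (X τ)).1) = sn at *
    generalize √(1 + C ^ 2) = r at *
    generalize cosPotDeriv m (C ^ 2) = P at *
    field_simp
    linear_combination (-(sn * r * g ^ 2 * R) + C ^ 2 * (-(sn * r * P * (1 - S)) -
      g * ((1 + g ^ 2) * R + S * h)) - R * (-(C ^ 2 * g * (1 + S)) + sn * r)) * h2 +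
      2 * R * (C ^ 2 * g - sn * r) * hR'
  · have h2 : v (X τ) ^ 2 = 2 * R (X τ) := Real.sq_sqrt (by linarith [hRpos (X τ)])
    have h3 : R (X τ) * (1 + (z (X τ)).2 ^ 2) =
        shapePot m (z (X τ)).1 * (1 - sigmoid (X τ)) + h * sigmoid (X τ) :=
      div_mul_cancel₀ _ (by positivity)
    change 1 / 2 * (v (X τ) ^ 2 * C (X τ) ^ 2 + (C (X τ) * (z (X τ)).2 * v (X τ)) ^ 2) -
      (1 - sigmoid (X τ)) * Wpot m (regShape (z (X τ)).1) - h * sigmoid (X τ) * C (X τ) ^ 2 = 0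
    rw [hW]
    linear_combination (1 / 2 * C (X τ) ^ 2 * (1 + (z (X τ)).2 ^ 2)) * h2 + C (X τ) ^ 2 * h3
  · have e : √(2 * (shapePot m a * (1 - 0) + h * 0)) = √(2 * shapePot m a) := by ring_nf
    rw [← e]
    exact (hlim hz.abs_left_lt hz.atBot tendsto_sigmoid_atBot).comp X.tendsto_atBot
  · have e : √(2 * (shapePot m b * (1 - 1) + h * 1)) = √(2 * h) := by ring_nf
    rw [← e]
    exact (hlim hz.abs_right_lt hz.atTop tendsto_sigmoid_atTop).comp X.tendsto_atTop

end ShapeConnection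

end Conversion

section Landscape

variable {m θ X : ℝ}

/-- The second derivative of `cosPot`. -/
noncomputable def cosPotDeriv2 (m X : ℝ) : ℝ :=
  2 / (√2 * X ^ 3) + 2 / ((1 / 2 + (1 - X ^ 2) / m) * √(1 / 2 + (1 - X ^ 2) / m)) +
    6 * X ^ 2 / (m * (1 / 2 + (1 - X ^ 2) / m) ^ 2 * √(1 / 2 + (1 - X ^ 2) / m))

theorem hasDerivAt_cosPotDeriv (hm : 0 < m) (h0 : 0 < X) (h1 : X ≤ 1) :
    HasDerivAt (cosPotDeriv m) (cosPotDeriv2 m X) X := by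
  have hD := half_add_pos hm (by nlinarith : X ^ 2 ≤ 1)
  have hs := Real.sqrt_pos.2 hD
  have d1 : HasDerivAt (fun X : ℝ => 1 / 2 + (1 - X ^ 2) / m) (-(2 * X) / m) X := by
    have := (((hasDerivAt_pow 2 X).const_sub 1).div_const m).const_add (1 / 2)
    exact this.congr_deriv (by norm_num)
  have d2 : HasDerivAt (fun X : ℝ => -1 / (√2 * X ^ 2)) _ X :=
    (hasDerivAt_const X (-1 : ℝ)).div ((hasDerivAt_pow 2 X).const_mul (√2)) (by positivity)
  have d3 := ((hasDerivAt_id X).const_mul 2).div (d1.mul (d1.sqrt hD.ne')) (mul_pos hD hs).ne'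
  refine (d2.add d3).congr_deriv ?_
  rw [cosPotDeriv2]
  simp only [Pi.mul_apply, id]
  have e2 : (√(1 / 2 + (1 - X ^ 2) / m)) ^ 2 = 1 / 2 + (1 - X ^ 2) / m := Real.sq_sqrt hD.le
  set r := √(1 / 2 + (1 - X ^ 2) / m)
  rw [← e2]
  have h2 : (√2) ^ 2 = 2 := Real.sq_sqrt two_pos.le
  field_simp
  ring

theorem cosPotDeriv2_pos (hm : 0 < m) (h0 : 0 < X) (h1 : X ≤ 1) : 0 < cosPotDeriv2 m X := by
  have hD := half_add_pos hm (by nlinarith : X ^ 2 ≤ 1)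
  have hs := Real.sqrt_pos.2 hD
  rw [cosPotDeriv2]
  positivity

theorem strictMonoOn_cosPotDeriv (hm : 0 < m) :
    StrictMonoOn (cosPotDeriv m) (Set.Ioc 0 1) := by
  refine strictMonoOn_of_hasDerivWithinAt_pos (f' := cosPotDeriv2 m) (convex_Ioc 0 1)
    (fun x hx => (hasDerivAt_cosPotDeriv hm hx.1 hx.2).continuousAt.continuousWithinAt) ?_ ?_
  all_goals
    intro x hx
    have hx' := interior_subset hx
  · exact (hasDerivAt_cosPotDeriv hm hx'.1 hx'.2).hasDerivWithinAt
  · exact cosPotDeriv2_pos hm hx'.1 hx'.2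

/-- The angle of the Lagrange central configuration. -/
noncomputable def lagrangeAngle (m : ℝ) : ℝ := arccos √((2 + m) / (2 * (1 + 2 * m)))

theorem lagrange_ratio_lt_one (hm : 0 < m) : (2 + m) / (2 * (1 + 2 * m)) < 1 := by
  rw [div_lt_one (by positivity)]
  linarith

theorem cos_lagrangeAngle (hm : 0 < m) :
    cos (lagrangeAngle m) = √((2 + m) / (2 * (1 + 2 * m))) := by
  refine cos_arccos ?_ (Real.sqrt_le_one.2 (lagrange_ratio_lt_one hm).le)
  linarith [Real.sqrt_nonneg ((2 + m) / (2 * (1 + 2 * m)))]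

theorem lagrangeAngle_pos (hm : 0 < m) : 0 < lagrangeAngle m :=
  arccos_pos.2 ((Real.sqrt_lt' one_pos).2 (by simpa using lagrange_ratio_lt_one hm))

theorem lagrangeAngle_lt (hm : 0 < m) : lagrangeAngle m < π / 2 :=
  arccos_lt_pi_div_two.2 (Real.sqrt_pos.2 (by positivity))

theorem abs_lagrangeAngle_lt (hm : 0 < m) : |lagrangeAngle m| < π / 2 := by
  rw [abs_of_pos (lagrangeAngle_pos hm)]
  exact lagrangeAngle_lt hm

theorem cosPotDeriv_cos_lagrangeAngle (hm : 0 < m) :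
    cosPotDeriv m (cos (lagrangeAngle m)) = 0 := by
  have hc := cos_pos_of_abs_lt (abs_lagrangeAngle_lt hm)
  have h2 : cos (lagrangeAngle m) ^ 2 = (2 + m) / (2 * (1 + 2 * m)) := by
    rw [cos_lagrangeAngle hm, Real.sq_sqrt (by positivity)]
  have hD : 1 / 2 + (1 - cos (lagrangeAngle m) ^ 2) / m = (√2 * cos (lagrangeAngle m)) ^ 2 := by
    rw [mul_pow, Real.sq_sqrt two_pos.le, h2]
    field_simp
    ring
  rw [cosPotDeriv, hD, Real.sqrt_sq (by positivity)]
  have h2 : (√2) ^ 2 = 2 := Real.sq_sqrt two_pos.le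
  field_simp
  linear_combination -h2

/-- The second derivative of `shapePot`. -/
noncomputable def shapePotDeriv2 (m θ : ℝ) : ℝ :=
  -cos θ * cosPotDeriv m (cos θ) + sin θ ^ 2 * cosPotDeriv2 m (cos θ)

theorem hasDerivAt_shapePotDeriv (hm : 0 < m) (hθ : |θ| < π / 2) :
    HasDerivAt (shapePotDeriv m) (shapePotDeriv2 m θ) θ := by
  have h1 := (hasDerivAt_cosPotDeriv hm (cos_pos_of_abs_lt hθ) (cos_le_one θ)).comp θ
    (hasDerivAt_cos θ)
  refine ((hasDerivAt_sin θ).neg.mul h1).congr_deriv ?_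
  rw [shapePotDeriv2]
  simp only [Function.comp_apply, Pi.neg_apply]
  ring

theorem continuousAt_shapePotDeriv2 (hm : 0 < m) (hθ : |θ| < π / 2) :
    ContinuousAt (shapePotDeriv2 m) θ := by
  have hc := cos_pos_of_abs_lt hθ
  have hD := half_add_pos hm (cos_sq_le_one θ)
  have hs := Real.sqrt_pos.2 hD
  have h1 := (hasDerivAt_cosPotDeriv hm hc (cos_le_one θ)).continuousAt
  have h2 : ContinuousAt (cosPotDeriv2 m) (cos θ) := by
    unfold cosPotDeriv2
    refine ContinuousAt.add (ContinuousAt.add ?_ ?_) ?_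
    · exact ContinuousAt.div (by fun_prop) (by fun_prop) (by positivity)
    · exact ContinuousAt.div (by fun_prop) (by fun_prop) (mul_pos hD hs).ne'
    · exact ContinuousAt.div (by fun_prop) (by fun_prop)
        (mul_pos (mul_pos hm (pow_pos hD 2)) hs).ne'
  exact (continuous_cos.neg.continuousAt.mul (h1.comp continuous_cos.continuousAt)).add
    ((continuous_sin.pow 2).continuousAt.mul (h2.comp continuous_cos.continuousAt))

theorem shapePotDeriv_lagrangeAngle (hm : 0 < m) : shapePotDeriv m (lagrangeAngle m) = 0 := by
  rw [shapePotDeriv, cosPotDeriv_cos_lagrangeAngle hm, mul_zero]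

theorem shapePotDeriv2_lagrangeAngle_pos (hm : 0 < m) :
    0 < shapePotDeriv2 m (lagrangeAngle m) := by
  have hp := lagrangeAngle_pos hm
  have hs := sin_pos_of_pos_of_lt_pi hp ((lagrangeAngle_lt hm).trans (by linarith [pi_pos]))
  have := cosPotDeriv2_pos hm (cos_pos_of_abs_lt (abs_lagrangeAngle_lt hm)) (cos_le_one _)
  rw [shapePotDeriv2, cosPotDeriv_cos_lagrangeAngle hm, mul_zero, zero_add]
  positivity

theorem shapePotDeriv2_neg : shapePotDeriv2 m (-θ) = shapePotDeriv2 m θ := by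
  rw [shapePotDeriv2, cos_neg, sin_neg, shapePotDeriv2, neg_sq]

theorem sqrt_half : √(1 / 2 + (1 - (1 : ℝ) ^ 2) / m) = √2 / 2 := by
  rw [show 1 / 2 + (1 - (1 : ℝ) ^ 2) / m = (√2 / 2) ^ 2 by
    rw [div_pow, Real.sq_sqrt two_pos.le]; norm_num, Real.sqrt_sq (by positivity)]

theorem shapePot_zero : shapePot m 0 = √2 * (1 + 4 * m) / 2 := by
  rw [shapePot, cos_zero, cosPot, sqrt_half]
  have h2 : (√2) ^ 2 = 2 := Real.sq_sqrt two_pos.le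
  field_simp
  linear_combination (-(1 + 4 * m)) * h2

theorem shapePotDeriv2_zero : shapePotDeriv2 m 0 = -(7 * √2 / 2) := by
  rw [shapePotDeriv2, cos_zero, sin_zero, cosPotDeriv, sqrt_half]
  have h2 : (√2) ^ 2 = 2 := Real.sq_sqrt two_pos.le
  norm_num
  field_simp
  linear_combination (7 : ℝ) * h2

theorem cosPotDeriv_pos_of_abs_lt (hm : 0 < m) (hθ : |θ| < lagrangeAngle m) :
    0 < cosPotDeriv m (cos θ) := by
  have h := lagrangeAngle_lt hm
  have hc := cos_pos_of_abs_lt (abs_lagrangeAngle_lt hm)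
  rw [← cosPotDeriv_cos_lagrangeAngle hm, ← cos_abs θ]
  have hlt := cos_lt_cos_of_nonneg_of_le_pi_div_two (abs_nonneg θ) h.le hθ
  exact strictMonoOn_cosPotDeriv hm ⟨hc, cos_le_one _⟩ ⟨hc.trans hlt, cos_le_one _⟩ hlt

theorem shapePotDeriv_pos_of_lt (hm : 0 < m) (h1 : lagrangeAngle m < θ) (h2 : θ < π / 2) :
    0 < shapePotDeriv m θ := by
  have hp := lagrangeAngle_pos hm
  have hc := cos_pos_of_mem_Ioo ⟨by linarith [pi_pos], h2⟩
  have hlt := cos_lt_cos_of_nonneg_of_le_pi_div_two hp.le h2.le h1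
  have h3 := strictMonoOn_cosPotDeriv hm ⟨hc, cos_le_one _⟩ ⟨hc.trans hlt, cos_le_one _⟩ hlt
  rw [cosPotDeriv_cos_lagrangeAngle hm] at h3
  have hs := sin_pos_of_pos_of_lt_pi (hp.trans h1) (by linarith [pi_pos])
  rw [shapePotDeriv]
  nlinarith

theorem shapePotDeriv_pos_of_neg (hm : 0 < m) (h1 : -lagrangeAngle m < θ) (h2 : θ < 0) :
    0 < shapePotDeriv m θ := by
  have h3 := cosPotDeriv_pos_of_abs_lt hm (abs_lt.2 ⟨h1, h2.trans (lagrangeAngle_pos hm)⟩)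
  have hs := sin_neg_of_neg_of_neg_pi_lt h2 (by linarith [pi_pos, lagrangeAngle_lt hm])
  rw [shapePotDeriv]
  nlinarith

theorem shapePot_lt_zero (hm : 0 < m) (hθ : |θ| ≤ lagrangeAngle m) (h0 : θ ≠ 0) :
    shapePot m θ < shapePot m 0 := by
  have hp := lagrangeAngle_pos hm
  have hlt := lagrangeAngle_lt hm
  have hmono : StrictMonoOn (shapePot m) (Set.Icc (-lagrangeAngle m) 0) := by
    have habs : ∀ x ∈ Set.Icc (-lagrangeAngle m) 0, |x| < π / 2 := fun x hx =>
      abs_lt.2 ⟨by linarith [hx.1], by linarith [hx.2, pi_pos]⟩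
    refine strictMonoOn_of_hasDerivWithinAt_pos (f' := shapePotDeriv m) (convex_Icc _ _)
      (fun x hx => (hasDerivAt_shapePot hm (habs x hx)).continuousAt.continuousWithinAt)
      (fun x hx => (hasDerivAt_shapePot hm
        (habs x (interior_subset hx))).hasDerivWithinAt) fun x hx => ?_
    rw [interior_Icc] at hx
    exact shapePotDeriv_pos_of_neg hm hx.1 hx.2
  have h1 : shapePot m (-|θ|) < shapePot m 0 :=
    hmono ⟨neg_le_neg hθ, by linarith [abs_nonneg θ]⟩ ⟨by linarith, le_rfl⟩
      (neg_lt_zero.2 (abs_pos.2 h0))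
  rwa [shapePot_neg, shapePot, cos_abs] at h1

end Landscape

section ClampedPotential

/-- The nearest point of the interval `[lo, hi]`. -/
noncomputable def clampTo (lo hi θ : ℝ) : ℝ := max lo (min hi θ)

variable {lo hi θ h m : ℝ}

theorem clampTo_mem (hle : lo ≤ hi) : clampTo lo hi θ ∈ Set.Icc lo hi :=
  ⟨le_max_left _ _, max_le hle (min_le_left _ _)⟩

theorem clampTo_of_mem (hθ : θ ∈ Set.Icc lo hi) : clampTo lo hi θ = θ := by
  rw [clampTo, min_eq_right hθ.2, max_eq_right hθ.1]

theorem clampTo_of_le (hθ : θ ≤ lo) : clampTo lo hi θ = lo :=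
  max_eq_left ((min_le_right _ _).trans hθ)

theorem clampTo_of_ge (hle : lo ≤ hi) (hθ : hi ≤ θ) : clampTo lo hi θ = hi := by
  rw [clampTo, min_eq_left hθ, max_eq_right hle]

theorem clampTo_eventuallyEq (hθ : θ ∈ Set.Ioo lo hi) (f : ℝ → ℝ) :
    (fun x => f (clampTo lo hi x)) =ᶠ[𝓝 θ] f := by
  filter_upwards [Ioo_mem_nhds hθ.1 hθ.2] with x hx
  rw [clampTo_of_mem ⟨hx.1.le, hx.2.le⟩]

theorem lipschitzWith_clampTo : LipschitzWith 1 (clampTo lo hi) :=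
  (LipschitzWith.id.const_min hi).const_max lo

theorem exists_lipschitzWith_clampTo {f f' : ℝ → ℝ} (hle : lo ≤ hi)
    (hf : ∀ x ∈ Set.Icc lo hi, HasDerivAt f (f' x) x) (hf' : ContinuousOn f' (Set.Icc lo hi)) :
    ∃ K : NNReal, LipschitzWith K fun x => f (clampTo lo hi x) := by
  obtain ⟨K, hK⟩ := isCompact_Icc.exists_bound_of_continuousOn hf'
  have h1 : LipschitzOnWith K.toNNReal f (Set.Icc lo hi) :=
    (convex_Icc lo hi).lipschitzOnWith_of_nnnorm_hasDerivWithin_le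
      (fun x hx => (hf x hx).hasDerivWithinAt) fun x hx => by
        rw [← NNReal.coe_le_coe]
        exact (hK x hx).trans (le_coe_toNNReal K)
  exact ⟨_, lipschitzOnWith_univ.1
    (h1.comp lipschitzWith_clampTo.lipschitzOnWith fun x _ => clampTo_mem hle)⟩

/-- Clamping the angle makes the shape potential globally regular. -/
theorem exists_shapePotential (hm : 0 < m) (hle : lo ≤ hi) (hlo : -(π / 2) < lo)
    (hhi : hi < π / 2) : ∃ c B, 0 < B ∧ ShapePotential (fun θ => shapePot m (clampTo lo hi θ))
      (fun θ => shapePotDeriv m (clampTo lo hi θ)) lo hi c B := by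
  have habs : ∀ x ∈ Set.Icc lo hi, |x| < π / 2 := fun x hx =>
    abs_lt.2 ⟨hlo.trans_le hx.1, hx.2.trans_lt hhi⟩
  have hcV : ContinuousOn (shapePot m) (Set.Icc lo hi) := fun x hx =>
    (hasDerivAt_shapePot hm (habs x hx)).continuousAt.continuousWithinAt
  have hcdV : ContinuousOn (shapePotDeriv m) (Set.Icc lo hi) := fun x hx =>
    (hasDerivAt_shapePotDeriv hm (habs x hx)).continuousAt.continuousWithinAt
  have hcddV : ContinuousOn (shapePotDeriv2 m) (Set.Icc lo hi) := fun x hx =>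
    (continuousAt_shapePotDeriv2 hm (habs x hx)).continuousWithinAt
  obtain ⟨x₀, hx₀, hmin⟩ := isCompact_Icc.exists_isMinOn (Set.nonempty_Icc.2 hle) hcV
  obtain ⟨K₁, hK₁⟩ := isCompact_Icc.exists_bound_of_continuousOn hcV
  obtain ⟨K₂, hK₂⟩ := isCompact_Icc.exists_bound_of_continuousOn hcdV
  have hmem : ∀ x, clampTo lo hi x ∈ Set.Icc lo hi := fun x => clampTo_mem hle
  have hpos := shapePot_pos hm (habs x₀ hx₀)
  have hB : ∀ x, shapePot m (clampTo lo hi x) ≤ max K₁ K₂ := fun x =>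
    (le_abs_self _).trans ((hK₁ _ (hmem x)).trans (le_max_left _ _))
  exact ⟨shapePot m x₀, max K₁ K₂, hpos.trans_le ((hmin (hmem x₀)).trans (hB x₀)),
    { lip := exists_lipschitzWith_clampTo hle
        (fun x hx => hasDerivAt_shapePot hm (habs x hx)) hcdV
      lip_deriv := exists_lipschitzWith_clampTo hle
        (fun x hx => hasDerivAt_shapePotDeriv hm (habs x hx)) hcddV
      pos := hpos
      le := fun x => hmin (hmem x)
      le_bound := hB
      abs_deriv_le := fun x => (hK₂ _ (hmem x)).trans (le_max_right _ _)
      hasDerivAt := fun x hx => by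
        have hx' := Set.Ioo_subset_Icc_self hx
        rw [clampTo_of_mem hx']
        exact (hasDerivAt_shapePot hm (habs x hx')).congr_of_eventuallyEq
          (clampTo_eventuallyEq hx _) }⟩

theorem exists_velocity_bound {c B : ℝ} (hc : 0 < c) (hB : 0 < B) :
    ∃ M, 0 < M ∧ B ≤ c * M ^ 2 := by
  refine ⟨1 + B / c, by positivity, ?_⟩
  have h1 : c * (B / c) = B := mul_div_cancel₀ _ hc.ne'
  have h2 : 0 < B / c := by positivity
  nlinarith [mul_pos hc h2, mul_pos hc (mul_pos h2 h2)]

/-- An orbit of the clamped system on which the clamping is inactive connects in the true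
system. -/
theorem shapeConnection_of_clamped {M a b : ℝ} {z : ℝ → ℝ × ℝ} (hlo : -(π / 2) < lo)
    (hhi : hi < π / 2)
    (hz : IsClampedOrbit h (fun θ => shapePot m (clampTo lo hi θ))
      (fun θ => shapePotDeriv m (clampTo lo hi θ)) M z)
    (hmem : ∀ x, (z x).1 ∈ Set.Icc lo hi) (hg : ∀ x, |(z x).2| ≤ M)
    (hbot : Tendsto z atBot (𝓝 (a, 0))) (htop : Tendsto z atTop (𝓝 (b, 0))) :
    ShapeConnection m h a b z where
  fst x := hz.fst (hg x)
  snd x := by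
    have := hz.snd (hg x)
    simp only [shapeAcc, clampTo_of_mem (hmem x)] at this
    exact this
  bound := ⟨max |lo| |hi|, by
      have hle := (hmem 0).1.trans (hmem 0).2
      exact max_lt (abs_lt.2 ⟨hlo, hle.trans_lt hhi⟩) (abs_lt.2 ⟨hlo.trans_le hle, hhi⟩),
    fun x => abs_le_max_abs_abs (hmem x).1 (hmem x).2⟩
  atBot := hbot
  atTop := htop

/-- A saddle on the left of an interval on which the potential increases is connected to every
point of the interval. -/
theorem exists_shapeConnection (hm : 0 < m) (hh : 0 < h) {q : ℝ} (hlo : -(π / 2) < lo)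
    (hhi : hi < π / 2) (hlt : lo < q) (hq : q < hi) (h0 : shapePotDeriv m lo = 0)
    (hpos : ∀ θ ∈ Set.Ioc lo q, 0 < shapePotDeriv m θ) : ∃ z, ShapeConnection m h lo q z := by
  obtain ⟨c, B, hB, hV⟩ := exists_shapePotential hm (hlt.trans hq).le hlo hhi
  obtain ⟨M, hM, hMB⟩ := exists_velocity_bound hV.pos hB
  have hIcc : ∀ θ ∈ Set.Icc lo q, θ ∈ Set.Icc lo hi := fun θ hθ => ⟨hθ.1, hθ.2.trans hq.le⟩
  obtain ⟨z, hz, hmem, hg, hbot, htop⟩ := SaddleData.exists_connection hV hh hM hMB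
    { lo_le := le_rfl
      lt := hlt
      lt_hi := hq
      deriv_eq := by rwa [clampTo_of_le le_rfl]
      le_left := fun θ hθ => by rw [clampTo_of_le hθ, clampTo_of_le le_rfl]
      deriv_pos := fun θ hθ => by
        rw [clampTo_of_mem (hIcc θ ⟨hθ.1.le, hθ.2⟩)]
        exact hpos θ hθ }
  exact ⟨z, shapeConnection_of_clamped hlo hhi hz (fun x => hIcc _ (hmem x)) hg hbot htop⟩

end ClampedPotential

section SpiralCriterion

/-- A sufficiently sharp maximum of the potential makes the orbits spiral. -/
theorem isSpiralling_of_hasDerivAt {h a c : ℝ} {V dV : ℝ → ℝ} (hh : 0 < h) (hc : 0 < c)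
    (hV : ∀ θ, c ≤ V θ) (hcont : ContinuousAt V 0) (hd : HasDerivAt dV a 0) (h0 : dV 0 = 0)
    (ha : V 0 < 8 * -a) : IsSpiralling h V dV := by
  have hV0 : 0 < V 0 := hc.trans_le (hV 0)
  obtain ⟨σ, hσ, hσ1⟩ : ∃ σ : ℝ, σ ^ 8 * V 0 < 8 * -a ∧ 1 < σ := by
    have h1 : ContinuousAt (fun σ : ℝ => σ ^ 8 * V 0) 1 := by fun_prop
    have h2 : ∀ᶠ σ in 𝓝 (1 : ℝ), σ ^ 8 * V 0 < 8 * -a :=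
      h1.eventually (gt_mem_nhds (by simpa using ha))
    exact ((h2.filter_mono nhdsWithin_le_nhds).and (self_mem_nhdsWithin (s := Set.Ioi 1))).exists
  have hσ0 : 0 < σ := one_pos.trans hσ1
  have ha0 : 0 < -a := by linarith
  have hVσ : V 0 < σ * V 0 := lt_mul_of_one_lt_left hV0 hσ1
  have hak : -a / σ < -a := div_lt_self ha0 hσ1
  have e1 : ∀ᶠ θ in 𝓝 (0 : ℝ), V θ < (V 0 + σ * V 0) / 2 :=
    hcont.eventually (gt_mem_nhds (by linarith))
  have e2 : ∀ᶠ θ in 𝓝 (0 : ℝ), -a / σ * θ ^ 2 ≤ -(θ * dV θ) := by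
    have := (hasDerivAt_iff_isLittleO.1 hd).def (sub_pos.2 hak)
    filter_upwards [this] with θ hθ
    simp only [h0, sub_zero, smul_eq_mul, norm_eq_abs] at hθ
    have h1 := mul_le_mul_of_nonneg_left hθ (abs_nonneg θ)
    rw [← abs_mul] at h1
    have h2 := (le_abs_self _).trans h1
    nlinarith [abs_mul_abs_self θ]
  have e3 : ∀ᶠ g in 𝓝 (0 : ℝ), 1 + g ^ 2 < σ := by
    have h1 : ContinuousAt (fun g : ℝ => 1 + g ^ 2) 0 := by fun_prop
    exact h1.eventually (gt_mem_nhds (by simpa using hσ1))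
  have e4 : ∀ᶠ x in atBot, h * exp x < min ((σ * V 0 - V 0) / 2) ((σ - 1) * c) := by
    have h1 := tendsto_exp_atBot.const_mul h
    rw [mul_zero] at h1
    exact h1.eventually (gt_mem_nhds
      (lt_min (by linarith) (mul_pos (by linarith) hc)))
  obtain ⟨ρ, hρ, hball⟩ := Metric.eventually_nhds_iff.1 (e1.and (e2.and e3))
  obtain ⟨K, hK⟩ := eventually_atBot.1 e4
  have hinv : 0 < 1 - 1 / σ := sub_pos.2 ((div_lt_one hσ0).2 hσ1)
  refine ⟨ρ / 2, half_pos hρ, (1 - 1 / σ) / 16, by positivity, max 0 (-K), le_max_left _ _,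
    fun x hx θ g hθ hg => ?_⟩
  obtain ⟨hVθ, hdV, -⟩ := hball (show dist θ 0 < ρ by
    rw [dist_zero_right, norm_eq_abs]; linarith)
  obtain ⟨-, -, hgσ⟩ := hball (show dist g 0 < ρ by
    rw [dist_zero_right, norm_eq_abs]; linarith)
  have hx1 := hK x (by linarith [le_max_right 0 (-K)])
  have hx2 := hx1.trans_le (min_le_left _ _)
  have hx3 := hx1.trans_le (min_le_right _ _)
  have hex : 0 < h * exp x := mul_pos hh (exp_pos x)
  set D := V θ + h * exp x with hD
  have hDc : c ≤ D := by linarith [hV θ]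
  have hD0 : 0 < D := hc.trans_le hDc
  have hDσ : D ≤ σ * V 0 := by linarith
  have hκ : σ ^ 6 / 8 * θ ^ 2 ≤ -(θ * dV θ) / D := by
    rw [le_div_iff₀ hD0]
    refine le_trans ?_ hdV
    have h1 : σ ^ 6 / 8 * D ≤ -a / σ := by
      rw [le_div_iff₀ hσ0]
      have := mul_le_mul_of_nonneg_left hDσ (by positivity : 0 ≤ σ ^ 7)
      nlinarith
    nlinarith [mul_le_mul_of_nonneg_right h1 (sq_nonneg θ)]
  have hr : 1 + h * exp x / D ≤ σ := by
    have : h * exp x / D ≤ σ - 1 := by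
      rw [div_le_iff₀ hD0]
      exact hx3.le.trans (mul_le_mul_of_nonneg_left hDc (by linarith))
    linarith
  have hr0 : 0 < 1 + h * exp x / D := by positivity
  have hprod : (1 + g ^ 2) * (1 + h * exp x / D) ≤ σ ^ 2 := by
    rw [pow_two σ]
    exact mul_le_mul hgσ.le hr hr0.le hσ0.le
  have hcross : -(σ ^ 2 * (|θ| * |g|)) ≤ (1 + g ^ 2) * (1 + h * exp x / D) * (θ * g) := by
    have h1 : |(1 + g ^ 2) * (1 + h * exp x / D) * (θ * g)| ≤ σ ^ 2 * (|θ| * |g|) := by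
      rw [abs_mul, abs_mul θ g, abs_of_pos (by positivity)]
      exact mul_le_mul_of_nonneg_right hprod (by positivity)
    exact (abs_le.1 h1).1
  have hforce : σ ^ 6 / 8 * θ ^ 2 ≤ (1 + g ^ 2) * (-(θ * dV θ) / D) := by
    have : 0 ≤ σ ^ 6 / 8 * θ ^ 2 := by positivity
    nlinarith [mul_nonneg (sq_nonneg g) (this.trans hκ)]
  have hacc : g ^ 2 - θ * shapeAcc h V dV x θ g = g ^ 2 + ((1 + g ^ 2) * (-(θ * dV θ) / D) +
      (1 + g ^ 2) * (1 + h * exp x / D) * (θ * g)) / 2 := by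
    rw [shapeAcc, ← hD]
    ring
  have hamgm : σ ^ 2 * (|θ| * |g|) ≤ 2 * (g ^ 2 / σ) + σ ^ 5 / 8 * θ ^ 2 := by
    have h1 : 2 * (g ^ 2 / σ) + σ ^ 5 / 8 * θ ^ 2 - σ ^ 2 * (|θ| * |g|) =
        (|g| - σ ^ 3 / 4 * |θ|) ^ 2 * (2 / σ) := by
      rw [← sq_abs g, ← sq_abs θ]
      field_simp
      ring
    have h2 : 0 ≤ (|g| - σ ^ 3 / 4 * |θ|) ^ 2 * (2 / σ) := by positivity
    linarith
  rw [hacc]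
  have h6 : 1 ≤ σ ^ 6 := one_le_pow₀ hσ1.le
  have h5 : σ ^ 6 * (1 - 1 / σ) = σ ^ 6 - σ ^ 5 := by
    field_simp
  have h7 : g ^ 2 * (1 - 1 / σ) = g ^ 2 - g ^ 2 / σ := by ring
  have h8 := mul_le_mul_of_nonneg_right h6 (mul_nonneg hinv.le (sq_nonneg θ))
  have h9 := mul_nonneg hinv.le (sq_nonneg g)
  have h10 : σ ^ 6 * ((1 - 1 / σ) * θ ^ 2) = (σ ^ 6 - σ ^ 5) * θ ^ 2 := by rw [← h5]; ring
  linarith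

end SpiralCriterion

section EulerConnections

variable {m h θ : ℝ}

theorem shapePotDeriv_ne_zero (hm : 0 < m) (hθ : |θ| < lagrangeAngle m) (h0 : θ ≠ 0) :
    shapePotDeriv m θ ≠ 0 := by
  obtain ⟨h1, h2⟩ := abs_lt.1 hθ
  rcases h0.lt_or_gt with hneg | hpos
  · exact (shapePotDeriv_pos_of_neg hm h1 hneg).ne'
  · have := shapePotDeriv_pos_of_neg hm (neg_lt_neg h2) (neg_lt_zero.2 hpos)
    rw [shapePotDeriv_neg] at this
    linarith

theorem shapePotDeriv_zero : shapePotDeriv m 0 = 0 := by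
  rw [shapePotDeriv, sin_zero, neg_zero, zero_mul]

theorem centralPeak (hm : 0 < m) :
    CentralPeak (fun θ => shapePot m (clampTo (-lagrangeAngle m) (lagrangeAngle m) θ))
      (fun θ => shapePotDeriv m (clampTo (-lagrangeAngle m) (lagrangeAngle m) θ))
      (lagrangeAngle m) := by
  have hp := lagrangeAngle_pos hm
  have hlt := lagrangeAngle_lt hm
  have hle : -lagrangeAngle m ≤ lagrangeAngle m := by linarith
  have h0 : (0 : ℝ) ∈ Set.Icc (-lagrangeAngle m) (lagrangeAngle m) := ⟨by linarith, hp.le⟩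
  have habs : ∀ x ∈ Set.Icc (-lagrangeAngle m) (lagrangeAngle m), |x| < π / 2 := fun x hx =>
    (abs_le.2 hx).trans_lt hlt
  obtain ⟨K, hK⟩ := isCompact_Icc.exists_bound_of_continuousOn fun x hx =>
    (continuousAt_shapePotDeriv2 hm (habs x hx)).continuousWithinAt
  exact
    { pos := hp
      mem_of_lt := fun θ hθ => by
        rw [clampTo_of_le le_rfl] at hθ
        by_contra hmem
        rw [Set.mem_Ioo, not_and_or, not_lt, not_lt] at hmem
        rcases hmem with h1 | h1
        · rw [clampTo_of_le h1] at hθ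
          exact hθ.false
        · rw [clampTo_of_ge hle h1, shapePot_neg] at hθ
          exact hθ.false
      exists_deriv2 := ⟨shapePotDeriv2 m, K, fun x hx =>
        have hx' := Set.Ioo_subset_Icc_self hx
        ⟨(hasDerivAt_shapePotDeriv hm (habs x hx')).congr_of_eventuallyEq
          (clampTo_eventuallyEq hx _), hK x hx'⟩⟩
      deriv_zero := by rw [clampTo_of_mem h0, shapePotDeriv_zero]
      eq_zero := fun x hx hd => by
        rw [clampTo_of_mem (Set.Ioo_subset_Icc_self hx)] at hd
        by_contra hne
        exact shapePotDeriv_ne_zero hm (abs_lt.2 hx) hne hd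
      lt_peak := fun x hx hne => by
        rw [clampTo_of_mem hx, clampTo_of_mem h0]
        exact shapePot_lt_zero hm (abs_le.2 hx) hne }

/-- Close to the left Lagrange angle the force and its logarithmic version increase. -/
theorem exists_monotoneForce (hm : 0 < m) : ∃ q, -lagrangeAngle m < q ∧ q < 0 ∧
    MonotoneForce (shapePot m) (shapePotDeriv m) (-lagrangeAngle m) q := by
  have hp := lagrangeAngle_pos hm
  have hlt := lagrangeAngle_lt hm
  have habs : |-lagrangeAngle m| < π / 2 := by rw [abs_neg]; exact abs_lagrangeAngle_lt hm
  have cV := (hasDerivAt_shapePot hm habs).continuousAt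
  have cdV := (hasDerivAt_shapePotDeriv hm habs).continuousAt
  have cddV := continuousAt_shapePotDeriv2 hm habs
  have hV0 := shapePot_pos hm habs
  have hd0 : shapePotDeriv m (-lagrangeAngle m) = 0 := by
    rw [shapePotDeriv_neg, shapePotDeriv_lagrangeAngle hm, neg_zero]
  have hdd0 : 0 < shapePotDeriv2 m (-lagrangeAngle m) := by
    rw [shapePotDeriv2_neg]
    exact shapePotDeriv2_lagrangeAngle_pos hm
  have e1 : ∀ᶠ x in 𝓝 (-lagrangeAngle m), shapePotDeriv m x < shapePot m x :=
    cdV.eventually_lt cV (by rwa [hd0])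
  have e2 : ∀ᶠ x in 𝓝 (-lagrangeAngle m),
      shapePotDeriv m x * shapePotDeriv m x < shapePotDeriv2 m x * shapePot m x :=
    (cdV.mul cdV).eventually_lt (cddV.mul cV) (by
      rw [Pi.mul_apply, hd0, zero_mul]
      exact mul_pos hdd0 hV0)
  obtain ⟨ε, hε, hball⟩ := Metric.eventually_nhds_iff.1 (e1.and e2)
  obtain ⟨q, hq1, hq2⟩ := exists_between
    (lt_min (neg_lt_zero.2 hp) (lt_add_of_pos_right (-lagrangeAngle m) hε))
  have hq0 := hq2.trans_le (min_le_left _ _)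
  have hqε := hq2.trans_le (min_le_right _ _)
  have hab : ∀ x ∈ Set.Icc (-lagrangeAngle m) q, |x| < π / 2 := fun x hx =>
    abs_lt.2 ⟨by linarith [hx.1], by linarith [hx.2, pi_pos]⟩
  have hnear : ∀ x ∈ Set.Icc (-lagrangeAngle m) q, shapePotDeriv m x < shapePot m x ∧
      shapePotDeriv m x * shapePotDeriv m x < shapePotDeriv2 m x * shapePot m x := fun x hx =>
    hball (by
      rw [Real.dist_eq, abs_of_nonneg (by linarith [hx.1])]
      linarith [hx.2])
  have hpos : ∀ x ∈ Set.Icc (-lagrangeAngle m) q, 0 < shapePot m x := fun x hx =>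
    shapePot_pos hm (hab x hx)
  have hdV : ∀ x ∈ Set.Icc (-lagrangeAngle m) q,
      HasDerivAt (shapePotDeriv m) (shapePotDeriv2 m x) x := fun x hx =>
    hasDerivAt_shapePotDeriv hm (hab x hx)
  have hquot : ∀ x ∈ Set.Icc (-lagrangeAngle m) q,
      HasDerivAt (fun x => shapePotDeriv m x / shapePot m x)
        ((shapePotDeriv2 m x * shapePot m x - shapePotDeriv m x * shapePotDeriv m x) /
          shapePot m x ^ 2) x := fun x hx =>
    (hdV x hx).div (hasDerivAt_shapePot hm (hab x hx)) (hpos x hx).ne'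
  have hratio : MonotoneOn (fun x => shapePotDeriv m x / shapePot m x)
      (Set.Icc (-lagrangeAngle m) q) :=
    monotoneOn_of_hasDerivWithinAt_nonneg (convex_Icc _ _)
      (fun x hx => (hquot x hx).continuousAt.continuousWithinAt)
      (fun x hx => (hquot x (interior_subset hx)).hasDerivWithinAt) fun x hx =>
        div_nonneg (sub_nonneg.2 (hnear x (interior_subset hx)).2.le) (sq_nonneg _)
  refine ⟨q, hq1, hq0, ?_, fun a ha b hb hle => ?_, fun a ha => (hnear a ha).1.le⟩
  · refine monotoneOn_of_hasDerivWithinAt_nonneg (convex_Icc _ _)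
      (fun x hx => (hdV x hx).continuousAt.continuousWithinAt)
      (fun x hx => (hdV x (interior_subset hx)).hasDerivWithinAt) fun x hx => ?_
    have hx' := interior_subset hx
    exact (pos_of_mul_pos_left ((mul_self_nonneg _).trans_lt (hnear x hx').2) (hpos x hx').le).le
  · exact (div_le_div_iff₀ (hpos a ha) (hpos b hb)).1 (hratio ha hb hle)

/-- Below the critical mass ratio there are infinitely many connections to the Euler shape. -/
theorem exists_infinite_shapeConnections (hm : 0 < m) (hh : 0 < h) (hm' : m < 55 / 4) :
    ∃ y : ℕ → ℝ → ℝ × ℝ, (∀ i, ShapeConnection m h (-lagrangeAngle m) 0 (y i)) ∧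
      ∀ i j, i ≠ j → (fun x => (y i x).1) ≠ fun x => (y j x).1 := by
  have hp := lagrangeAngle_pos hm
  have hlt := lagrangeAngle_lt hm
  have hle : -lagrangeAngle m ≤ lagrangeAngle m := by linarith
  have hlo : -(π / 2) < -lagrangeAngle m := neg_lt_neg hlt
  have h0 : (0 : ℝ) ∈ Set.Ioo (-lagrangeAngle m) (lagrangeAngle m) := ⟨by linarith, hp⟩
  have h0' := Set.Ioo_subset_Icc_self h0
  have habs : |(0 : ℝ)| < π / 2 := by rw [abs_zero]; linarith
  obtain ⟨c, B, hB, hV⟩ := exists_shapePotential hm hle hlo hlt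
  obtain ⟨M, hM, hMB⟩ := exists_velocity_bound hV.pos hB
  obtain ⟨q, hq, hq0, hmon⟩ := exists_monotoneForce hm
  have hIcc : ∀ θ ∈ Set.Icc (-lagrangeAngle m) q,
      θ ∈ Set.Icc (-lagrangeAngle m) (lagrangeAngle m) := fun θ hθ =>
    ⟨hθ.1, by linarith [hθ.2]⟩
  have hspir := isSpiralling_of_hasDerivAt hh hV.pos hV.le
    (((hasDerivAt_shapePot hm habs).congr_of_eventuallyEq
      (clampTo_eventuallyEq h0 _)).continuousAt)
    ((hasDerivAt_shapePotDeriv hm habs).congr_of_eventuallyEq (clampTo_eventuallyEq h0 _))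
    (by rw [clampTo_of_mem h0', shapePotDeriv_zero]) (by
      rw [clampTo_of_mem h0', shapePot_zero, shapePotDeriv2_zero]
      have := Real.sqrt_pos.2 (two_pos (α := ℝ))
      nlinarith)
  obtain ⟨y, hy, hne⟩ := CentralPeak.exists_infinite_connections hV hh hM hMB (centralPeak hm)
    (q := q)
    { lo_le := le_rfl
      lt := hq
      lt_hi := hq0.trans hp
      deriv_eq := by
        rw [clampTo_of_le le_rfl, shapePotDeriv_neg, shapePotDeriv_lagrangeAngle hm, neg_zero]
      le_left := fun θ hθ => by rw [clampTo_of_le hθ, clampTo_of_le le_rfl]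
      deriv_pos := fun θ hθ => by
        rw [clampTo_of_mem (hIcc θ ⟨hθ.1.le, hθ.2⟩)]
        exact shapePotDeriv_pos_of_neg hm hθ.1 (hθ.2.trans_lt hq0) }
    { mono := fun a ha b hb hab => by
        simp only [clampTo_of_mem (hIcc a ha), clampTo_of_mem (hIcc b hb)]
        exact hmon.mono ha hb hab
      ratio := fun a ha b hb hab => by
        simp only [clampTo_of_mem (hIcc a ha), clampTo_of_mem (hIcc b hb)]
        exact hmon.ratio a ha b hb hab
      le := fun a ha => by
        simp only [clampTo_of_mem (hIcc a ha)]
        exact hmon.le a ha }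
    hq0 hspir
  refine ⟨y, fun i => ?_, hne⟩
  obtain ⟨horb, hmem, hg, hbot, htop⟩ := hy i
  exact shapeConnection_of_clamped hlo hlt horb hmem hg hbot htop

end EulerConnections

section Heteroclinic

variable {m h θ u a b : ℝ}

theorem strictMonoOn_regShape : StrictMonoOn regShape (Set.Ioo (-(π / 2)) (π / 2)) := by
  have habs : ∀ x ∈ Set.Ioo (-(π / 2)) (π / 2), |x| < π / 2 := fun x hx => abs_lt.2 hx
  refine strictMonoOn_of_hasDerivWithinAt_pos
    (f' := fun θ => √(1 + cos (regShape θ) ^ 2) / (2 * cos (regShape θ))) (convex_Ioo _ _)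
    (fun x hx => (hasDerivAt_regShape (habs x hx)).continuousAt.continuousWithinAt)
    (fun x hx => (hasDerivAt_regShape (habs x (interior_subset hx))).hasDerivWithinAt)
    fun x hx => ?_
  have := cos_regShape_pos (habs x (interior_subset hx))
  positivity

theorem exists_regShape_eq (hu : u ∈ Set.Ioo (-(π / 2)) (π / 2)) :
    ∃ θ ∈ Set.Ioo (-(π / 2)) (π / 2), regShape θ = u := by
  have h2 : √2 * √2 = 2 := Real.mul_self_sqrt two_pos.le
  have h1 : regShape (π / 2) = π / 2 := by
    rw [regShape, show π / 2 / 2 = π / 4 by ring, sin_pi_div_four,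
      show √2 * (√2 / 2) = 1 by linarith, arcsin_one]
  refine intermediate_value_Ioo (by linarith [pi_pos]) continuous_regShape.continuousOn ?_
  rwa [regShape_neg, h1]

theorem regShape_lagrangeAngle (hm : 0 < m) :
    regShape (lagrangeAngle m) = arccos (((2 + m) / (2 * (1 + 2 * m))) ^ ((1 : ℝ) / 4)) := by
  have hp := lagrangeAngle_pos hm
  have hlt := lagrangeAngle_lt hm
  have h0 : regShape 0 = 0 := by simp [regShape]
  have hpos : 0 < regShape (lagrangeAngle m) := by
    rw [← h0]
    exact strictMonoOn_regShape ⟨by linarith, by linarith⟩ ⟨by linarith, hlt⟩ hp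
  have hle : regShape (lagrangeAngle m) ≤ π := (arcsin_le_pi_div_two _).trans (by linarith)
  rw [← arccos_cos hpos.le hle, cos_regShape, cos_lagrangeAngle hm, Real.sqrt_eq_rpow,
    Real.sqrt_eq_rpow, ← Real.rpow_mul (by positivity)]
  norm_num

theorem sqrt_shapePot (hm : 0 < m) (hθ : |θ| < π / 2) :
    √(2 * Wpot m (regShape θ)) / cos (regShape θ) = √(2 * shapePot m θ) := by
  have hc := cos_regShape_pos hθ
  rw [Wpot_eq hm hc, cos_regShape_sq hθ, ← shapePot, ← cos_regShape_sq hθ,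
    show 2 * (cos (regShape θ) ^ 2 * shapePot m θ) =
      cos (regShape θ) ^ 2 * (2 * shapePot m θ) by ring,
    Real.sqrt_mul (sq_nonneg _), Real.sqrt_sq hc.le, mul_div_cancel_left₀ _ hc.ne']

/-- The equilibrium at the Lagrange angle. -/
theorem shapeConnection_const (hm : 0 < m) :
    ShapeConnection m h (lagrangeAngle m) (lagrangeAngle m) fun _ => (lagrangeAngle m, 0) where
  fst x := hasDerivAt_const x _
  snd x := (hasDerivAt_const x (0 : ℝ)).congr_deriv (by
    simp only [shapeAcc, shapePotDeriv_lagrangeAngle hm]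
    ring)
  bound := ⟨_, abs_lagrangeAngle_lt hm, fun _ => le_rfl⟩
  atBot := tendsto_const_nhds
  atTop := tendsto_const_nhds

theorem exists_shapeConnection_lagrangeAngle (hm : 0 < m) (hh : 0 < h)
    (hθ : θ ∈ Set.Ioo 0 (π / 2)) : ∃ z, ShapeConnection m h (lagrangeAngle m) θ z := by
  have hp := lagrangeAngle_pos hm
  have hlt := lagrangeAngle_lt hm
  rcases lt_trichotomy θ (lagrangeAngle m) with h1 | rfl | h1
  · obtain ⟨z, hz⟩ := exists_shapeConnection hm hh (neg_lt_neg hlt) hlt (neg_lt_neg h1)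
      (by linarith [hθ.1] : -θ < lagrangeAngle m)
      (by rw [shapePotDeriv_neg, shapePotDeriv_lagrangeAngle hm, neg_zero])
      fun x hx => shapePotDeriv_pos_of_neg hm hx.1 (by linarith [hx.2, hθ.1])
    have := hz.neg
    rw [neg_neg, neg_neg] at this
    exact ⟨_, this⟩
  · exact ⟨_, shapeConnection_const hm⟩
  · obtain ⟨hi, hhi, hhi'⟩ := exists_between hθ.2
    exact exists_shapeConnection hm hh (by linarith) hhi' h1 hhi (shapePotDeriv_lagrangeAngle hm)
      fun x hx => shapePotDeriv_pos_of_lt hm hx.1 (hx.2.trans_lt hθ.2)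

/-- Infinitely many distinct connections yield solutions that are not time translates. -/
theorem exists_infinite_solutions (hm : 0 < m) (hh : 0 < h) {y : ℕ → ℝ → ℝ × ℝ}
    (hy : ∀ i, ShapeConnection m h a b (y i))
    (hne : ∀ i j, i ≠ j → (fun x => (y i x).1) ≠ fun x => (y j x).1) :
    ∃ S V U Wf : ℕ → ℝ → ℝ,
      (∀ i : ℕ, IsSolution m h (S i) (V i) (U i) (Wf i) ∧
        SatisfiesEnergy m h (S i) (V i) (U i) (Wf i) ∧
        Tendsto (fun τ => (S i τ, V i τ, U i τ, Wf i τ)) Filter.atBot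
          (𝓝 (0, √(2 * shapePot m a), regShape a, 0)) ∧
        Tendsto (fun τ => (S i τ, V i τ, U i τ, Wf i τ)) Filter.atTop
          (𝓝 (1, √(2 * h), regShape b, 0))) ∧
      (∀ i j : ℕ, i ≠ j → ∀ c : ℝ, ¬ ∀ τ : ℝ,
        (S i τ, V i τ, U i τ, Wf i τ) =
          (S j (τ + c), V j (τ + c), U j (τ + c), Wf j (τ + c))) := by
  choose S V U Wf X h1 h2 h3 h4 h5 h6 using fun i => (hy i).exists_solution hm hh
  refine ⟨S, V, U, Wf, fun i => ⟨h1 i, h2 i, h3 i, h4 i⟩, fun i j hij c heq => hne i j hij ?_⟩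
  funext x
  obtain ⟨τ, rfl⟩ := (X i).surjective x
  have hτ := heq τ
  simp only [Prod.mk.injEq, h5, h6] at hτ
  have hX : X i τ = X j (τ + c) := sigmoid_strictMono.injective hτ.1
  have := strictMonoOn_regShape.injOn (abs_lt.1 ((hy i).abs_lt _)) (abs_lt.1 ((hy j).abs_lt _))
    hτ.2.2.1
  rw [this, hX]

end Heteroclinic

/-- heteroclinic connections from the Lagrange triple collision restpoints
`L₊ = (0, v₊, l₊, 0)` and `L₋ = (0, v₊, -l₊, 0)` to the restpoints `(1, √(2h), u₁, 0)`
on the infinity manifold: for every `u₁ ∈ (0, π/2)` there is such a connection from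
`L₊`, for every `u₁ ∈ (-π/2, 0)` one from `L₋`, and if `m3 < 55/4` there are infinitely
many pairwise non-time-translate heteroclinic orbits from `L₊` (and likewise from `L₋`)
to the Euler restpoint `(1, √(2h), 0, 0)`. -/
theorem stmt19 (m3 h : ℝ) (hm3 : 0 < m3) (hh : 0 < h) (lp vp : ℝ)
    (hlp : lp = Real.arccos (((2 + m3) / (2 * (1 + 2 * m3))) ^ ((1 : ℝ) / 4)))
    (hvp : vp = Real.sqrt (2 * Wpot m3 lp) / Real.cos lp) :
    (∀ u1 ∈ Set.Ioo (0 : ℝ) (Real.pi / 2), ∃ s v u w : ℝ → ℝ,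
      IsSolution m3 h s v u w ∧ SatisfiesEnergy m3 h s v u w ∧
      Tendsto (fun τ => (s τ, v τ, u τ, w τ)) atBot
        (nhds ((0 : ℝ), vp, lp, (0 : ℝ))) ∧
      Tendsto (fun τ => (s τ, v τ, u τ, w τ)) atTop
        (nhds ((1 : ℝ), Real.sqrt (2 * h), u1, (0 : ℝ)))) ∧
    (∀ u1 ∈ Set.Ioo (-(Real.pi / 2)) (0 : ℝ), ∃ s v u w : ℝ → ℝ,
      IsSolution m3 h s v u w ∧ SatisfiesEnergy m3 h s v u w ∧
      Tendsto (fun τ => (s τ, v τ, u τ, w τ)) atBot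
        (nhds ((0 : ℝ), vp, -lp, (0 : ℝ))) ∧
      Tendsto (fun τ => (s τ, v τ, u τ, w τ)) atTop
        (nhds ((1 : ℝ), Real.sqrt (2 * h), u1, (0 : ℝ)))) ∧
    (m3 < 55 / 4 →
      (∃ S V U Wf : ℕ → ℝ → ℝ,
        (∀ i : ℕ, IsSolution m3 h (S i) (V i) (U i) (Wf i) ∧
          SatisfiesEnergy m3 h (S i) (V i) (U i) (Wf i) ∧
          Tendsto (fun τ => (S i τ, V i τ, U i τ, Wf i τ)) atBot
            (nhds ((0 : ℝ), vp, lp, (0 : ℝ))) ∧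
          Tendsto (fun τ => (S i τ, V i τ, U i τ, Wf i τ)) atTop
            (nhds ((1 : ℝ), Real.sqrt (2 * h), (0 : ℝ), (0 : ℝ)))) ∧
        (∀ i j : ℕ, i ≠ j → ∀ c : ℝ, ¬ ∀ τ : ℝ,
          (S i τ, V i τ, U i τ, Wf i τ) =
            (S j (τ + c), V j (τ + c), U j (τ + c), Wf j (τ + c)))) ∧
      (∃ S V U Wf : ℕ → ℝ → ℝ,
        (∀ i : ℕ, IsSolution m3 h (S i) (V i) (U i) (Wf i) ∧
          SatisfiesEnergy m3 h (S i) (V i) (U i) (Wf i) ∧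
          Tendsto (fun τ => (S i τ, V i τ, U i τ, Wf i τ)) atBot
            (nhds ((0 : ℝ), vp, -lp, (0 : ℝ))) ∧
          Tendsto (fun τ => (S i τ, V i τ, U i τ, Wf i τ)) atTop
            (nhds ((1 : ℝ), Real.sqrt (2 * h), (0 : ℝ), (0 : ℝ)))) ∧
        (∀ i j : ℕ, i ≠ j → ∀ c : ℝ, ¬ ∀ τ : ℝ,
          (S i τ, V i τ, U i τ, Wf i τ) =
            (S j (τ + c), V j (τ + c), U j (τ + c), Wf j (τ + c))))) := by
  have hL := regShape_lagrangeAngle hm3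
  rw [← hlp] at hL
  have hV : √(2 * shapePot m3 (lagrangeAngle m3)) = vp := by
    rw [hvp, ← hL, sqrt_shapePot hm3 (abs_lagrangeAngle_lt hm3)]
  have hV' : √(2 * shapePot m3 (-lagrangeAngle m3)) = vp := by rw [shapePot_neg, hV]
  have hL' : regShape (-lagrangeAngle m3) = -lp := by rw [regShape_neg, hL]
  have h0 : regShape 0 = 0 := by simp [regShape]
  have key : ∀ u1 ∈ Set.Ioo (0 : ℝ) (π / 2),
      ∃ z θ, regShape θ = u1 ∧ ShapeConnection m3 h (lagrangeAngle m3) θ z := fun u1 hu => by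
    obtain ⟨θ, hθ, rfl⟩ := exists_regShape_eq ⟨by linarith [hu.1, pi_pos], hu.2⟩
    have hpos : 0 < θ := by
      rw [← h0] at hu
      exact (strictMonoOn_regShape.lt_iff_lt ⟨by linarith [pi_pos], by linarith [pi_pos]⟩ hθ).1 hu.1
    obtain ⟨z, hz⟩ := exists_shapeConnection_lagrangeAngle hm3 hh ⟨hpos, hθ.2⟩
    exact ⟨z, θ, rfl, hz⟩
  refine ⟨fun u1 hu => ?_, fun u1 hu => ?_, fun hm' => ?_⟩
  · obtain ⟨z, θ, rfl, hz⟩ := key u1 hu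
    obtain ⟨s, v, u, w, -, h1, h2, h3, h4, -⟩ := hz.exists_solution hm3 hh
    rw [hV, hL] at h3
    exact ⟨s, v, u, w, h1, h2, h3, h4⟩
  · obtain ⟨z, θ, hθ, hz⟩ := key (-u1) ⟨by linarith [hu.2], by linarith [hu.1]⟩
    obtain ⟨s, v, u, w, -, h1, h2, h3, h4, -⟩ := hz.neg.exists_solution hm3 hh
    rw [hV', hL'] at h3
    rw [regShape_neg, hθ, neg_neg] at h4
    exact ⟨s, v, u, w, h1, h2, h3, h4⟩
  · obtain ⟨y, hy, hne⟩ := exists_infinite_shapeConnections hm3 hh hm'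
    have hy' : ∀ i, ShapeConnection m3 h (lagrangeAngle m3) 0 fun x => -y i x := fun i => by
      simpa using (hy i).neg
    have h5 := exists_infinite_solutions hm3 hh hy' fun i j hij heq => hne i j hij
      (funext fun x => neg_injective (congrFun heq x))
    have h6 := exists_infinite_solutions hm3 hh hy hne
    rw [hV, hL, h0] at h5
    rw [hV', hL', h0] at h6
    exact ⟨h5, h6⟩
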